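/- Fix an integer k ≥ 3. There exists a constant C > 0 such that the proportion of labelled C_k-free oriented graphs G on [n] with b(G) ≤ C·n tends to 1 as n → ∞; that is, almost all C_k-free oriented graphs have O(n) backwards arcs in a transitive-optimal ordering. -/

import Mathlib

open scoped Classical

/-- An arc set on `Fin n`: a digraph on vertex set `[n]` is identified with its
finite set of arcs. -/
abbrev ArcSet (n : ℕ) := Finset (Fin n × Fin n)

/-- A digraph is loopless. -/
def IsLoopless {n : ℕ} (E : ArcSet n) : Prop := ∀ v : Fin n, (v, v) ∉ E

/-- An oriented graph: loopless and at most one of the arcs `(u,v)`, `(v,u)`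
is present for each pair. -/
def IsOriented {n : ℕ} (E : ArcSet n) : Prop :=
  IsLoopless E ∧ ∀ u v : Fin n, (u, v) ∈ E → (v, u) ∉ E

/-- `E` contains a (not necessarily induced) copy of the directed cycle `C_k`. -/
def ContainsCycle {n : ℕ} (k : ℕ) (E : ArcSet n) : Prop :=
  ∃ f : ZMod k → Fin n, Function.Injective f ∧ ∀ i : ZMod k, (f i, f (i + 1)) ∈ E

/-- `E` is `C_k`-free. -/
def CkFree {n : ℕ} (k : ℕ) (E : ArcSet n) : Prop := ¬ ContainsCycle k E

/-- The number of backwards arcs of `E` with respect to the ordering `σ`: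
arcs `(u,v)` with `σ u > σ v`. -/
def backCount {n : ℕ} (E : ArcSet n) (σ : Equiv.Perm (Fin n)) : ℕ :=
  (E.filter fun e => σ e.2 < σ e.1).card

/-- `b(E)`: the minimum number of backwards arcs over all orderings, i.e. the
number of backwards arcs in a transitive-optimal ordering. -/
noncomputable def bMin {n : ℕ} (E : ArcSet n) : ℕ :=
  Finset.univ.inf' Finset.univ_nonempty (backCount E)

/-- The number of labelled `C_k`-free oriented graphs on `[n]`. -/
noncomputable def fnk (n k : ℕ) : ℕ :=
  (Finset.univ.filter fun E : ArcSet n => IsOriented E ∧ CkFree k E).card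

namespace BackArcs

/-- The real indicator of a proposition. -/
noncomputable def ind (p : Prop) : ℝ := if p then 1 else 0

lemma ind_nonneg (p : Prop) : 0 ≤ ind p := by unfold ind; split_ifs <;> norm_num
lemma ind_le_one (p : Prop) : ind p ≤ 1 := by unfold ind; split_ifs <;> norm_num
lemma ind_true {p : Prop} (h : p) : ind p = 1 := if_pos h
lemma ind_false {p : Prop} (h : ¬ p) : ind p = 0 := if_neg h
lemma ind_mono {p q : Prop} (h : p → q) : ind p ≤ ind q := by
  unfold ind; split_ifs <;> first | tauto | norm_num
lemma ind_and (p q : Prop) : ind (p ∧ q) = ind p * ind q := by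
  unfold ind; split_ifs <;> first | tauto | norm_num
lemma sum_ind {V : Type*} [Fintype V] (p : V → Prop) :
    ∑ v, ind (p v) = ((Finset.univ.filter p).card : ℝ) := by
  simp [ind]

section Mat
variable {V : Type*} [Fintype V] [DecidableEq V]

lemma pow_entry_nonneg {A : Matrix V V ℝ} (hA : ∀ u v, 0 ≤ A u v) (j : ℕ) (u v : V) :
    0 ≤ (A ^ j) u v := by
  induction j generalizing v with
  | zero => rw [pow_zero, Matrix.one_apply]; split_ifs <;> norm_num
  | succ j ih =>
    rw [pow_succ, Matrix.mul_apply]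
    exact Finset.sum_nonneg fun w _ => mul_nonneg (ih w) (hA w v)

lemma pow_entry_mono {A B : Matrix V V ℝ} (hA : ∀ u v, 0 ≤ A u v) (hAB : ∀ u v, A u v ≤ B u v)
    (j : ℕ) (u v : V) : (A ^ j) u v ≤ (B ^ j) u v := by
  induction j generalizing v with
  | zero => simp
  | succ j ih =>
    rw [pow_succ, pow_succ, Matrix.mul_apply, Matrix.mul_apply]
    exact Finset.sum_le_sum fun w _ => mul_le_mul (ih w) (hAB w v) (hA w v)
      (pow_entry_nonneg (fun u v => (hA u v).trans (hAB u v)) j u w)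

lemma pow_entry_le {A : Matrix V V ℝ} (hA : ∀ u v, 0 ≤ A u v) (hA1 : ∀ u v, A u v ≤ 1)
    (j : ℕ) (u v : V) : (A ^ (j + 1)) u v ≤ (Fintype.card V : ℝ) ^ j := by
  induction j generalizing v with
  | zero => simpa using hA1 u v
  | succ j ih =>
    rw [pow_succ, Matrix.mul_apply]
    calc ∑ w, (A ^ (j + 1)) u w * A w v
        ≤ ∑ _w : V, (Fintype.card V : ℝ) ^ j := by
          refine Finset.sum_le_sum fun w _ => ?_
          exact (mul_le_of_le_one_right (pow_entry_nonneg hA _ _ _) (hA1 w v)).trans (ih w)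
      _ = _ := by simp [pow_succ, mul_comm]

lemma trace_mono {A B : Matrix V V ℝ} (hAB : ∀ u v, A u v ≤ B u v) : A.trace ≤ B.trace :=
  Finset.sum_le_sum fun u _ => hAB u u

lemma trace_mul_eq (A B : Matrix V V ℝ) : (A * B).trace = ∑ u, ∑ v, A u v * B v u := by
  simp [Matrix.trace, Matrix.mul_apply]

lemma mul_entry_mono {A B C D : Matrix V V ℝ} (hA : ∀ u v, 0 ≤ A u v) (hAB : ∀ u v, A u v ≤ B u v)
    (hC : ∀ u v, 0 ≤ C u v) (hCD : ∀ u v, C u v ≤ D u v) (u v : V) :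
    (A * C) u v ≤ (B * D) u v := by
  rw [Matrix.mul_apply, Matrix.mul_apply]
  exact Finset.sum_le_sum fun w _ => mul_le_mul (hAB u w) (hCD w v) (hC w v)
    ((hA u w).trans (hAB u w))

/-- The sum of all entries of a matrix. -/
noncomputable def tot (A : Matrix V V ℝ) : ℝ := ∑ u, ∑ v, A u v

lemma tot_double {M : Matrix V V ℝ} (hs : M.transpose = M) (i : ℕ) :
    tot (M ^ i) ^ 2 ≤ Fintype.card V * tot (M ^ (2 * i)) := by
  have hsi : ∀ u v, (M ^ i) u v = (M ^ i) v u := fun u v => by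
    conv_lhs => rw [← hs, ← Matrix.transpose_pow, Matrix.transpose_apply]
  have h1 : tot (M ^ (2 * i)) = ∑ w, (∑ u, (M ^ i) u w) ^ 2 := by
    unfold tot
    rw [two_mul, pow_add]
    simp_rw [Matrix.mul_apply, sq, Finset.sum_mul_sum]
    have : ∀ u v : V, ∑ w, (M ^ i) u w * (M ^ i) w v = ∑ w, (M ^ i) u w * (M ^ i) v w :=
      fun u v => Finset.sum_congr rfl fun w _ => by rw [hsi w v]
    simp_rw [this]
    calc _ = ∑ u, ∑ w, ∑ v, (M ^ i) u w * (M ^ i) v w :=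
          Finset.sum_congr rfl fun u _ => Finset.sum_comm
      _ = _ := Finset.sum_comm
  have h2 : tot (M ^ i) = ∑ w, ∑ u, (M ^ i) u w := Finset.sum_comm
  rw [h1, h2]
  simpa using sq_sum_le_card_mul_sum_sq (s := Finset.univ) (f := fun w => ∑ u, (M ^ i) u w)

lemma tot_pow_two {M : Matrix V V ℝ} (hs : M.transpose = M) (h0 : ∀ u v, 0 ≤ M u v)
    {g : ℝ} (hg : 0 ≤ g) (ht : g * (Fintype.card V : ℝ) ^ 2 ≤ tot M) (t : ℕ) :
    g ^ (2 ^ t) * (Fintype.card V : ℝ) ^ (2 ^ t + 1) ≤ tot (M ^ (2 ^ t)) := by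
  set m : ℝ := (Fintype.card V : ℝ)
  have hm0 : 0 ≤ m := Nat.cast_nonneg _
  induction t with
  | zero => simpa using ht
  | succ t ih =>
    have hd := tot_double hs (2 ^ t)
    have e : 2 ^ (t + 1) = 2 * 2 ^ t := by ring
    rw [e]
    rcases hm0.eq_or_lt with hm | hm
    · rw [← hm]
      have : tot (M ^ (2 * 2 ^ t)) ≥ 0 :=
        Finset.sum_nonneg fun u _ => Finset.sum_nonneg fun v _ => pow_entry_nonneg h0 _ _ _
      simpa using this
    · have h3 : (g ^ (2 ^ t) * m ^ (2 ^ t + 1)) ^ 2 ≤ tot (M ^ 2 ^ t) ^ 2 :=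
        pow_le_pow_left₀ (by positivity) ih 2
      have h4 : m * (g ^ (2 * 2 ^ t) * m ^ (2 * 2 ^ t + 1)) ≤ m * tot (M ^ (2 * 2 ^ t)) := by
        refine le_trans (le_of_eq ?_) (h3.trans hd)
        ring
      exact le_of_mul_le_mul_left h4 hm

lemma tot_pow_succ_le {M : Matrix V V ℝ} (h0 : ∀ u v, 0 ≤ M u v) (h1 : ∀ u v, M u v ≤ 1) (i : ℕ) :
    tot (M ^ (i + 1)) ≤ Fintype.card V * tot (M ^ i) := by
  unfold tot
  rw [Finset.mul_sum]
  refine Finset.sum_le_sum fun u _ => ?_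
  simp_rw [pow_succ, Matrix.mul_apply]
  rw [Finset.sum_comm, Finset.mul_sum]
  refine Finset.sum_le_sum fun w _ => ?_
  rw [← Finset.mul_sum, mul_comm]
  refine mul_le_mul_of_nonneg_right ?_ (pow_entry_nonneg h0 _ _ _)
  calc ∑ v, M w v ≤ ∑ _v : V, (1 : ℝ) := Finset.sum_le_sum fun v _ => h1 w v
    _ = _ := by simp

lemma tot_pow_le {M : Matrix V V ℝ} (h0 : ∀ u v, 0 ≤ M u v) (h1 : ∀ u v, M u v ≤ 1) (i j : ℕ) :
    tot (M ^ (i + j)) ≤ (Fintype.card V : ℝ) ^ j * tot (M ^ i) := by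
  induction j with
  | zero => simp
  | succ j ih =>
    refine (tot_pow_succ_le h0 h1 (i + j)).trans ?_
    rw [pow_succ', mul_assoc]
    gcongr

/-- Even closed walks are plentiful in a dense symmetric matrix. -/
lemma trace_even_ge {M : Matrix V V ℝ} (hs : M.transpose = M) (h0 : ∀ u v, 0 ≤ M u v)
    (h1 : ∀ u v, M u v ≤ 1) {g : ℝ} (hg : 0 ≤ g)
    (ht : g * (Fintype.card V : ℝ) ^ 2 ≤ tot M) (j : ℕ) (hj0 : 0 < j) :
    (g ^ (2 ^ j)) ^ 2 * (Fintype.card V : ℝ) ^ (2 * j) ≤ (M ^ (2 * j)).trace := by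
  have hpt := tot_pow_two hs h0 hg ht j
  set m : ℝ := (Fintype.card V : ℝ) with hm'
  have hm0 : 0 ≤ m := Nat.cast_nonneg _
  have hsj : ∀ u v, (M ^ j) u v = (M ^ j) v u := fun u v => by
    conv_lhs => rw [← hs, ← Matrix.transpose_pow, Matrix.transpose_apply]
  have htr : (M ^ (2 * j)).trace = ∑ u, ∑ v, (M ^ j) u v ^ 2 := by
    rw [two_mul, pow_add, trace_mul_eq]
    refine Finset.sum_congr rfl fun u _ => Finset.sum_congr rfl fun v _ => ?_
    rw [hsj v u, sq]
  have hnn : 0 ≤ (M ^ (2 * j)).trace := by rw [htr]; positivity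
  rcases hm0.eq_or_lt with hm | hm
  · rw [← hm, zero_pow (by omega), mul_zero]; exact hnn
  · have hcs : tot (M ^ j) ^ 2 ≤ m ^ 2 * (M ^ (2 * j)).trace := by
      rw [htr]
      calc tot (M ^ j) ^ 2 ≤ m * ∑ u, (∑ v, (M ^ j) u v) ^ 2 := by
            simpa [hm', tot] using sq_sum_le_card_mul_sum_sq (s := Finset.univ)
              (f := fun u => ∑ v, (M ^ j) u v)
        _ ≤ m * ∑ u, m * ∑ v, (M ^ j) u v ^ 2 := by
            gcongr with u
            simpa [hm'] using sq_sum_le_card_mul_sum_sq (s := Finset.univ)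
              (f := fun v => (M ^ j) u v)
        _ = _ := by rw [← Finset.mul_sum]; ring
    have hj : j ≤ 2 ^ j := Nat.lt_two_pow_self.le
    have hd := tot_pow_le h0 h1 j (2 ^ j - j)
    rw [Nat.add_sub_cancel' hj] at hd
    have h5 : m ^ (2 ^ j - j) * (g ^ (2 ^ j) * m ^ (j + 1)) ≤ m ^ (2 ^ j - j) * tot (M ^ j) := by
      refine le_trans (le_of_eq ?_) (hpt.trans hd)
      have : 2 ^ j + 1 = (2 ^ j - j) + (j + 1) := by omega
      rw [this, pow_add]; ring
    have h6 := le_of_mul_le_mul_left h5 (by positivity)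
    have h7 : (g ^ (2 ^ j) * m ^ (j + 1)) ^ 2 ≤ m ^ 2 * (M ^ (2 * j)).trace :=
      (pow_le_pow_left₀ (by positivity) h6 2).trans hcs
    have h8 : m ^ 2 * ((g ^ (2 ^ j)) ^ 2 * m ^ (2 * j)) ≤ m ^ 2 * (M ^ (2 * j)).trace := by
      refine le_trans (le_of_eq ?_) h7
      ring
    exact le_of_mul_le_mul_left h8 (by positivity)

end Mat

section Rel
variable {V : Type*} [Fintype V] [DecidableEq V]

/-- Adjacency matrix of a relation. -/
noncomputable def adj (R : V → V → Prop) : Matrix V V ℝ := Matrix.of fun u v => ind (R u v)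

lemma adj_apply (R : V → V → Prop) (u v : V) : adj R u v = ind (R u v) := rfl
lemma adj_nonneg (R : V → V → Prop) (u v : V) : 0 ≤ adj R u v := ind_nonneg _
lemma adj_le_one (R : V → V → Prop) (u v : V) : adj R u v ≤ 1 := ind_le_one _

/-- Number of ordered pairs related in both directions. -/
noncomputable def dbl (R : V → V → Prop) : ℝ := ∑ u, ∑ v, ind (R u v ∧ R v u)
/-- Number of ordered pairs related in no direction. -/
noncomputable def non (R : V → V → Prop) : ℝ := ∑ u, ∑ v, ind (¬ R u v ∧ ¬ R v u)

lemma non_nonneg (R : V → V → Prop) : 0 ≤ non R :=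
  Finset.sum_nonneg fun _ _ => Finset.sum_nonneg fun _ _ => ind_nonneg _

/-- Symmetric relations with many related pairs have many even closed walks. -/
lemma trace_adj_even {S : V → V → Prop} (hS : ∀ u v, S u v → S v u) {g : ℝ} (hg : 0 ≤ g)
    (ht : g * (Fintype.card V : ℝ) ^ 2 ≤ ∑ u, ∑ v, ind (S u v)) (j : ℕ) (hj : 0 < j) :
    (g ^ (2 ^ j)) ^ 2 * (Fintype.card V : ℝ) ^ (2 * j) ≤ (adj S ^ (2 * j)).trace :=
  trace_even_ge (by ext u v; exact congrArg ind (propext ⟨hS v u, hS u v⟩))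
    (adj_nonneg S) (adj_le_one S) hg ht j hj

/-- The relation of double edges one of whose directions lies in many paths of length two. -/
def richDbl (R : V → V → Prop) (g : ℝ) (u v : V) : Prop :=
  (R u v ∧ R v u) ∧ (g * Fintype.card V ≤ (adj R ^ 2) u v ∨ g * Fintype.card V ≤ (adj R ^ 2) v u)

lemma trace_richDbl (R : V → V → Prop) (g : ℝ) (j : ℕ) :
    g * Fintype.card V * (adj (richDbl R g) ^ (j + 1)).trace ≤ 2 * (adj R ^ (j + 2)).trace := by
  set S := richDbl R g
  have hS : (adj S).transpose = adj S := by
    ext u v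
    exact congrArg ind (propext (by unfold S richDbl; tauto))
  have hsj : ∀ u v, (adj S ^ j) u v = (adj S ^ j) v u := fun u v => by
    conv_lhs => rw [← hS, ← Matrix.transpose_pow, Matrix.transpose_apply]
  have hSR : ∀ u v, adj S u v ≤ adj R u v := fun u v => ind_mono fun h => h.1.1
  have h1 : (adj S ^ j * adj R ^ 2).trace ≤ (adj R ^ (j + 2)).trace := by
    rw [pow_add]
    exact trace_mono (mul_entry_mono (pow_entry_nonneg (adj_nonneg S) j)
      (pow_entry_mono (adj_nonneg S) hSR j) (pow_entry_nonneg (adj_nonneg R) 2) fun _ _ => le_rfl)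
  have h2 : 2 * (adj S ^ j * adj R ^ 2).trace
      = ∑ u, ∑ v, (adj S ^ j) u v * ((adj R ^ 2) u v + (adj R ^ 2) v u) := by
    rw [trace_mul_eq, two_mul]
    conv_lhs => arg 1; rw [Finset.sum_comm]
    simp_rw [← Finset.sum_add_distrib]
    refine Finset.sum_congr rfl fun u _ => Finset.sum_congr rfl fun v _ => ?_
    rw [hsj v u]; ring
  have h3 : g * Fintype.card V * (adj S ^ (j + 1)).trace
      ≤ ∑ u, ∑ v, (adj S ^ j) u v * ((adj R ^ 2) u v + (adj R ^ 2) v u) := by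
    rw [pow_succ, trace_mul_eq, Finset.mul_sum]
    refine Finset.sum_le_sum fun u _ => ?_
    rw [Finset.mul_sum]
    refine Finset.sum_le_sum fun v _ => ?_
    rw [mul_left_comm]
    refine mul_le_mul_of_nonneg_left ?_ (pow_entry_nonneg (adj_nonneg S) _ _ _)
    have n1 := pow_entry_nonneg (adj_nonneg R) 2 u v
    have n2 := pow_entry_nonneg (adj_nonneg R) 2 v u
    rw [adj_apply]
    by_cases h : S v u
    · rw [ind_true h, mul_one]
      rcases h.2 with h | h <;> linarith
    · rw [ind_false h, mul_zero]; linarith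
  linarith

lemma adj_sq_apply (R : V → V → Prop) (u v : V) :
    (adj R ^ 2) u v = ∑ w, ind (R u w ∧ R w v) := by
  rw [sq, Matrix.mul_apply]
  exact Finset.sum_congr rfl fun w _ => (ind_and _ _).symm

/-- If double edges lie in few paths of length two, they are outnumbered by non-adjacent pairs. -/
lemma poorDbl_le_non (R : V → V → Prop) {g : ℝ} (hg : 0 ≤ g) :
    ∑ u, ∑ v, ind ((R u v ∧ R v u) ∧ ¬ richDbl R g u v)
      ≤ non R + 2 * g * (Fintype.card V : ℝ) ^ 2 := by
  set D : V → V → Prop := fun u v => (R u v ∧ R v u) ∧ ¬ richDbl R g u v with hD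
  have hDs : ∀ u v, D u v ↔ D v u := fun u v => by simp only [hD, richDbl]; tauto
  set m : ℝ := (Fintype.card V : ℝ) with hm
  have hm0 : 0 ≤ m := Nat.cast_nonneg _
  set d : V → ℝ := fun u => ∑ v, ind (D u v) with hd
  set nn : V → ℝ := fun v => ∑ w, ind (¬ R v w ∧ ¬ R w v) with hnn
  have hd0 : ∀ u, 0 ≤ d u := fun u => Finset.sum_nonneg fun v _ => ind_nonneg _
  have key : ∀ u v, D u v → d u ≤ nn v + 2 * g * m := by
    intro u v huv
    have hp : (adj R ^ 2) u v ≤ g * m ∧ (adj R ^ 2) v u ≤ g * m := by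
      have := huv.2
      simp only [richDbl, not_and, not_or, not_le] at this
      exact ⟨(this huv.1).1.le, (this huv.1).2.le⟩
    rw [adj_sq_apply, adj_sq_apply] at hp
    have : d u ≤ ∑ w, (ind (¬ R v w ∧ ¬ R w v) + ind (R u w ∧ R w v) + ind (R v w ∧ R w u)) := by
      refine Finset.sum_le_sum fun w _ => ?_
      unfold ind
      simp only [hD]
      split_ifs <;> first | tauto | norm_num
    rw [Finset.sum_add_distrib, Finset.sum_add_distrib] at this
    linarith [hp.1, hp.2]
  have key2 : ∀ v, ∑ u, ind (D u v) * (d u / d v) ≤ nn v + 2 * g * m := by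
    intro v
    have hn0 : 0 ≤ nn v + 2 * g * m :=
      add_nonneg (Finset.sum_nonneg fun _ _ => ind_nonneg _) (by positivity)
    have hdv : ∑ u, ind (D u v) = d v :=
      Finset.sum_congr rfl fun u _ => congrArg ind (propext (hDs u v))
    rcases (hd0 v).eq_or_lt with h | h
    · rw [← h]; simpa using hn0
    · calc ∑ u, ind (D u v) * (d u / d v) ≤ ∑ u, ind (D u v) * ((nn v + 2 * g * m) / d v) := by
            refine Finset.sum_le_sum fun u _ => ?_
            by_cases hu : D u v
            · rw [ind_true hu, one_mul, one_mul]
              exact div_le_div_of_nonneg_right (key u v hu) h.le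
            · simp [ind_false hu]
        _ = _ := by rw [← Finset.sum_mul, hdv]; field_simp
  have hsum : ∑ v, (nn v + 2 * g * m) = non R + 2 * g * m ^ 2 := by
    rw [Finset.sum_add_distrib]
    simp only [Finset.sum_const, Finset.card_univ, nsmul_eq_mul, ← hm]
    have : ∑ v, nn v = non R := rfl
    rw [this]; ring
  rw [← hsum]
  refine le_trans ?_ (Finset.sum_le_sum fun v _ => key2 v)
  have hsym : ∑ v, ∑ u, ind (D u v) * (d u / d v) = ∑ v, ∑ u, ind (D u v) * (d v / d u) := by
    rw [Finset.sum_comm]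
    refine Finset.sum_congr rfl fun u _ => Finset.sum_congr rfl fun v _ => ?_
    rw [propext (hDs u v)]
  have h2 : 2 * ∑ u, ∑ v, ind (D u v)
      ≤ ∑ v, ∑ u, ind (D u v) * (d u / d v) + ∑ v, ∑ u, ind (D u v) * (d v / d u) := by
    rw [← Finset.sum_add_distrib, Finset.sum_comm, Finset.mul_sum]
    refine Finset.sum_le_sum fun v _ => ?_
    rw [← Finset.sum_add_distrib, Finset.mul_sum]
    refine Finset.sum_le_sum fun u _ => ?_
    by_cases hu : D u v
    · rw [ind_true hu, one_mul, one_mul, mul_one]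
      have pu : 0 < d u := lt_of_lt_of_le (by rw [ind_true hu]; norm_num)
        (Finset.single_le_sum (f := fun w => ind (D u w)) (fun w _ => ind_nonneg _)
          (Finset.mem_univ v))
      have pv : 0 < d v := lt_of_lt_of_le (by rw [ind_true ((hDs u v).1 hu)]; norm_num)
        (Finset.single_le_sum (f := fun w => ind (D v w)) (fun w _ => ind_nonneg _)
          (Finset.mem_univ u))
      rw [div_add_div _ _ pv.ne' pu.ne', le_div_iff₀ (by positivity)]
      nlinarith [sq_nonneg (d u - d v)]
    · simp [ind_false hu]
  linarith

/-- With few closed `k`-walks, double edges are essentially outnumbered by non-adjacent pairs. -/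
theorem exists_dbl_le_non (k : ℕ) (hk : 3 ≤ k) {g : ℝ} (hg : 0 < g) :
    ∃ c > 0, ∀ {V : Type} [Fintype V] [DecidableEq V] (R : V → V → Prop),
      (adj R ^ k).trace ≤ c * (Fintype.card V : ℝ) ^ k →
        dbl R ≤ non R + g * (Fintype.card V : ℝ) ^ 2 := by
  rcases Nat.even_or_odd' k with ⟨j, rfl | rfl⟩
  · refine ⟨(g ^ 2 ^ j) ^ 2 / 2, by positivity, ?_⟩
    intro V _ _ R h
    by_contra hcon
    push Not at hcon
    have hm : 0 < (Fintype.card V : ℝ) := by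
      rcases Nat.eq_zero_or_pos (Fintype.card V) with h0 | h0
      · have : IsEmpty V := Fintype.card_eq_zero_iff.1 h0
        simp [dbl, non] at hcon
      · exact_mod_cast h0
    have h1 := trace_adj_even (S := fun u v => R u v ∧ R v u) (fun u v h => ⟨h.2, h.1⟩) hg.le
      (by have := non_nonneg R; unfold dbl at hcon; linarith) j (by omega)
    have h2 := trace_mono (pow_entry_mono (adj_nonneg fun u v => R u v ∧ R v u)
      (B := adj R) (fun u v => ind_mono fun h => h.1) (2 * j))
    have : 0 < (g ^ 2 ^ j) ^ 2 * (Fintype.card V : ℝ) ^ (2 * j) := by positivity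
    linarith
  · set a := g / 4 with ha
    have ha0 : 0 < a := by positivity
    refine ⟨a * (a ^ 2 ^ j) ^ 2 / 4, by positivity, ?_⟩
    intro V _ _ R h
    by_contra hcon
    push Not at hcon
    have hm : 0 < (Fintype.card V : ℝ) := by
      rcases Nat.eq_zero_or_pos (Fintype.card V) with h0 | h0
      · have : IsEmpty V := Fintype.card_eq_zero_iff.1 h0
        simp [dbl, non] at hcon
      · exact_mod_cast h0
    have hp := poorDbl_le_non R ha0.le
    have hsplit : dbl R ≤ ∑ u, ∑ v, ind ((R u v ∧ R v u) ∧ ¬ richDbl R a u v)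
        + ∑ u, ∑ v, ind (richDbl R a u v) := by
      unfold dbl
      simp_rw [← Finset.sum_add_distrib]
      refine Finset.sum_le_sum fun u _ => Finset.sum_le_sum fun v _ => ?_
      unfold ind
      split_ifs <;> first | tauto | norm_num
    have hrich : a * (Fintype.card V : ℝ) ^ 2 ≤ ∑ u, ∑ v, ind (richDbl R a u v) := by
      rw [ha] at hp hsplit ⊢
      nlinarith [sq_nonneg (Fintype.card V : ℝ)]
    have h1 := trace_adj_even (S := richDbl R a) (fun u v h => ⟨⟨h.1.2, h.1.1⟩, h.2.symm⟩) ha0.le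
      hrich j (by omega)
    have h2 := trace_richDbl R a (2 * j - 1)
    rw [show 2 * j - 1 + 1 = 2 * j by omega, show 2 * j - 1 + 2 = 2 * j + 1 by omega] at h2
    have h3 : a * (Fintype.card V : ℝ) * ((a ^ 2 ^ j) ^ 2 * (Fintype.card V : ℝ) ^ (2 * j))
      ≤ a * (Fintype.card V : ℝ) * (adj (richDbl R a) ^ (2 * j)).trace := by gcongr
    have : 0 < a * (a ^ 2 ^ j) ^ 2 * (Fintype.card V : ℝ) ^ (2 * j + 1) := by positivity
    have e : a * (Fintype.card V : ℝ) * ((a ^ 2 ^ j) ^ 2 * (Fintype.card V : ℝ) ^ (2 * j))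
      = a * (a ^ 2 ^ j) ^ 2 * (Fintype.card V : ℝ) ^ (2 * j + 1) := by ring
    linarith

end Rel

section Rel
variable {V : Type*} [Fintype V] [DecidableEq V]

lemma adj_cube_apply (R : V → V → Prop) (u v : V) :
    (adj R ^ 3) u v = ∑ w, ∑ x, ind (R u w ∧ R w x ∧ R x v) := by
  rw [pow_succ', Matrix.mul_apply]
  refine Finset.sum_congr rfl fun w _ => ?_
  rw [adj_sq_apply, adj_apply, Finset.mul_sum]
  exact Finset.sum_congr rfl fun x _ => (ind_and _ _).symm

lemma adj_sq_sq_le (R : V → V → Prop) (u v : V) :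
    ((adj R ^ 2) u v) ^ 2 ≤ 2 * (adj R ^ 3) u v + non R := by
  have h1 : ((adj R ^ 2) u v) ^ 2
      = ∑ w, ∑ x, ind (R u w ∧ R w v) * ind (R u x ∧ R x v) := by
    rw [adj_sq_apply, sq, Finset.sum_mul_sum]
  have h2 : (adj R ^ 3) u v = ∑ w, ∑ x, ind (R u x ∧ R x w ∧ R w v) := by
    rw [adj_cube_apply, Finset.sum_comm]
  have h3 : ∑ w, ∑ x, ind (R u w ∧ R w v) * ind (R u x ∧ R x v)
      ≤ ∑ w, ∑ x, (ind (R u w ∧ R w x ∧ R x v) + ind (R u x ∧ R x w ∧ R w v)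
        + ind (¬ R w x ∧ ¬ R x w)) := by
    refine Finset.sum_le_sum fun w _ => Finset.sum_le_sum fun x _ => ?_
    rw [← ind_and]
    unfold ind
    split_ifs <;> first | tauto | norm_num
  simp_rw [Finset.sum_add_distrib] at h3
  rw [← h1, ← h2, ← adj_cube_apply] at h3
  unfold non
  linarith

lemma trace_sq_le_trace_succ (R : V → V → Prop) (i : ℕ) :
    ((adj R ^ (i + 3)).trace) ^ 2 ≤ (2 * (adj R ^ (i + 4)).trace
      + non R * (Fintype.card V : ℝ) ^ (i + 2)) * (Fintype.card V : ℝ) ^ (i + 2) := by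
  set m : ℝ := (Fintype.card V : ℝ) with hm
  set A := adj R with hA
  set L := A ^ (i + 1) with hL
  have hL0 : ∀ u v, 0 ≤ L u v := pow_entry_nonneg (adj_nonneg R) _
  have hLs : ∑ u, ∑ v, L v u ≤ m ^ (i + 2) := by
    calc _ ≤ ∑ _u : V, ∑ _v : V, m ^ i := by
          gcongr; exact pow_entry_le (adj_nonneg R) (adj_le_one R) _ _ _
      _ = _ := by simp only [Finset.sum_const, Finset.card_univ, nsmul_eq_mul, ← hm]; ring
  have h3 : (A ^ (i + 3)).trace = ∑ u, ∑ v, (A ^ 2) u v * L v u := by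
    rw [show i + 3 = 2 + (i + 1) by ring, pow_add, trace_mul_eq]
  have h4 : (A ^ (i + 4)).trace = ∑ u, ∑ v, (A ^ 3) u v * L v u := by
    rw [show i + 4 = 3 + (i + 1) by ring, pow_add, trace_mul_eq]
  have hn := non_nonneg R
  have hcs : ((A ^ (i + 3)).trace) ^ 2
      ≤ (∑ u, ∑ v, ((A ^ 2) u v) ^ 2 * L v u) * ∑ u, ∑ v, L v u := by
    rw [h3]
    simp_rw [← Fintype.sum_prod_type']
    exact Finset.sum_sq_le_sum_mul_sum_of_sq_le_mul _
      (fun p _ => mul_nonneg (sq_nonneg _) (hL0 _ _)) (fun p _ => hL0 _ _)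
      (fun p _ => le_of_eq (by ring))
  have h5 : ∑ u, ∑ v, ((A ^ 2) u v) ^ 2 * L v u
      ≤ 2 * (A ^ (i + 4)).trace + non R * m ^ (i + 2) := by
    calc _ ≤ ∑ u, ∑ v, (2 * (A ^ 3) u v + non R) * L v u := by
          refine Finset.sum_le_sum fun u _ => Finset.sum_le_sum fun v _ => ?_
          exact mul_le_mul_of_nonneg_right (adj_sq_sq_le R u v) (hL0 _ _)
      _ = 2 * (A ^ (i + 4)).trace + non R * ∑ u, ∑ v, L v u := by
          rw [h4]
          simp_rw [add_mul, Finset.sum_add_distrib, Finset.mul_sum, mul_assoc]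
      _ ≤ _ := by gcongr
  have h6 : 0 ≤ ∑ u, ∑ v, L v u := Finset.sum_nonneg fun u _ => Finset.sum_nonneg fun v _ => hL0 _ _
  have h7 : 0 ≤ (A ^ (i + 4)).trace :=
    Finset.sum_nonneg fun u _ => pow_entry_nonneg (adj_nonneg R) _ _ _
  refine hcs.trans ((mul_le_mul_of_nonneg_right h5 h6).trans ?_)
  exact mul_le_mul_of_nonneg_left hLs (by positivity)

/-- Few closed `k`-walks and few non-adjacent pairs imply few closed `3`-walks. -/
lemma exists_trace_three_le (k : ℕ) (hk : 3 ≤ k) : ∀ {g : ℝ}, 0 < g →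
    ∃ c > 0, ∀ {V : Type} [Fintype V] [DecidableEq V] (R : V → V → Prop),
      (adj R ^ k).trace ≤ c * (Fintype.card V : ℝ) ^ k →
      non R ≤ c * (Fintype.card V : ℝ) ^ 2 →
        (adj R ^ 3).trace ≤ g * (Fintype.card V : ℝ) ^ 3 := by
  induction k, hk using Nat.le_induction with
  | base => exact fun {g} hg => ⟨g, hg, fun R h _ => h⟩
  | succ k hk ih =>
    intro g hg
    obtain ⟨c, hc, h⟩ := ih hg
    refine ⟨min c (c ^ 2 / 3), by positivity, ?_⟩
    intro V _ _ R h1 h2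
    obtain ⟨i, rfl⟩ := Nat.exists_eq_add_of_le' hk
    refine h R ?_ (h2.trans (by gcongr; exact min_le_left _ _))
    have h3 := trace_sq_le_trace_succ R i
    set m : ℝ := (Fintype.card V : ℝ) with hm
    have hm0 : 0 ≤ m := Nat.cast_nonneg _
    have h4 : (adj R ^ (i + 4)).trace ≤ c ^ 2 / 3 * m ^ (i + 4) :=
      h1.trans (by gcongr; exact min_le_right _ _)
    have h5 : non R ≤ c ^ 2 / 3 * m ^ 2 := h2.trans (by gcongr; exact min_le_right _ _)
    refine le_of_sq_le_sq ?_ (by positivity)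
    refine h3.trans ?_
    calc _ ≤ (2 * (c ^ 2 / 3 * m ^ (i + 4)) + (c ^ 2 / 3 * m ^ 2) * m ^ (i + 2)) * m ^ (i + 2) := by
          gcongr
      _ = _ := by ring

/-- Out-degree. -/
noncomputable def odeg (R : V → V → Prop) (u : V) : ℝ := ∑ w, ind (R u w)

/-- Size of the symmetric difference of two out-neighbourhoods. -/
noncomputable def odiff (R : V → V → Prop) (u v : V) : ℝ := ∑ w, ind (¬ (R u w ↔ R v w))

lemma odiff_le (R : V → V → Prop) {u v : V} (hd : odeg R u ≤ odeg R v) :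
    odiff R u v ≤ 2 * ((adj R ^ 2) v u + ∑ w, ind (¬ R u w ∧ ¬ R w u)) := by
  have h1 : ∑ w, ind (R v w ∧ ¬ R u w) ≤ (adj R ^ 2) v u + ∑ w, ind (¬ R u w ∧ ¬ R w u) := by
    rw [adj_sq_apply, ← Finset.sum_add_distrib]
    refine Finset.sum_le_sum fun w _ => ?_
    unfold ind
    split_ifs <;> first | tauto | norm_num
  have h2 : ∑ w, ind (R u w ∧ ¬ R v w) + odeg R v = ∑ w, ind (R v w ∧ ¬ R u w) + odeg R u := by
    unfold odeg
    rw [← Finset.sum_add_distrib, ← Finset.sum_add_distrib]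
    refine Finset.sum_congr rfl fun w _ => ?_
    unfold ind
    split_ifs <;> first | tauto | norm_num
  have h3 : odiff R u v = ∑ w, ind (R u w ∧ ¬ R v w) + ∑ w, ind (R v w ∧ ¬ R u w) := by
    unfold odiff
    rw [← Finset.sum_add_distrib]
    refine Finset.sum_congr rfl fun w _ => ?_
    unfold ind
    split_ifs <;> first | tauto | norm_num
  linarith

lemma sum_odiff_le (R : V → V → Prop) :
    ∑ u, ∑ v, ind (R u v ∧ odeg R u ≤ odeg R v) * odiff R u v
      ≤ 2 * ((adj R ^ 3).trace + non R * Fintype.card V) := by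
  calc _ ≤ ∑ u, ∑ v, (2 * (ind (R u v) * (adj R ^ 2) v u)
        + 2 * ∑ w, ind (¬ R u w ∧ ¬ R w u)) := by
        refine Finset.sum_le_sum fun u _ => Finset.sum_le_sum fun v _ => ?_
        have n0 : 0 ≤ ∑ w, ind (¬ R u w ∧ ¬ R w u) := Finset.sum_nonneg fun w _ => ind_nonneg _
        have n1 := pow_entry_nonneg (adj_nonneg R) 2 v u
        by_cases h : R u v ∧ odeg R u ≤ odeg R v
        · rw [ind_true h, ind_true h.1]
          linarith [odiff_le R h.2]
        · rw [ind_false h, zero_mul]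
          have := ind_nonneg (R u v)
          positivity
    _ = _ := by
        simp_rw [Finset.sum_add_distrib, ← Finset.mul_sum]
        rw [pow_succ' _ 2, trace_mul_eq]
        simp only [Finset.sum_const, Finset.card_univ, nsmul_eq_mul, non, adj_apply]
        rw [← Finset.mul_sum]; ring

lemma sum_close_sq_le (R : V → V → Prop) {a : ℝ} (ha : 0 ≤ a) (u : V) :
    (∑ v, ind (R u v ∧ odiff R u v < a * Fintype.card V)) ^ 2
      ≤ dbl R + 2 * a * (Fintype.card V : ℝ) ^ 2 := by
  set m : ℝ := (Fintype.card V : ℝ) with hm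
  set S : V → Prop := fun v => R u v ∧ odiff R u v < a * m with hS
  have h1 : (∑ v, ind (S v)) ^ 2 = ∑ v, ∑ w, ind (S v) * ind (S w) := by
    rw [sq, Finset.sum_mul_sum]
  have h2 : ∑ v, ∑ w, ind (S v) * ind (S w)
      ≤ ∑ v, ∑ w, (ind (R v w ∧ R w v) + ind (S v) * ind (¬ (R u w ↔ R v w))
        + ind (S w) * ind (¬ (R u v ↔ R w v))) := by
    refine Finset.sum_le_sum fun v _ => Finset.sum_le_sum fun w _ => ?_
    have n1 := ind_nonneg (R v w ∧ R w v)
    have n2 := mul_nonneg (ind_nonneg (S v)) (ind_nonneg (¬ (R u w ↔ R v w)))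
    have n3 := mul_nonneg (ind_nonneg (S w)) (ind_nonneg (¬ (R u v ↔ R w v)))
    by_cases hv : S v
    · by_cases hw : S w
      · have r1 := hv.1
        have r2 := hw.1
        rw [ind_true hv, ind_true hw]
        by_cases e1 : R v w <;> by_cases e2 : R w v <;> simp [r1, r2, e1, e2, ind]
      · rw [ind_false hw] at n3 ⊢; linarith
    · rw [ind_false hv] at n2 ⊢; linarith
  have h3 : ∀ v, ∑ w, ind (S v) * ind (¬ (R u w ↔ R v w)) ≤ a * m := by
    intro v
    rw [← Finset.mul_sum]
    by_cases h : S v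
    · rw [ind_true h, one_mul]; exact h.2.le
    · rw [ind_false h, zero_mul]; positivity
  have h4 : ∑ v, ∑ w, ind (S v) * ind (¬ (R u w ↔ R v w)) ≤ a * m ^ 2 := by
    calc _ ≤ ∑ _v : V, a * m := Finset.sum_le_sum fun v _ => h3 v
      _ = _ := by simp only [Finset.sum_const, Finset.card_univ, nsmul_eq_mul, ← hm]; ring
  have h5 : ∑ v, ∑ w, ind (S w) * ind (¬ (R u v ↔ R w v)) ≤ a * m ^ 2 := by
    rw [Finset.sum_comm]; exact h4
  simp_rw [Finset.sum_add_distrib] at h2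
  rw [h1]
  unfold dbl
  linarith

/-- A relation with few closed `k`-walks and few non-adjacent pairs is almost transitive: ordering
by decreasing out-degree leaves few backward pairs. -/
theorem exists_backward_le (k : ℕ) (hk : 3 ≤ k) {g : ℝ} (hg : 0 < g) :
    ∃ c > 0, ∀ {V : Type} [Fintype V] [DecidableEq V] (R : V → V → Prop),
      (adj R ^ k).trace ≤ c * (Fintype.card V : ℝ) ^ k →
      non R ≤ c * (Fintype.card V : ℝ) ^ 2 →
        ∑ u, ∑ v, ind (R u v ∧ odeg R u ≤ odeg R v) ≤ g * (Fintype.card V : ℝ) ^ 2 := by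
  set a : ℝ := g ^ 2 / 16 with ha
  have ha0 : 0 < a := by positivity
  set b : ℝ := a * g / 8 with hb
  obtain ⟨c1, hc1, h1⟩ := exists_trace_three_le k hk (g := b) (by positivity)
  obtain ⟨c2, hc2, h2⟩ := exists_dbl_le_non k hk (g := a) ha0
  refine ⟨min (min c1 c2) (min a b), by positivity, ?_⟩
  intro V _ _ R ht hn
  have hmn : ∀ x, min (min c1 c2) (min a b) ≤ x → non R ≤ x * (Fintype.card V : ℝ) ^ 2 :=
    fun x hx => hn.trans (by gcongr)
  have hmt : ∀ x, min (min c1 c2) (min a b) ≤ x →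
      (adj R ^ k).trace ≤ x * (Fintype.card V : ℝ) ^ k := fun x hx => ht.trans (by gcongr)
  have t3 := h1 R (hmt c1 (by simp)) (hmn c1 (by simp))
  have td := h2 R (hmt c2 (by simp))
  have na := hmn a (by simp)
  have nb := hmn b (by simp)
  have hs := sum_odiff_le R
  set m : ℝ := (Fintype.card V : ℝ) with hm
  have hm0 : 0 ≤ m := Nat.cast_nonneg _
  rcases hm0.eq_or_lt with h0 | hmpos
  · have : IsEmpty V := by
      rw [← Fintype.card_eq_zero_iff]; exact_mod_cast (hm ▸ h0.symm)
    simp only [Finset.univ_eq_empty, Finset.sum_empty]; positivity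
  set P : V → V → Prop := fun u v => R u v ∧ odeg R u ≤ odeg R v with hP
  have hsplit : ∀ u v, ind (P u v)
      ≤ ind (R u v ∧ odiff R u v < a * m) + ind (P u v) * odiff R u v / (a * m) := by
    intro u v
    have hd : 0 ≤ odiff R u v := Finset.sum_nonneg fun _ _ => ind_nonneg _
    by_cases h : P u v
    · rw [ind_true h, one_mul]
      by_cases h' : odiff R u v < a * m
      · rw [ind_true ⟨h.1, h'⟩]; have : 0 ≤ odiff R u v / (a * m) := by positivity
        linarith
      · have : 1 ≤ odiff R u v / (a * m) := by
          rw [le_div_iff₀ (by positivity)]; linarith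
        linarith [ind_nonneg (R u v ∧ odiff R u v < a * m)]
    · rw [ind_false h]; simpa using ind_nonneg _
  have hclose : ∀ u, ∑ v, ind (R u v ∧ odiff R u v < a * m) ≤ g / 2 * m := by
    intro u
    refine le_of_sq_le_sq ?_ (by positivity)
    refine (sum_close_sq_le R ha0.le u).trans ?_
    rw [ha] at td na ⊢
    nlinarith
  calc ∑ u, ∑ v, ind (P u v)
      ≤ ∑ u, ∑ v, (ind (R u v ∧ odiff R u v < a * m) + ind (P u v) * odiff R u v / (a * m)) :=
        Finset.sum_le_sum fun u _ => Finset.sum_le_sum fun v _ => hsplit u v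
    _ = ∑ u, ∑ v, ind (R u v ∧ odiff R u v < a * m)
        + (∑ u, ∑ v, ind (P u v) * odiff R u v) / (a * m) := by
        simp_rw [Finset.sum_add_distrib, ← Finset.sum_div]
    _ ≤ ∑ _u : V, g / 2 * m + (2 * (b * m ^ 3 + b * m ^ 2 * m)) / (a * m) := by
        gcongr with u
        · exact hclose u
        · exact hs.trans (by gcongr)
    _ = g * m ^ 2 := by
        simp only [Finset.sum_const, Finset.card_univ, nsmul_eq_mul, ← hm]
        rw [hb]; field_simp; ring

end Rel

section Rel
variable {V : Type*} [Fintype V] [DecidableEq V]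

/-- `C` sums to at most `a` over every combinatorial rectangle. -/
def CutLe (C : Matrix V V ℝ) (a : ℝ) : Prop :=
  ∀ S T : V → Prop, ∑ u, ∑ v, ind (S u) * ind (T v) * C u v ≤ a

lemma CutLe.sum_le {C : Matrix V V ℝ} {a : ℝ} (hC : CutLe C a) {f g : V → ℝ} {b : ℝ}
    (hf0 : ∀ u, 0 ≤ f u) (hf1 : ∀ u, f u ≤ b) (hg0 : ∀ u, 0 ≤ g u) (hg1 : ∀ u, g u ≤ 1)
    (hb : 0 ≤ b) :
    ∑ u, ∑ v, f u * C u v * g v ≤ b * a := by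
  set S : V → Prop := fun u => 0 < ∑ v, C u v * g v
  set T : V → Prop := fun v => 0 < ∑ u, ind (S u) * C u v
  have h1 : ∑ u, ∑ v, f u * C u v * g v ≤ b * ∑ u, ∑ v, ind (S u) * C u v * g v := by
    rw [Finset.mul_sum]
    refine Finset.sum_le_sum fun u _ => ?_
    simp_rw [mul_assoc, ← Finset.mul_sum]
    by_cases h : S u
    · rw [ind_true h, one_mul]; exact mul_le_mul_of_nonneg_right (hf1 u) h.le
    · rw [ind_false h, zero_mul, mul_zero]
      exact mul_nonpos_of_nonneg_of_nonpos (hf0 u) (not_lt.1 h)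
  have h2 : ∑ u, ∑ v, ind (S u) * C u v * g v ≤ ∑ u, ∑ v, ind (S u) * ind (T v) * C u v := by
    rw [Finset.sum_comm]
    conv_rhs => rw [Finset.sum_comm]
    refine Finset.sum_le_sum fun v _ => ?_
    have e : ∑ u, ind (S u) * ind (T v) * C u v = ind (T v) * ∑ u, ind (S u) * C u v := by
      rw [Finset.mul_sum]; exact Finset.sum_congr rfl fun u _ => by ring
    rw [← Finset.sum_mul, e, mul_comm]
    by_cases h : T v
    · rw [ind_true h]; exact mul_le_mul_of_nonneg_right (hg1 v) h.le
    · rw [ind_false h, zero_mul]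
      exact mul_nonpos_of_nonneg_of_nonpos (hg0 v) (not_lt.1 h)
  exact h1.trans (mul_le_mul_of_nonneg_left (h2.trans (hC S T)) hb)

lemma CutLe.trace_mul_le {C : Matrix V V ℝ} {a : ℝ} (hC : CutLe C a) {P Q : Matrix V V ℝ} {b : ℝ}
    (hP0 : ∀ u v, 0 ≤ P u v) (hP1 : ∀ u v, P u v ≤ 1) (hQ0 : ∀ u v, 0 ≤ Q u v)
    (hQ1 : ∀ u v, Q u v ≤ b) (hb : 0 ≤ b) :
    (C * (P * Q)).trace ≤ Fintype.card V * (b * a) := by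
  rw [trace_mul_eq]
  have : ∑ u, ∑ v, C u v * (P * Q) v u = ∑ w, ∑ u, ∑ v, Q w u * C u v * P v w := by
    simp_rw [Matrix.mul_apply, Finset.mul_sum]
    calc _ = ∑ u, ∑ w, ∑ v, C u v * (P v w * Q w u) :=
          Finset.sum_congr rfl fun u _ => Finset.sum_comm
      _ = ∑ w, ∑ u, ∑ v, C u v * (P v w * Q w u) := Finset.sum_comm
      _ = _ := Finset.sum_congr rfl fun w _ => Finset.sum_congr rfl fun u _ =>
          Finset.sum_congr rfl fun v _ => by ring
  rw [this]
  calc _ ≤ ∑ _w : V, b * a := Finset.sum_le_sum fun w _ =>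
        hC.sum_le (hQ0 w) (hQ1 w) (fun v => hP0 v w) (fun v => hP1 v w) hb
    _ = _ := by simp

lemma mul_pow_entry_le {A B : Matrix V V ℝ} (hA0 : ∀ u v, 0 ≤ A u v) (hA1 : ∀ u v, A u v ≤ 1)
    (hB0 : ∀ u v, 0 ≤ B u v) (hB1 : ∀ u v, B u v ≤ 1) (i j l : ℕ) (h : i + j = l + 1) (u v : V) :
    (A ^ i * B ^ j) u v ≤ (Fintype.card V : ℝ) ^ l := by
  rcases i with _ | i
  · obtain rfl : j = l + 1 := by omega
    rw [pow_zero, one_mul]; exact pow_entry_le hB0 hB1 l u v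
  rcases j with _ | j
  · obtain rfl : i = l := by omega
    rw [pow_zero, mul_one]; exact pow_entry_le hA0 hA1 i u v
  obtain rfl : l = i + j + 1 := by omega
  rw [Matrix.mul_apply]
  calc _ ≤ ∑ _w : V, (Fintype.card V : ℝ) ^ i * (Fintype.card V : ℝ) ^ j := by
        refine Finset.sum_le_sum fun w _ => mul_le_mul (pow_entry_le hA0 hA1 i u w)
          (pow_entry_le hB0 hB1 j w v) (pow_entry_nonneg hB0 _ _ _) (by positivity)
    _ = _ := by simp only [Finset.sum_const, Finset.card_univ, nsmul_eq_mul]; ring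

/-- Cut-close matrices have close numbers of closed walks. -/
lemma trace_pow_le_of_cut {A B : Matrix V V ℝ} (hA0 : ∀ u v, 0 ≤ A u v) (hA1 : ∀ u v, A u v ≤ 1)
    (hB0 : ∀ u v, 0 ≤ B u v) (hB1 : ∀ u v, B u v ≤ 1) {e : ℝ}
    (hC : CutLe (B - A) (e * (Fintype.card V : ℝ) ^ 2)) (k : ℕ) (hk : 3 ≤ k) :
    (B ^ k).trace ≤ (A ^ k).trace + k * (e * (Fintype.card V : ℝ) ^ k) := by
  set m : ℝ := (Fintype.card V : ℝ) with hm
  have hm0 : 0 ≤ m := Nat.cast_nonneg _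
  have hstep : ∀ i ∈ Finset.range k,
      (B ^ (i + 1) * A ^ (k - (i + 1))).trace - (B ^ i * A ^ (k - i)).trace ≤ e * m ^ k := by
    intro i hi
    have hi := Finset.mem_range.1 hi
    have e1 : (B ^ (i + 1) * A ^ (k - (i + 1))).trace - (B ^ i * A ^ (k - i)).trace
        = ((B - A) * (A ^ (k - (i + 1)) * B ^ i)).trace := by
      rw [show k - i = (k - (i + 1)) + 1 by omega, pow_succ' A, pow_succ B, ← Matrix.trace_sub]
      rw [← mul_assoc (B - A), Matrix.trace_mul_comm _ (B ^ i)]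
      congr 1
      noncomm_ring
    have e2 : m * (m ^ (k - 3) * (e * m ^ 2)) = e * m ^ k := by
      rw [show k = (k - 3) + 3 by omega, Nat.add_sub_cancel]; ring
    rw [e1, ← e2]
    rcases Nat.eq_zero_or_pos (k - (i + 1)) with h0 | h0
    · rw [h0, pow_zero, one_mul, show i = (i - 1) + 1 by omega, pow_succ']
      refine hC.trace_mul_le hB0 hB1 (pow_entry_nonneg hB0 _) (fun u v => ?_) (by positivity)
      rw [show i - 1 = (k - 3) + 1 by omega]
      exact pow_entry_le hB0 hB1 _ u v
    · rw [show k - (i + 1) = (k - (i + 1) - 1) + 1 by omega, pow_succ', mul_assoc]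
      refine hC.trace_mul_le hA0 hA1 (fun u v => ?_) (fun u v => ?_) (by positivity)
      · rw [Matrix.mul_apply]
        exact Finset.sum_nonneg fun w _ => mul_nonneg (pow_entry_nonneg hA0 _ _ _)
          (pow_entry_nonneg hB0 _ _ _)
      · exact mul_pow_entry_le hA0 hA1 hB0 hB1 _ _ _ (by omega) u v
  have hsum := Finset.sum_le_sum hstep
  rw [Finset.sum_range_sub (fun i => (B ^ i * A ^ (k - i)).trace)] at hsum
  simp only [Nat.sub_self, pow_zero, mul_one, one_mul, Nat.sub_zero, Finset.sum_const,
    Finset.card_range, nsmul_eq_mul] at hsum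
  linarith
end Rel

section Avg
variable {X : Type*} [Fintype X]

/-- Average of `A` over the colour class of `p`. -/
noncomputable def avg {K : Type*} (c : X → K) (A : X → ℝ) (p : X) : ℝ :=
  (∑ q, ind (c q = c p) * A q) / ∑ q, ind (c q = c p)

lemma avg_pos_den {K : Type*} (c : X → K) (p : X) : 0 < ∑ q, ind (c q = c p) :=
  lt_of_lt_of_le (by rw [ind_true (rfl : c p = c p)]; norm_num)
    (Finset.single_le_sum (f := fun q => ind (c q = c p)) (fun q _ => ind_nonneg _)
      (Finset.mem_univ p))

lemma avg_nonneg {K : Type*} (c : X → K) {A : X → ℝ} (hA : ∀ p, 0 ≤ A p) (p : X) :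
    0 ≤ avg c A p :=
  div_nonneg (Finset.sum_nonneg fun q _ => mul_nonneg (ind_nonneg _) (hA q)) (avg_pos_den c p).le

lemma avg_le_one {K : Type*} (c : X → K) {A : X → ℝ} (hA : ∀ p, A p ≤ 1) (p : X) :
    avg c A p ≤ 1 := by
  unfold avg
  rw [div_le_one (avg_pos_den c p)]
  exact Finset.sum_le_sum fun q _ => mul_le_of_le_one_right (ind_nonneg _) (hA q)

lemma avg_congr {K : Type*} (c : X → K) (A : X → ℝ) {p q : X} (h : c p = c q) :
    avg c A p = avg c A q := by unfold avg; rw [h]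

lemma sum_avg_mul {K : Type*} (c : X → K) (A : X → ℝ) {g : X → ℝ}
    (hg : ∀ p q, c p = c q → g p = g q) : ∑ p, avg c A p * g p = ∑ p, A p * g p := by
  unfold avg
  simp_rw [div_mul_eq_mul_div, Finset.sum_mul, Finset.sum_div]
  rw [Finset.sum_comm]
  refine Finset.sum_congr rfl fun q _ => ?_
  have : ∀ p, ind (c q = c p) * A q * g p / ∑ r, ind (c r = c p)
      = A q * g q / (∑ r, ind (c r = c q)) * ind (c p = c q) := by
    intro p
    by_cases h : c q = c p
    · rw [ind_true h, ind_true h.symm, hg q p h, h]; ring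
    · rw [ind_false h, ind_false (Ne.symm h)]; ring
  simp_rw [this]
  rw [← Finset.mul_sum, div_mul_cancel₀ _ (avg_pos_den c q).ne']

/-- Energy increment for a refinement of the colouring. -/
lemma energy_increment {K L : Type*} (c : X → K) (c' : X → L) (hc : ∀ p q, c' p = c' q → c p = c q)
    (A : X → ℝ) {g : X → ℝ} (hg : ∀ p q, c' p = c' q → g p = g q) (hg1 : ∀ p, |g p| ≤ 1) :
    (∑ p, g p * (avg c A p - A p)) ^ 2
      ≤ Fintype.card X * (∑ p, avg c' A p ^ 2 - ∑ p, avg c A p ^ 2) := by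
  have h1 : ∑ p, g p * (avg c A p - A p) = ∑ p, g p * (avg c A p - avg c' A p) := by
    have := sum_avg_mul c' A hg
    simp_rw [mul_sub, Finset.sum_sub_distrib]
    congr 1
    simp_rw [mul_comm (g _)]
    exact this.symm
  have h2 : ∑ p, (avg c A p - avg c' A p) ^ 2 = ∑ p, avg c' A p ^ 2 - ∑ p, avg c A p ^ 2 := by
    have e1 := sum_avg_mul c' A (g := avg c A) fun p q h => avg_congr c A (hc p q h)
    have e2 := sum_avg_mul c A (g := avg c A) fun p q h => avg_congr c A h
    have : ∀ p, (avg c A p - avg c' A p) ^ 2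
        = avg c' A p ^ 2 - 2 * (avg c' A p * avg c A p) + avg c A p * avg c A p := fun p => by ring
    simp_rw [this, Finset.sum_add_distrib, Finset.sum_sub_distrib, ← Finset.mul_sum]
    rw [e1, ← e2]
    simp_rw [← sq]; ring
  rw [h1, ← h2]
  have h3 := sq_sum_le_card_mul_sum_sq (s := Finset.univ)
    (f := fun p => g p * (avg c A p - avg c' A p))
  refine h3.trans ?_
  rw [Finset.card_univ]
  refine mul_le_mul_of_nonneg_left (Finset.sum_le_sum fun p _ => ?_) (Nat.cast_nonneg _)
  rw [mul_pow]
  have : g p ^ 2 ≤ 1 := by rw [sq_le_one_iff_abs_le_one]; exact hg1 p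
  exact mul_le_of_le_one_left (sq_nonneg _) this
end Avg

section Rel
variable {V : Type*} [Fintype V] [DecidableEq V]

/-- The averaged matrix for a vertex colouring. -/
noncomputable def avgM (π : V → ℕ) (A : Matrix V V ℝ) : Matrix V V ℝ :=
  Matrix.of fun u v => avg (fun p : V × V => (π p.1, π p.2)) (fun p => A p.1 p.2) (u, v)

lemma avgM_nonneg (π : V → ℕ) {A : Matrix V V ℝ} (hA : ∀ u v, 0 ≤ A u v) (u v : V) :
    0 ≤ avgM π A u v :=
  avg_nonneg (fun p : V × V => (π p.1, π p.2)) (A := fun p => A p.1 p.2) (fun p => hA p.1 p.2) (u, v)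

lemma avgM_le_one (π : V → ℕ) {A : Matrix V V ℝ} (hA : ∀ u v, A u v ≤ 1) (u v : V) :
    avgM π A u v ≤ 1 :=
  avg_le_one (fun p : V × V => (π p.1, π p.2)) (A := fun p => A p.1 p.2) (fun p => hA p.1 p.2) (u, v)

/-- Weak regularity lemma. -/
lemma exists_cutLe (A : Matrix V V ℝ) (hA0 : ∀ u v, 0 ≤ A u v) (hA1 : ∀ u v, A u v ≤ 1)
    {e : ℝ} (he : 0 < e) (t : ℕ) (ht : 1 < t * e ^ 2) :
    ∃ π : V → ℕ, (∀ v, π v < 4 ^ t) ∧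
      CutLe (avgM π A - A) (e * (Fintype.card V : ℝ) ^ 2) := by
  set m : ℝ := (Fintype.card V : ℝ) with hm
  have hm0 : 0 ≤ m := Nat.cast_nonneg _
  rcases hm0.eq_or_lt with h0 | hmpos
  · have : IsEmpty V := by
      rw [← Fintype.card_eq_zero_iff]; exact_mod_cast (hm ▸ h0.symm)
    refine ⟨fun _ => 0, fun v => isEmptyElim v, fun S T => ?_⟩
    simp only [Finset.univ_eq_empty, Finset.sum_empty]; positivity
  set q : (V → ℕ) → ℝ := fun π => ∑ p : V × V, avgM π A p.1 p.2 ^ 2 with hq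
  have hq1 : ∀ π, q π ≤ m ^ 2 := by
    intro π
    calc q π ≤ ∑ _p : V × V, (1 : ℝ) := by
          refine Finset.sum_le_sum fun p _ => ?_
          have h1 : avgM π A p.1 p.2 ≤ 1 := avgM_le_one π hA1 _ _
          have h2 : 0 ≤ avgM π A p.1 p.2 := avgM_nonneg π hA0 _ _
          nlinarith
      _ = _ := by simp [hm, sq]
  have key : ∀ s : ℕ, ∃ π : V → ℕ, (∀ v, π v < 4 ^ s) ∧
      (CutLe (avgM π A - A) (e * m ^ 2) ∨ s * e ^ 2 * m ^ 2 ≤ q π) := by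
    intro s
    induction s with
    | zero => exact ⟨fun _ => 0, by simp, Or.inr (by
        simpa using Finset.sum_nonneg fun p _ => sq_nonneg _)⟩
    | succ s ih =>
      obtain ⟨π, h1, h2⟩ := ih
      by_cases hcut : CutLe (avgM π A - A) (e * m ^ 2)
      · exact ⟨π, fun v => (h1 v).trans_le (Nat.pow_le_pow_right (by norm_num) (by omega)),
          Or.inl hcut⟩
      have h2 := h2.resolve_left hcut
      unfold CutLe at hcut
      push Not at hcut
      obtain ⟨S, T, hST⟩ := hcut
      set π' : V → ℕ := fun v => 4 * π v + 2 * (if S v then 1 else 0) + (if T v then 1 else 0)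
        with hπ'
      have hdec : ∀ u v, π' u = π' v → π u = π v ∧ (S u ↔ S v) ∧ (T u ↔ T v) := by
        intro u v h
        simp only [hπ'] at h
        by_cases a : S u <;> by_cases b : S v <;> by_cases c : T u <;> by_cases d : T v <;>
          simp only [a, b, c, d, if_true, if_false, iff_true, iff_false,
            not_true, and_true, and_false, iff_self] at h ⊢ <;> omega
      refine ⟨π', fun v => ?_, Or.inr ?_⟩
      · have := h1 v
        simp only [hπ']
        rw [pow_succ]
        split_ifs <;> omega
      have hinc := energy_increment (fun p : V × V => (π p.1, π p.2))
        (fun p : V × V => (π' p.1, π' p.2)) (fun p q h => by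
          simp only [Prod.mk.injEq] at h ⊢
          exact ⟨(hdec _ _ h.1).1, (hdec _ _ h.2).1⟩) (fun p => A p.1 p.2)
        (g := fun p => ind (S p.1) * ind (T p.2)) (fun p q h => by
          simp only [Prod.mk.injEq] at h
          simp only [(hdec _ _ h.1).2.1, (hdec _ _ h.2).2.2]) (fun p => by
          rw [← ind_and, abs_of_nonneg (ind_nonneg _)]; exact ind_le_one _)
      have hsum : ∑ u, ∑ v, ind (S u) * ind (T v) * (avgM π A - A) u v
          = ∑ p : V × V, ind (S p.1) * ind (T p.2) *
            (avg (fun p : V × V => (π p.1, π p.2)) (fun p => A p.1 p.2) p - A p.1 p.2) := by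
        rw [Fintype.sum_prod_type]; rfl
      rw [← hsum] at hinc
      have hcard : (Fintype.card (V × V) : ℝ) = m ^ 2 := by simp [hm, sq]
      rw [hcard] at hinc
      have h3 : (e * m ^ 2) ^ 2 < m ^ 2 * (q π' - q π) :=
        lt_of_lt_of_le (pow_lt_pow_left₀ hST (by positivity) two_ne_zero) hinc
      have h4 : e ^ 2 * m ^ 2 < q π' - q π := by
        refine lt_of_mul_lt_mul_left (a := m ^ 2) ?_ (by positivity)
        linarith [h3, show (e * m ^ 2) ^ 2 = m ^ 2 * (e ^ 2 * m ^ 2) by ring]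
      push_cast
      linarith
  obtain ⟨π, h1, h2⟩ := key t
  refine ⟨π, h1, h2.resolve_right fun h => ?_⟩
  have := hq1 π
  have : 1 * m ^ 2 < t * e ^ 2 * m ^ 2 := by gcongr
  linarith

/-- Container lemma: a relation with few closed `k`-walks is almost contained in a relation of
bounded complexity with few closed `k`-walks. -/
theorem exists_container (k : ℕ) (hk : 3 ≤ k) {e : ℝ} (he : 0 < e) :
    ∃ M : ℕ, ∃ c > 0, ∀ {V : Type} [Fintype V] [DecidableEq V] (R : V → V → Prop),
      (adj R ^ k).trace ≤ c * (Fintype.card V : ℝ) ^ k →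
      ∃ π : V → ℕ, (∀ v, π v < M) ∧ ∃ P : ℕ → ℕ → Prop,
        ∑ u, ∑ v, ind (R u v ∧ ¬ P (π u) (π v)) ≤ e * (Fintype.card V : ℝ) ^ 2 ∧
        (adj (fun u v => P (π u) (π v)) ^ k).trace ≤ e * (Fintype.card V : ℝ) ^ k := by
  set c : ℝ := e ^ (k + 1) / (k + 1) with hc
  have hc0 : 0 < c := by positivity
  obtain ⟨t, ht⟩ := exists_nat_gt (1 / c ^ 2)
  refine ⟨4 ^ t, c, hc0, ?_⟩
  intro V _ _ R hR
  obtain ⟨π, hπ, hcut⟩ := exists_cutLe (adj R) (adj_nonneg R) (adj_le_one R) hc0 t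
    (by rwa [div_lt_iff₀ (by positivity)] at ht)
  set B := avgM π (adj R) with hB
  have hB0 : ∀ u v, 0 ≤ B u v := avgM_nonneg π (adj_nonneg R)
  have hB1 : ∀ u v, B u v ≤ 1 := avgM_le_one π (adj_le_one R)
  have htr := trace_pow_le_of_cut (adj_nonneg R) (adj_le_one R) hB0 hB1 hcut k hk
  set m : ℝ := (Fintype.card V : ℝ) with hm
  have hm0 : 0 ≤ m := Nat.cast_nonneg _
  have hBc : ∀ u v u' v', π u = π u' → π v = π v' → B u v = B u' v' := by
    intro u v u' v' h h'
    exact avg_congr _ _ (by simp [h, h'])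
  set P : ℕ → ℕ → Prop := fun i j => ∃ u v, π u = i ∧ π v = j ∧ e ≤ B u v with hP
  have hPB : ∀ u v, P (π u) (π v) ↔ e ≤ B u v := by
    intro u v
    constructor
    · rintro ⟨u', v', h1, h2, h⟩; rwa [hBc u v u' v' h1.symm h2.symm]
    · exact fun h => ⟨u, v, rfl, rfl, h⟩
  refine ⟨π, hπ, P, ?_, ?_⟩
  · have h1 : ∑ p : V × V, B p.1 p.2 * ind (¬ P (π p.1) (π p.2))
        = ∑ p : V × V, adj R p.1 p.2 * ind (¬ P (π p.1) (π p.2)) :=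
      sum_avg_mul (fun p : V × V => (π p.1, π p.2)) (fun p => adj R p.1 p.2)
        (g := fun p => ind (¬ P (π p.1) (π p.2))) (fun p q h => by
          simp only [Prod.mk.injEq] at h
          rw [h.1, h.2])
    have h2 : ∑ u, ∑ v, ind (R u v ∧ ¬ P (π u) (π v))
        = ∑ p : V × V, adj R p.1 p.2 * ind (¬ P (π p.1) (π p.2)) := by
      rw [Fintype.sum_prod_type]
      exact Finset.sum_congr rfl fun u _ => Finset.sum_congr rfl fun v _ => ind_and _ _
    rw [h2, ← h1]
    calc _ ≤ ∑ _p : V × V, e := by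
          refine Finset.sum_le_sum fun p _ => ?_
          by_cases h : P (π p.1) (π p.2)
          · rw [ind_false (not_not.2 h), mul_zero]; exact he.le
          · rw [ind_true h, mul_one]; rw [hPB] at h; exact (not_le.1 h).le
      _ = _ := by
          simp only [Finset.sum_const, Finset.card_univ, nsmul_eq_mul, Fintype.card_prod,
            Nat.cast_mul, ← hm]; ring
  · set Q := adj (fun u v => P (π u) (π v)) with hQ
    have hle : ∀ u v, (e • Q) u v ≤ B u v := by
      intro u v
      rw [Matrix.smul_apply, smul_eq_mul, hQ, adj_apply]
      by_cases h : P (π u) (π v)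
      · rw [ind_true h, mul_one]; exact (hPB u v).1 h
      · rw [ind_false h, mul_zero]; exact hB0 u v
    have h3 := trace_mono (pow_entry_mono (A := e • Q) (fun u v => by
      rw [Matrix.smul_apply, smul_eq_mul]; exact mul_nonneg he.le (adj_nonneg _ _ _)) hle k)
    rw [smul_pow, Matrix.trace_smul, smul_eq_mul] at h3
    have h4 : e ^ k * (Q ^ k).trace ≤ e ^ k * (e * m ^ k) := by
      calc _ ≤ c * m ^ k + k * (c * m ^ k) := h3.trans (htr.trans (by gcongr))
        _ = _ := by rw [hc]; field_simp; ring
    exact le_of_mul_le_mul_left h4 (by positivity)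

/-- The relation `R` has a directed cycle of length `k`. -/
def HasCyc {V : Type*} (R : V → V → Prop) (k : ℕ) : Prop :=
  ∃ c : ℕ → V, (∀ i < k, ∀ j < k, c i = c j → i = j) ∧
    (∀ i, i + 1 < k → R (c i) (c (i + 1))) ∧ R (c (k - 1)) (c 0)

lemma mulVec_pow_apply (A : Matrix V V ℝ) (j : ℕ) (h : V → ℝ) (u : V) :
    ((A ^ j).mulVec h) u = ∑ f : Fin j → V,
      (∏ i : Fin j, A ((Fin.cons u f : Fin (j + 1) → V) i.castSucc) (f i))
        * h ((Fin.cons u f : Fin (j + 1) → V) (Fin.last j)) := by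
  induction j generalizing u with
  | zero => simp
  | succ j ih =>
    rw [pow_succ', ← Matrix.mulVec_mulVec, Matrix.mulVec, dotProduct]
    simp_rw [ih, Finset.mul_sum]
    rw [← Fintype.sum_prod_type', ← (Fin.consEquiv fun _ : Fin (j + 1) => V).sum_comp]
    refine Finset.sum_congr rfl fun p _ => ?_
    rw [Fin.prod_univ_succ]
    simp only [Fin.consEquiv_apply, Fin.castSucc_zero, Fin.cons_zero, Fin.cons_succ,
      Fin.castSucc_succ, ← Fin.succ_last]
    ring

lemma trace_pow_succ_apply (A : Matrix V V ℝ) (j : ℕ) :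
    (A ^ (j + 1)).trace = ∑ f : Fin (j + 1) → V,
      (∏ i : Fin j, A (f i.castSucc) (f i.succ)) * A (f (Fin.last j)) (f 0) := by
  have : (A ^ (j + 1)).trace = ∑ u, ((A ^ j).mulVec fun v => A v u) u := by
    rw [pow_succ]; rfl
  rw [this]
  simp_rw [mulVec_pow_apply]
  rw [← Fintype.sum_prod_type', ← (Fin.consEquiv fun _ : Fin (j + 1) => V).sum_comp]
  refine Finset.sum_congr rfl fun p _ => ?_
  simp [Fin.consEquiv_apply]

lemma sum_ind_eq_at_le {j : ℕ} (a b : Fin (j + 1)) (hab : a ≠ b) :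
    ∑ f : Fin (j + 1) → V, ind (f a = f b) ≤ (Fintype.card V : ℝ) ^ j := by
  rw [sum_ind, ← Nat.cast_pow, Nat.cast_le]
  have h : Fintype.card ({i : Fin (j + 1) // i ≠ b} → V) = Fintype.card V ^ j := by
    rw [Fintype.card_fun]; simp
  rw [← h, ← Finset.card_univ]
  refine Finset.card_le_card_of_injOn (fun f i => f i.1) (fun _ _ => Finset.mem_coe.2 (Finset.mem_univ _)) ?_
  intro f hf g hg hfg
  simp only [Finset.coe_filter, Finset.mem_univ, true_and, Set.mem_ofPred_eq] at hf hg
  have hne : ∀ i, i ≠ b → f i = g i := fun i hi => congrFun hfg ⟨i, hi⟩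
  funext i
  by_cases hi : i = b
  · rw [hi, ← hf, ← hg, hne a hab]
  · exact hne i hi

/-- Without directed `k`-cycles there are few closed `k`-walks. -/
lemma trace_le_of_no_cyc (R : V → V → Prop) (k : ℕ) (hk : 0 < k) (h : ¬ HasCyc R k) :
    (adj R ^ k).trace ≤ k ^ 2 * (Fintype.card V : ℝ) ^ (k - 1) := by
  obtain ⟨j, rfl⟩ : ∃ j, k = j + 1 := ⟨k - 1, by omega⟩
  rw [trace_pow_succ_apply]
  have hterm : ∀ f : Fin (j + 1) → V,
      (∏ i : Fin j, adj R (f i.castSucc) (f i.succ)) * adj R (f (Fin.last j)) (f 0)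
        ≤ ∑ p : Fin (j + 1) × Fin (j + 1), ind (p.1 ≠ p.2 ∧ f p.1 = f p.2) := by
    intro f
    have hprod0 : 0 ≤ ∏ i : Fin j, adj R (f i.castSucc) (f i.succ) :=
      Finset.prod_nonneg fun i _ => adj_nonneg _ _ _
    have hprod1 : ∏ i : Fin j, adj R (f i.castSucc) (f i.succ) ≤ 1 :=
      Finset.prod_le_one (fun i _ => adj_nonneg _ _ _) fun i _ => adj_le_one _ _ _
    by_cases hf : Function.Injective f
    · suffices h0 : (∏ i : Fin j, adj R (f i.castSucc) (f i.succ)) * adj R (f (Fin.last j)) (f 0) = 0 by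
        rw [h0]; exact Finset.sum_nonneg fun _ _ => ind_nonneg _
      by_contra hne
      obtain ⟨hn1, hn2⟩ := mul_ne_zero_iff.1 hne
      rw [Finset.prod_ne_zero_iff] at hn1
      have harc : ∀ u v, adj R u v ≠ 0 → R u v := fun u v huv => by
        by_contra hc; exact huv (ind_false hc)
      refine h ⟨fun i => if hi : i < j + 1 then f ⟨i, hi⟩ else f 0, ?_, ?_, ?_⟩
      · intro a ha b hb hab
        simp only [dif_pos ha, dif_pos hb] at hab
        simpa using hf hab
      · intro i hi
        simp only [dif_pos hi, dif_pos (show i < j + 1 by omega)]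
        exact harc _ _ (hn1 ⟨i, by omega⟩ (Finset.mem_univ _))
      · simp only [Nat.add_sub_cancel, dif_pos (Nat.lt_succ_self j), dif_pos (Nat.succ_pos j)]
        exact harc _ _ hn2
    · rw [Function.Injective] at hf
      push Not at hf
      obtain ⟨a, b, hab, hne⟩ := hf
      calc _ ≤ (1 : ℝ) := mul_le_one₀ hprod1 (adj_nonneg _ _ _) (adj_le_one _ _ _)
        _ = ind ((a, b).1 ≠ (a, b).2 ∧ f (a, b).1 = f (a, b).2) := (ind_true ⟨hne, hab⟩).symm
        _ ≤ _ := Finset.single_le_sum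
          (f := fun p : Fin (j + 1) × Fin (j + 1) => ind (p.1 ≠ p.2 ∧ f p.1 = f p.2))
          (fun _ _ => ind_nonneg _) (Finset.mem_univ (a, b))
  refine (Finset.sum_le_sum fun f _ => hterm f).trans ?_
  rw [Finset.sum_comm]
  calc _ ≤ ∑ _p : Fin (j + 1) × Fin (j + 1), (Fintype.card V : ℝ) ^ j := by
        refine Finset.sum_le_sum fun p _ => ?_
        by_cases hp : p.1 = p.2
        · simp only [hp, ne_eq, not_true_eq_false, false_and]
          rw [ind_false not_false, Finset.sum_const_zero]; positivity
        · simp only [ne_eq, hp, not_false_eq_true, true_and]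
          exact sum_ind_eq_at_le p.1 p.2 hp
    _ = _ := by
        simp only [Finset.sum_const, Finset.card_univ, nsmul_eq_mul, Fintype.card_prod,
          Fintype.card_fin, Nat.add_sub_cancel]
        push_cast; ring

end Rel

lemma sum_comp_le_of_injective {W V : Type*} [Fintype W] [Fintype V] {φ : W → V}
    (hφ : Function.Injective φ) {f : V → ℝ} (hf : ∀ v, 0 ≤ f v) : ∑ w, f (φ w) ≤ ∑ v, f v := by
  rw [← Finset.sum_image (s := Finset.univ) (f := f) (fun _ _ _ _ h => hφ h)]
  exact Finset.sum_le_sum_of_subset_of_nonneg (Finset.subset_univ _) fun v _ _ => hf v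

section Sub
variable {V W : Type*} [Fintype V] [DecidableEq V] [Fintype W] [DecidableEq W]

lemma adj_comp_pow_le (R : V → V → Prop) {φ : W → V} (hφ : Function.Injective φ) (j : ℕ) (a b : W) :
    (adj (fun u v => R (φ u) (φ v)) ^ j) a b ≤ (adj R ^ j) (φ a) (φ b) := by
  induction j generalizing b with
  | zero =>
    simp only [pow_zero, Matrix.one_apply, hφ.eq_iff]; rfl
  | succ j ih =>
    rw [pow_succ, pow_succ, Matrix.mul_apply, Matrix.mul_apply]
    refine le_trans (Finset.sum_le_sum fun w _ => ?_)
      (sum_comp_le_of_injective hφ (f := fun v => (adj R ^ j) (φ a) v * adj R v (φ b))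
        fun v => mul_nonneg (pow_entry_nonneg (adj_nonneg R) _ _ _) (adj_nonneg R _ _))
    exact mul_le_mul_of_nonneg_right (ih w) (adj_nonneg R _ _)

lemma trace_comp_le (R : V → V → Prop) {φ : W → V} (hφ : Function.Injective φ) (j : ℕ) :
    (adj (fun u v => R (φ u) (φ v)) ^ j).trace ≤ (adj R ^ j).trace :=
  (Finset.sum_le_sum fun a _ => adj_comp_pow_le R hφ j a a).trans
    (sum_comp_le_of_injective hφ (f := fun v => (adj R ^ j) v v)
      fun v => pow_entry_nonneg (adj_nonneg R) _ _ _)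

end Sub

/-- Weighted count of small subsets. -/
lemma sum_small_subsets_le {α : Type*} (Y : Finset α) {t θ b N : ℝ} (ht : 0 < t)
    (ht1 : t ≤ 1) (hb : 0 ≤ b) (hN : (Y.card : ℝ) ≤ N) :
    ∑ X ∈ Y.powerset, ind ((X.card : ℝ) ≤ θ * N) * Real.exp (b * X.card)
      ≤ Real.exp (N * (t + θ * (b - Real.log t))) := by
  have hlog : Real.log t ≤ 0 := Real.log_nonpos ht.le ht1
  have h1 : ∀ X : Finset α, ind ((X.card : ℝ) ≤ θ * N) * Real.exp (b * X.card)
      ≤ t ^ X.card * Real.exp (θ * N * (b - Real.log t)) := by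
    intro X
    by_cases h : (X.card : ℝ) ≤ θ * N
    · rw [ind_true h, one_mul]
      have : t ^ X.card = Real.exp (X.card * Real.log t) := by
        rw [Real.exp_nat_mul, Real.exp_log ht]
      rw [this, ← Real.exp_add, Real.exp_le_exp]
      nlinarith [h]
    · rw [ind_false h, zero_mul]
      positivity
  refine (Finset.sum_le_sum fun X _ => h1 X).trans ?_
  have h2 : ∑ X ∈ Y.powerset, t ^ X.card * Real.exp (θ * N * (b - Real.log t))
      = (t + 1) ^ Y.card * Real.exp (θ * N * (b - Real.log t)) := by
    rw [← Finset.sum_pow_mul_eq_add_pow t 1 Y, Finset.sum_mul]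
    simp only [one_pow, mul_one]
  rw [h2]
  calc _ ≤ Real.exp (N * t) * Real.exp (θ * N * (b - Real.log t)) := by
        gcongr
        calc (t + 1) ^ Y.card ≤ (Real.exp t) ^ Y.card := by
              gcongr; exact Real.add_one_le_exp t
          _ = Real.exp (Y.card * t) := (Real.exp_nat_mul _ _).symm
          _ ≤ _ := by rw [Real.exp_le_exp]; gcongr
    _ = _ := by rw [← Real.exp_add]; ring_nf

/-- The window `[a, b)` has forward arcs between any two large separated sets. -/
def NiceWin (T : ℕ → ℕ → Prop) (ε : ℝ) (a b : ℕ) : Prop :=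
  ∀ X Y : Finset ℕ, X ⊆ Finset.Ico a b → Y ⊆ Finset.Ico a b → (∀ x ∈ X, ∀ y ∈ Y, x < y) →
    ε * (b - a : ℕ) ≤ X.card → ε * (b - a : ℕ) ≤ Y.card → ∃ x ∈ X, ∃ y ∈ Y, T x y

/-- No reordering inside a window reduces the number of backward arcs. -/
def OptOn (T : ℕ → ℕ → Prop) (p : ℕ) : Prop :=
  ∀ a b : ℕ, b ≤ p → ∀ ρ : ℕ → ℝ,
    ∑ u ∈ Finset.Ico a b, ∑ v ∈ Finset.Ico a b, ind (T u v ∧ v < u)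
      ≤ ∑ u ∈ Finset.Ico a b, ∑ v ∈ Finset.Ico a b, ind (T u v ∧ ρ v ≤ ρ u)

/-- The status of the pair `z < x`: `0` for no arc, `1` for a forward arc, `2` for a backward arc. -/
noncomputable def status (T : ℕ → ℕ → Prop) (z x : ℕ) : Fin 3 :=
  if T z x then 1 else if T x z then 2 else 0

/-- In a window where `R` has few non-adjacent pairs, an optimally ordered subrelation has few
backward arcs. -/
theorem exists_window_backward_le (k : ℕ) (hk : 3 ≤ k) {g : ℝ} (hg : 0 < g) :
    ∃ c > 0, ∀ (p a b : ℕ), a ≤ b → b ≤ p → ∀ (T : ℕ → ℕ → Prop) (R : ℕ → ℕ → Prop) (e : ℝ),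
      OptOn T p →
      (adj (fun u v : Fin p => R u v) ^ k).trace ≤ c * (b - a : ℕ) ^ k →
      ∑ u ∈ Finset.Ico a b, ∑ v ∈ Finset.Ico a b, ind (¬ R u v ∧ ¬ R v u) ≤ c * (b - a : ℕ) ^ 2 →
      ∑ u ∈ Finset.range p, ∑ v ∈ Finset.range p, ind (T u v ∧ ¬ R u v) ≤ e →
      ∑ u ∈ Finset.Ico a b, ∑ v ∈ Finset.Ico a b, ind (T u v ∧ v < u) ≤ g * (b - a : ℕ) ^ 2 + e := by
  obtain ⟨c, hc, h⟩ := exists_backward_le k hk hg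
  refine ⟨c, hc, ?_⟩
  intro p a b hab hbp T R e hopt htr hnon hexc
  set w := b - a with hw
  set φ : Fin w → Fin p := fun i => ⟨a + i, by omega⟩ with hφ
  have hφi : Function.Injective φ := fun i j hij => by
    simp only [hφ, Fin.mk.injEq] at hij; exact Fin.ext (by omega)
  set R' : Fin w → Fin w → Prop := fun i j => R (a + i) (a + j) with hR'
  have hsum : ∀ f : ℕ → ℕ → ℝ, ∑ u ∈ Finset.Ico a b, ∑ v ∈ Finset.Ico a b, f u v
      = ∑ i : Fin w, ∑ j : Fin w, f (a + i) (a + j) := by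
    intro f
    rw [Finset.sum_Ico_eq_sum_range, ← Fin.sum_univ_eq_sum_range (fun i => ∑ v ∈ Finset.Ico a b, f (a + i) v)]
    refine Finset.sum_congr rfl fun i _ => ?_
    rw [Finset.sum_Ico_eq_sum_range, ← Fin.sum_univ_eq_sum_range (fun j => f (a + i) (a + j))]
  have h1 := h R' (by
    rw [Fintype.card_fin]
    exact (trace_comp_le (fun u v : Fin p => R u v) hφi k).trans htr) (by
    rw [Fintype.card_fin]; rw [hsum] at hnon; exact hnon)
  set ρ : ℕ → ℝ := fun u => if hu : a ≤ u ∧ u < b then - odeg R' ⟨u - a, by omega⟩ else 0 with hρ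
  have hρ' : ∀ i : Fin w, ρ (a + i) = - odeg R' i := by
    intro i
    have : a ≤ a + (i : ℕ) ∧ a + (i : ℕ) < b := ⟨by omega, by omega⟩
    simp only [hρ, dif_pos this]
    congr 2
    exact Fin.ext (by simp)
  refine (hopt a b hbp ρ).trans ?_
  have h2 : ∑ u ∈ Finset.Ico a b, ∑ v ∈ Finset.Ico a b, ind (T u v ∧ ρ v ≤ ρ u)
      ≤ ∑ u ∈ Finset.Ico a b, ∑ v ∈ Finset.Ico a b, ind (R u v ∧ ρ v ≤ ρ u)
        + ∑ u ∈ Finset.Ico a b, ∑ v ∈ Finset.Ico a b, ind (T u v ∧ ¬ R u v) := by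
    simp_rw [← Finset.sum_add_distrib]
    refine Finset.sum_le_sum fun u _ => Finset.sum_le_sum fun v _ => ?_
    unfold ind
    split_ifs <;> first | tauto | norm_num
  have h3 : ∑ u ∈ Finset.Ico a b, ∑ v ∈ Finset.Ico a b, ind (T u v ∧ ¬ R u v) ≤ e := by
    refine le_trans ?_ hexc
    have hs : Finset.Ico a b ⊆ Finset.range p := fun x hx => by
      rw [Finset.mem_Ico] at hx; exact Finset.mem_range.2 (by omega)
    refine (Finset.sum_le_sum_of_subset_of_nonneg hs fun u _ _ =>
      Finset.sum_nonneg fun v _ => ind_nonneg _).trans ?_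
    exact Finset.sum_le_sum fun u _ =>
      Finset.sum_le_sum_of_subset_of_nonneg hs fun u _ _ => ind_nonneg _
  have h4 : ∑ u ∈ Finset.Ico a b, ∑ v ∈ Finset.Ico a b, ind (R u v ∧ ρ v ≤ ρ u)
      ≤ g * (w : ℝ) ^ 2 := by
    rw [hsum]
    simp_rw [hρ', neg_le_neg_iff]
    rw [Fintype.card_fin] at h1
    exact h1
  linarith

/-- Sum over pairs `z < x < p`. -/
noncomputable def pairSum (p : ℕ) (f : ℕ → ℕ → ℝ) : ℝ :=
  ∑ x ∈ Finset.range p, ∑ z ∈ Finset.range x, f z x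

lemma pairSum_mono {p : ℕ} {f g : ℕ → ℕ → ℝ} (h : ∀ z x, z < x → x < p → f z x ≤ g z x) :
    pairSum p f ≤ pairSum p g :=
  Finset.sum_le_sum fun x hx => Finset.sum_le_sum fun z hz =>
    h z x (Finset.mem_range.1 hz) (Finset.mem_range.1 hx)

lemma pairSum_add (p : ℕ) (f g : ℕ → ℕ → ℝ) :
    pairSum p (fun z x => f z x + g z x) = pairSum p f + pairSum p g := by
  unfold pairSum; simp_rw [Finset.sum_add_distrib]

lemma pairSum_nonneg {p : ℕ} {f : ℕ → ℕ → ℝ} (h : ∀ z x, 0 ≤ f z x) : 0 ≤ pairSum p f :=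
  Finset.sum_nonneg fun _ _ => Finset.sum_nonneg fun _ _ => h _ _

lemma sum_square_eq (p : ℕ) (f : ℕ → ℕ → ℝ) :
    ∑ u ∈ Finset.range p, ∑ v ∈ Finset.range p, f u v
      = pairSum p (fun z x => f z x + f x z) + ∑ u ∈ Finset.range p, f u u := by
  induction p with
  | zero => simp [pairSum]
  | succ p ih =>
    have e : pairSum (p + 1) (fun z x => f z x + f x z)
        = pairSum p (fun z x => f z x + f x z) + ∑ z ∈ Finset.range p, (f z p + f p z) := by
      unfold pairSum; rw [Finset.sum_range_succ]
    rw [Finset.sum_range_succ, e, Finset.sum_range_succ (fun u => f u u)]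
    simp_rw [Finset.sum_range_succ (fun v => f _ v)]
    rw [Finset.sum_add_distrib, ih, Finset.sum_add_distrib]
    ring

lemma sum_fin_square (p : ℕ) (f : ℕ → ℕ → ℝ) :
    ∑ u : Fin p, ∑ v : Fin p, f u v = ∑ u ∈ Finset.range p, ∑ v ∈ Finset.range p, f u v := by
  rw [← Fin.sum_univ_eq_sum_range (fun u => ∑ v ∈ Finset.range p, f u v)]
  exact Finset.sum_congr rfl fun u _ => Fin.sum_univ_eq_sum_range (fun v => f u v) p

/-- A family of disjoint nonempty windows in `[0, p)`. -/
def WinFam (p : ℕ) (W : Finset (ℕ × ℕ)) : Prop :=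
  (∀ I ∈ W, I.1 < I.2 ∧ I.2 ≤ p) ∧ ∀ I ∈ W, ∀ J ∈ W, I ≠ J → I.2 ≤ J.1 ∨ J.2 ≤ I.1

lemma WinFam.subset {p : ℕ} {W W' : Finset (ℕ × ℕ)} (h : WinFam p W) (hs : W' ⊆ W) :
    WinFam p W' :=
  ⟨fun I hI => h.1 I (hs hI), fun I hI J hJ => h.2 I (hs hI) J (hs hJ)⟩

lemma WinFam.eq_of_mem {p : ℕ} {W : Finset (ℕ × ℕ)} (h : WinFam p W) {I J : ℕ × ℕ} (hI : I ∈ W)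
    (hJ : J ∈ W) {u : ℕ} (h1 : I.1 ≤ u) (h2 : u < I.2) (h3 : J.1 ≤ u) (h4 : u < J.2) : I = J := by
  by_contra hne
  rcases h.2 I hI J hJ hne with h | h <;> omega

lemma WinFam.sum_le {p : ℕ} {W : Finset (ℕ × ℕ)} (h : WinFam p W) {f : ℕ → ℕ → ℝ}
    (hf : ∀ u v, 0 ≤ f u v) :
    ∑ I ∈ W, ∑ u ∈ Finset.Ico I.1 I.2, ∑ v ∈ Finset.Ico I.1 I.2, f u v
      ≤ ∑ u ∈ Finset.range p, ∑ v ∈ Finset.range p, f u v := by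
  simp_rw [← Finset.sum_product']
  rw [← Finset.sum_biUnion]
  · refine Finset.sum_le_sum_of_subset_of_nonneg ?_ fun _ _ _ => hf _ _
    intro q hq
    simp only [Finset.mem_biUnion, Finset.mem_product, Finset.mem_Ico, Finset.mem_range] at hq ⊢
    obtain ⟨I, hI, h1, h2⟩ := hq
    have := (h.1 I hI).2
    omega
  · intro I hI J hJ hne
    refine Finset.disjoint_left.2 fun q hq hq' => ?_
    simp only [Finset.mem_product, Finset.mem_Ico] at hq hq'
    exact hne (h.eq_of_mem hI hJ hq.1.1 hq.1.2 hq'.1.1 hq'.1.2)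

lemma WinFam.sum_len_le {p : ℕ} {W : Finset (ℕ × ℕ)} (h : WinFam p W) :
    ∑ I ∈ W, ((I.2 - I.1 : ℕ) : ℝ) ≤ p := by
  have h1 : ∑ I ∈ W, (I.2 - I.1) = (W.biUnion fun I => Finset.Ico I.1 I.2).card := by
    rw [Finset.card_biUnion]
    · simp
    · intro I hI J hJ hne
      refine Finset.disjoint_left.2 fun q hq hq' => ?_
      simp only [Finset.mem_Ico] at hq hq'
      exact hne (h.eq_of_mem hI hJ hq.1 hq.2 hq'.1 hq'.2)
  rw [← Nat.cast_sum, h1]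
  have : (W.biUnion fun I => Finset.Ico I.1 I.2) ⊆ Finset.range p := by
    intro q hq
    simp only [Finset.mem_biUnion, Finset.mem_Ico, Finset.mem_range] at hq ⊢
    obtain ⟨I, hI, h1, h2⟩ := hq
    have := (h.1 I hI).2
    omega
  have := Finset.card_le_card this
  rw [Finset.card_range] at this
  exact_mod_cast this

/-- Discarding short windows loses at most half of the total squared length. -/
lemma WinFam.long_windows {p : ℕ} {W : Finset (ℕ × ℕ)} (h : WinFam p W) {σ : ℝ} (hσ : 0 ≤ σ)
    (hW : σ * (p : ℝ) ^ 2 ≤ ∑ I ∈ W, ((I.2 - I.1 : ℕ) : ℝ) ^ 2) :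
    σ / 2 * (p : ℝ) ^ 2
      ≤ ∑ I ∈ W with σ / 2 * p ≤ ((I.2 - I.1 : ℕ) : ℝ), ((I.2 - I.1 : ℕ) : ℝ) ^ 2 := by
  have h1 := Finset.sum_filter_add_sum_filter_not W (fun I => σ / 2 * p ≤ ((I.2 - I.1 : ℕ) : ℝ))
    (fun I => ((I.2 - I.1 : ℕ) : ℝ) ^ 2)
  have h2 : ∑ I ∈ W with ¬ σ / 2 * p ≤ ((I.2 - I.1 : ℕ) : ℝ), ((I.2 - I.1 : ℕ) : ℝ) ^ 2
      ≤ σ / 2 * p * p := by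
    calc _ ≤ ∑ I ∈ W with ¬ σ / 2 * p ≤ ((I.2 - I.1 : ℕ) : ℝ),
          σ / 2 * p * ((I.2 - I.1 : ℕ) : ℝ) := by
          refine Finset.sum_le_sum fun I hI => ?_
          rw [sq]
          exact mul_le_mul_of_nonneg_right (not_le.1 (Finset.mem_filter.1 hI).2).le
            (Nat.cast_nonneg _)
      _ = σ / 2 * p * ∑ I ∈ W with ¬ σ / 2 * p ≤ ((I.2 - I.1 : ℕ) : ℝ),
          ((I.2 - I.1 : ℕ) : ℝ) := by rw [Finset.mul_sum]
      _ ≤ _ := by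
          gcongr
          exact (h.subset (Finset.filter_subset _ _)).sum_len_le
  nlinarith

/-- Codes for unions of rectangles. -/
def RectCode (γ : ℕ → ℕ) (z x : ℕ) : Prop := Even (γ z) ∧ γ x = γ z + 1

/-- A union of rectangles inside disjoint windows is described by a single function. -/
lemma exists_rectCode {p : ℕ} {W : Finset (ℕ × ℕ)} (h : WinFam p W)
    (X Y : ℕ × ℕ → Finset ℕ) (hX : ∀ I ∈ W, X I ⊆ Finset.Ico I.1 I.2)
    (hY : ∀ I ∈ W, Y I ⊆ Finset.Ico I.1 I.2) (hXY : ∀ I ∈ W, ∀ x ∈ X I, ∀ y ∈ Y I, x < y) :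
    ∃ γ : ℕ → ℕ, (∀ u, γ u < 2 * p + 1) ∧
      ∀ z x, RectCode γ z x ↔ ∃ I ∈ W, z ∈ X I ∧ x ∈ Y I := by
  have hX' : ∀ I ∈ W, ∀ u ∈ X I, I.1 ≤ u ∧ u < I.2 := fun I hI u hu => Finset.mem_Ico.1 (hX I hI hu)
  have hY' : ∀ I ∈ W, ∀ u ∈ Y I, I.1 ≤ u ∧ u < I.2 := fun I hI u hu => Finset.mem_Ico.1 (hY I hI hu)
  set γ : ℕ → ℕ := fun u => if hu : ∃ I ∈ W, u ∈ X I then 2 * hu.choose.1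
    else if hu : ∃ I ∈ W, u ∈ Y I then 2 * hu.choose.1 + 1 else 2 * p with hγ
  have gX : ∀ I ∈ W, ∀ u ∈ X I, γ u = 2 * I.1 := by
    intro I hI u hu
    have hex : ∃ I ∈ W, u ∈ X I := ⟨I, hI, hu⟩
    simp only [hγ, dif_pos hex]
    have hs := hex.choose_spec
    have h1 := hX' _ hs.1 u hs.2
    have h2 := hX' I hI u hu
    rw [h.eq_of_mem hs.1 hI h1.1 h1.2 h2.1 h2.2]
  have gY : ∀ I ∈ W, ∀ u ∈ Y I, γ u = 2 * I.1 + 1 := by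
    intro I hI u hu
    have hnex : ¬ ∃ I ∈ W, u ∈ X I := by
      rintro ⟨J, hJ, hu'⟩
      have h1 := hX' J hJ u hu'
      have h2 := hY' I hI u hu
      obtain rfl := h.eq_of_mem hJ hI h1.1 h1.2 h2.1 h2.2
      exact lt_irrefl _ (hXY J hJ u hu' u hu)
    have hex : ∃ I ∈ W, u ∈ Y I := ⟨I, hI, hu⟩
    simp only [hγ, dif_neg hnex, dif_pos hex]
    have hs := hex.choose_spec
    have h1 := hY' _ hs.1 u hs.2
    have h2 := hY' I hI u hu
    rw [h.eq_of_mem hs.1 hI h1.1 h1.2 h2.1 h2.2]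
  have gN : ∀ u, (¬ ∃ I ∈ W, u ∈ X I) → (¬ ∃ I ∈ W, u ∈ Y I) → γ u = 2 * p := by
    intro u h1 h2
    simp only [hγ, dif_neg h1, dif_neg h2]
  have hlt : ∀ u, γ u < 2 * p + 1 := by
    intro u
    by_cases h1 : ∃ I ∈ W, u ∈ X I
    · obtain ⟨I, hI, hu⟩ := h1
      have := h.1 I hI
      rw [gX I hI u hu]; omega
    by_cases h2 : ∃ I ∈ W, u ∈ Y I
    · obtain ⟨I, hI, hu⟩ := h2
      have := h.1 I hI
      rw [gY I hI u hu]; omega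
    · rw [gN u h1 h2]; omega
  refine ⟨γ, hlt, fun z x => ⟨?_, ?_⟩⟩
  · rintro ⟨⟨r, hr⟩, he⟩
    by_cases h1 : ∃ I ∈ W, z ∈ X I
    · obtain ⟨I, hI, hz⟩ := h1
      rw [gX I hI z hz] at he
      by_cases h2 : ∃ J ∈ W, x ∈ X J
      · obtain ⟨J, hJ, hx⟩ := h2
        rw [gX J hJ x hx] at he; omega
      by_cases h3 : ∃ J ∈ W, x ∈ Y J
      · obtain ⟨J, hJ, hx⟩ := h3
        rw [gY J hJ x hx] at he
        have e : J.1 = I.1 := by omega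
        have l1 := (h.1 I hI).1
        have l2 := (h.1 J hJ).1
        obtain rfl := h.eq_of_mem hI hJ (u := I.1) le_rfl l1 e.le (by omega)
        exact ⟨I, hI, hz, hx⟩
      · rw [gN x h2 h3] at he; omega
    by_cases h2 : ∃ J ∈ W, z ∈ Y J
    · obtain ⟨J, hJ, hz⟩ := h2
      rw [gY J hJ z hz] at hr; omega
    · rw [gN z h1 h2] at he
      have := hlt x
      omega
  · rintro ⟨I, hI, hz, hx⟩
    refine ⟨?_, ?_⟩
    · rw [gX I hI z hz]; exact even_two_mul _
    · rw [gX I hI z hz, gY I hI x hx]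

/-- Savings rate for pairs without options. -/
noncomputable def bZero : ℝ := -3 * Real.log (17 / 20)
/-- Cost rate for pairs with all options. -/
noncomputable def dZero : ℝ := Real.log (31 / 20)

lemma bZero_nonneg : 0 ≤ bZero := by
  have : Real.log (17 / 20) ≤ 0 := Real.log_nonpos (by norm_num) (by norm_num)
  unfold bZero; linarith

lemma dZero_nonneg : 0 ≤ dZero := Real.log_nonneg (by norm_num)

lemma dZero_le_one : dZero ≤ 1 := by
  have := Real.log_le_sub_one_of_pos (x := 31 / 20) (by norm_num)
  unfold dZero; linarith

lemma bZero_le_one : bZero ≤ 1 := by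
  have h := Real.log_le_sub_one_of_pos (x := 20 / 17) (by norm_num)
  have e : Real.log (17 / 20) = - Real.log (20 / 17) := by
    rw [← Real.log_inv]; norm_num
  unfold bZero; rw [e]; linarith

lemma bZero_sub_dZero : 48 / 1000 ≤ bZero - dZero := by
  have h := Real.log_le_sub_one_of_pos (x := (17 / 20) ^ 3 * (31 / 20)) (by norm_num)
  rw [Real.log_mul (by norm_num) (by norm_num), Real.log_pow] at h
  unfold bZero dZero
  push_cast at h
  norm_num at h ⊢
  linarith

lemma log_fifty_le : - Real.log (1 / 50) ≤ 4 := by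
  have e : - Real.log (1 / 50) = Real.log 50 := by
    rw [← Real.log_inv]; norm_num
  rw [e, Real.log_le_iff_le_exp (by norm_num)]
  have h := Real.exp_one_gt_d9
  have e4 : Real.exp 4 = Real.exp 1 ^ 4 := by rw [← Real.exp_nat_mul]; norm_num
  rw [e4]
  calc (50 : ℝ) ≤ 2.7182818283 ^ 4 := by norm_num
    _ ≤ _ := by gcongr

/-- The options left for a pair `z < x` by a container `R`, a sparse set `Z` and exceptions `A`. -/
noncomputable def opts (R Z : ℕ → ℕ → Prop) (A : Finset (ℕ × ℕ)) (z x : ℕ) : Finset (Fin 3) :=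
  if (z, x) ∈ A then {1} else if (x, z) ∈ A then {2} else if Z z x then {0}
  else Finset.univ.filter fun o => (o = 1 → R z x) ∧ (o = 2 → R x z)

/-- Number of pairs forced to be non-adjacent. -/
noncomputable def nullPairs (p : ℕ) (Ω : ℕ → ℕ → Finset (Fin 3)) : ℝ :=
  pairSum p fun z x => ind (Ω z x ⊆ {0})
/-- Number of unrestricted pairs. -/
noncomputable def fullPairs (p : ℕ) (Ω : ℕ → ℕ → Finset (Fin 3)) : ℝ :=
  pairSum p fun z x => ind (Ω z x = Finset.univ)
/-- Number of pairs which are sparse or non-adjacent in the container. -/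
noncomputable def sparsePairs (p : ℕ) (R Z : ℕ → ℕ → Prop) : ℝ :=
  pairSum p fun z x => ind (Z z x ∨ (¬ R z x ∧ ¬ R x z))

lemma sum_square_mem_le (p : ℕ) (A : Finset (ℕ × ℕ)) :
    ∑ u ∈ Finset.range p, ∑ v ∈ Finset.range p, ind ((u, v) ∈ A) ≤ A.card := by
  rw [← Finset.sum_product' (f := fun u v => ind ((u, v) ∈ A))]
  simp only [ind, Prod.mk.eta]
  rw [← Finset.sum_filter, Finset.sum_const, nsmul_eq_mul, mul_one]
  exact_mod_cast Finset.card_le_card fun q hq => (Finset.mem_filter.1 hq).2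

lemma sparsePairs_le (p : ℕ) (R Z : ℕ → ℕ → Prop) (A : Finset (ℕ × ℕ)) :
    sparsePairs p R Z ≤ nullPairs p (opts R Z A) + A.card := by
  have h1 : sparsePairs p R Z ≤ pairSum p fun z x => ind (opts R Z A z x ⊆ {0})
      + (ind ((z, x) ∈ A) + ind ((x, z) ∈ A)) := by
    refine pairSum_mono fun z x _ _ => ?_
    by_cases hA : (z, x) ∈ A
    · rw [ind_true hA]
      linarith [ind_le_one (Z z x ∨ (¬ R z x ∧ ¬ R x z)), ind_nonneg (opts R Z A z x ⊆ {0}),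
        ind_nonneg ((x, z) ∈ A)]
    by_cases hA' : (x, z) ∈ A
    · rw [ind_true hA']
      linarith [ind_le_one (Z z x ∨ (¬ R z x ∧ ¬ R x z)), ind_nonneg (opts R Z A z x ⊆ {0}),
        ind_nonneg ((z, x) ∈ A)]
    · rw [ind_false hA, ind_false hA', add_zero, add_zero]
      refine ind_mono fun h => ?_
      unfold opts
      rw [if_neg hA, if_neg hA']
      split_ifs with hZ
      · exact subset_rfl
      · obtain ⟨n1, n2⟩ := h.resolve_left hZ
        intro o ho
        obtain ⟨-, o1, o2⟩ := Finset.mem_filter.1 ho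
        rw [Finset.mem_singleton]
        fin_cases o
        · rfl
        · exact absurd (o1 rfl) n1
        · exact absurd (o2 rfl) n2
  rw [pairSum_add] at h1
  have h2 := sum_square_eq p (fun u v => ind ((u, v) ∈ A))
  have h3 := sum_square_mem_le p A
  have h4 : 0 ≤ ∑ u ∈ Finset.range p, ind ((u, u) ∈ A) := Finset.sum_nonneg fun _ _ => ind_nonneg _
  unfold nullPairs
  linarith

lemma fullPairs_le (p : ℕ) (R Z : ℕ → ℕ → Prop) (A : Finset (ℕ × ℕ)) {γ : ℝ}
    (hR : dbl (fun u v : Fin p => R u v) ≤ non (fun u v : Fin p => R u v) + γ * (p : ℝ) ^ 2) :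
    fullPairs p (opts R Z A) ≤ sparsePairs p R Z + p / 2 + γ / 2 * (p : ℝ) ^ 2 := by
  have h1 : fullPairs p (opts R Z A) ≤ pairSum p fun z x => ind (R z x ∧ R x z) := by
    refine pairSum_mono fun z x _ _ => ind_mono fun h => ?_
    have m1 : (1 : Fin 3) ∈ opts R Z A z x := h ▸ Finset.mem_univ _
    have m2 : (2 : Fin 3) ∈ opts R Z A z x := h ▸ Finset.mem_univ _
    have m0 : (0 : Fin 3) ∈ opts R Z A z x := h ▸ Finset.mem_univ _
    unfold opts at m0 m1 m2
    split_ifs at m0 m1 m2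
    · simp at m0
    · simp at m0
    · simp at m1
    · exact ⟨(Finset.mem_filter.1 m1).2.1 rfl, (Finset.mem_filter.1 m2).2.2 rfl⟩
  have h2 : dbl (fun u v : Fin p => R u v) = _ := sum_fin_square p (fun u v => ind (R u v ∧ R v u))
  have h3 : non (fun u v : Fin p => R u v) = _ :=
    sum_fin_square p (fun u v => ind (¬ R u v ∧ ¬ R v u))
  rw [sum_square_eq] at h2 h3
  rw [pairSum_add] at h2 h3
  have h4 : (pairSum p fun z x => ind (R x z ∧ R z x)) = pairSum p fun z x => ind (R z x ∧ R x z) := by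
    simp_rw [and_comm]
  have h5 : ∀ z x, ind (¬ R x z ∧ ¬ R z x) ≤ ind (Z z x ∨ (¬ R z x ∧ ¬ R x z)) :=
    fun z x => ind_mono (by tauto)
  have h5' : ∀ z x, ind (¬ R z x ∧ ¬ R x z) ≤ ind (Z z x ∨ (¬ R z x ∧ ¬ R x z)) :=
    fun z x => ind_mono (by tauto)
  have h6 := pairSum_mono (p := p) fun z x _ _ => h5 z x
  have h6' := pairSum_mono (p := p) fun z x _ _ => h5' z x
  have h7 : ∑ u ∈ Finset.range p, ind (¬ R u u ∧ ¬ R u u) ≤ p := by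
    calc _ ≤ ∑ u ∈ Finset.range p, (1 : ℝ) := Finset.sum_le_sum fun _ _ => ind_le_one _
      _ = p := by simp
  have h8 : 0 ≤ ∑ u ∈ Finset.range p, ind (R u u ∧ R u u) :=
    Finset.sum_nonneg fun _ _ => ind_nonneg _
  unfold sparsePairs
  linarith

lemma sparsePairs_nonneg (p : ℕ) (R Z : ℕ → ℕ → Prop) : 0 ≤ sparsePairs p R Z :=
  pairSum_nonneg fun _ _ => ind_nonneg _

lemma card_reversed_le (p : ℕ) (R Z : ℕ → ℕ → Prop) :
    (((Finset.range p ×ˢ Finset.range p).filter fun q => q.2 < q.1 ∧ Z q.2 q.1).card : ℝ)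
      ≤ sparsePairs p R Z := by
  have h1 : (((Finset.range p ×ˢ Finset.range p).filter fun q => q.2 < q.1 ∧ Z q.2 q.1).card : ℝ)
      = ∑ x ∈ Finset.range p, ∑ z ∈ Finset.range p, ind (z < x ∧ Z z x) := by
    rw [← Finset.sum_product' (f := fun x z => ind (z < x ∧ Z z x))]
    rw [Finset.card_filter]
    push_cast
    exact Finset.sum_congr rfl fun q _ => by unfold ind; congr
  rw [h1, sum_square_eq]
  have h2 : ∑ u ∈ Finset.range p, ind (u < u ∧ Z u u) = 0 :=
    Finset.sum_eq_zero fun u _ => ind_false fun h => lt_irrefl _ h.1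
  rw [h2, add_zero]
  refine pairSum_mono fun z x hzx _ => ?_
  rw [ind_false (p := x < z ∧ Z x z) fun h => lt_asymm hzx h.1, zero_add]
  exact ind_mono fun h => Or.inl h.2

/-- Weighted count of the exceptional sets attached to a container and a sparse set. -/
lemma sum_opts_le (p : ℕ) (R Z : ℕ → ℕ → Prop) {γ e t : ℝ} (hγ : 0 ≤ γ) (he : 0 ≤ e) (ht : 0 < t)
    (ht1 : t ≤ 1)
    (hR : dbl (fun u v : Fin p => R u v) ≤ non (fun u v : Fin p => R u v) + γ * (p : ℝ) ^ 2) :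
    ∑ X ∈ (Finset.range p ×ˢ Finset.range p).powerset,
      ∑ Y ∈ ((Finset.range p ×ˢ Finset.range p).filter fun q => q.2 < q.1 ∧ Z q.2 q.1).powerset,
        ind ((X.card : ℝ) ≤ e * (p : ℝ) ^ 2) * ind ((Y.card : ℝ) ≤ 1 / 200 * sparsePairs p R Z) *
          Real.exp (-bZero * nullPairs p (opts R Z (X ∪ Y)) + dZero * fullPairs p (opts R Z (X ∪ Y)))
      ≤ Real.exp (-(3 / 1000) * sparsePairs p R Z + p + γ * (p : ℝ) ^ 2
          + (p : ℝ) ^ 2 * (t + e * (1 - Real.log t))) := by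
  set S := sparsePairs p R Z with hS
  have hS0 : 0 ≤ S := sparsePairs_nonneg p R Z
  set P := Finset.range p ×ˢ Finset.range p with hP
  set Q := P.filter fun q => q.2 < q.1 ∧ Z q.2 q.1 with hQ
  have hb := bZero_nonneg
  have hd := dZero_nonneg
  have hd1 := dZero_le_one
  have hb1 := bZero_le_one
  have hlog : Real.log t ≤ 0 := Real.log_nonpos ht.le ht1
  have key : ∀ X ∈ P.powerset, ∀ Y ∈ Q.powerset,
      ind ((X.card : ℝ) ≤ e * (p : ℝ) ^ 2) * ind ((Y.card : ℝ) ≤ 1 / 200 * S) *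
          Real.exp (-bZero * nullPairs p (opts R Z (X ∪ Y)) + dZero * fullPairs p (opts R Z (X ∪ Y)))
      ≤ Real.exp ((dZero - bZero) * S + (p + γ * (p : ℝ) ^ 2))
        * (ind ((X.card : ℝ) ≤ e * (p : ℝ) ^ 2) * Real.exp (bZero * X.card))
        * (ind ((Y.card : ℝ) ≤ 1 / 200 * S) * Real.exp (bZero * Y.card)) := by
    intro X _ Y _
    have h1 := sparsePairs_le p R Z (X ∪ Y)
    have h2 := fullPairs_le p R Z (X ∪ Y) hR
    have h3 : ((X ∪ Y).card : ℝ) ≤ X.card + Y.card := by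
      exact_mod_cast Finset.card_union_le X Y
    have h4 : Real.exp (-bZero * nullPairs p (opts R Z (X ∪ Y)) + dZero * fullPairs p (opts R Z (X ∪ Y)))
        ≤ Real.exp ((dZero - bZero) * S + (p + γ * (p : ℝ) ^ 2)) * Real.exp (bZero * X.card)
          * Real.exp (bZero * Y.card) := by
      rw [← Real.exp_add, ← Real.exp_add, Real.exp_le_exp]
      have g1 := mul_le_mul_of_nonneg_left h1 hb
      have g2 := mul_le_mul_of_nonneg_left h2 hd
      have g3 := mul_le_mul_of_nonneg_left h3 hb
      have hpp : 0 ≤ (p : ℝ) / 2 + γ / 2 * (p : ℝ) ^ 2 := by positivity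
      have g4 := mul_le_mul_of_nonneg_right hd1 hpp
      nlinarith
    have i1 := ind_nonneg ((X.card : ℝ) ≤ e * (p : ℝ) ^ 2)
    have i2 := ind_nonneg ((Y.card : ℝ) ≤ 1 / 200 * S)
    calc _ ≤ ind ((X.card : ℝ) ≤ e * (p : ℝ) ^ 2) * ind ((Y.card : ℝ) ≤ 1 / 200 * S) *
          (Real.exp ((dZero - bZero) * S + (p + γ * (p : ℝ) ^ 2)) * Real.exp (bZero * X.card)
          * Real.exp (bZero * Y.card)) := mul_le_mul_of_nonneg_left h4 (by positivity)
      _ = _ := by ring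
  refine (Finset.sum_le_sum fun X hX => Finset.sum_le_sum fun Y hY => key X hX Y hY).trans ?_
  simp_rw [← Finset.mul_sum]
  rw [← Finset.sum_mul, ← Finset.mul_sum]
  have hX := sum_small_subsets_le P (t := t) (θ := e) (b := bZero) (N := (p : ℝ) ^ 2) ht ht1 hb
    (by rw [hP, Finset.card_product, Finset.card_range]; push_cast; exact le_of_eq (by ring))
  have hY := sum_small_subsets_le Q (t := 1 / 50) (θ := 1 / 200) (b := bZero) (N := S) (by norm_num)
    (by norm_num) hb (card_reversed_le p R Z)
  have hX0 : 0 ≤ ∑ X ∈ P.powerset, ind ((X.card : ℝ) ≤ e * (p : ℝ) ^ 2) * Real.exp (bZero * X.card) :=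
    Finset.sum_nonneg fun X _ => mul_nonneg (ind_nonneg _) (Real.exp_pos _).le
  have hY0 : 0 ≤ ∑ Y ∈ Q.powerset, ind ((Y.card : ℝ) ≤ 1 / 200 * S) * Real.exp (bZero * Y.card) :=
    Finset.sum_nonneg fun X _ => mul_nonneg (ind_nonneg _) (Real.exp_pos _).le
  calc _ ≤ Real.exp ((dZero - bZero) * S + (p + γ * (p : ℝ) ^ 2))
        * Real.exp ((p : ℝ) ^ 2 * (t + e * (bZero - Real.log t)))
        * Real.exp (S * (1 / 50 + 1 / 200 * (bZero - Real.log (1 / 50)))) :=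
        mul_le_mul (mul_le_mul_of_nonneg_left hX (Real.exp_pos _).le) hY hY0 (by positivity)
    _ ≤ _ := by
        rw [← Real.exp_add, ← Real.exp_add, Real.exp_le_exp]
        have g1 : S * (1 / 50 + 1 / 200 * (bZero - Real.log (1 / 50))) ≤ S * (45 / 1000) :=
          mul_le_mul_of_nonneg_left (by linarith [log_fifty_le]) hS0
        have g2 := mul_le_mul_of_nonneg_right bZero_sub_dZero hS0
        have g3 : (p : ℝ) ^ 2 * (t + e * (bZero - Real.log t)) ≤ (p : ℝ) ^ 2 * (t + e * (1 - Real.log t)) := by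
          gcongr
        nlinarith

/-- Codes for a block container together with a union of rectangles. -/
abbrev BlockCode (p M : ℕ) :=
  (Fin p → Fin M) × Finset (Fin M × Fin M) × (Fin p → Fin (2 * p + 1))

/-- The container relation of a code. -/
def BlockCode.rel {p M : ℕ} (j : BlockCode p M) (u v : ℕ) : Prop :=
  ∃ (hu : u < p) (hv : v < p), (j.1 ⟨u, hu⟩, j.1 ⟨v, hv⟩) ∈ j.2.1

/-- The sparse relation of a code. -/
def BlockCode.sparse {p M : ℕ} (j : BlockCode p M) (u v : ℕ) : Prop :=
  ∃ (hu : u < p) (hv : v < p), Even (j.2.2 ⟨u, hu⟩ : ℕ) ∧ (j.2.2 ⟨v, hv⟩ : ℕ) = j.2.2 ⟨u, hu⟩ + 1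

/-- The pairs `(x, z)` with `z < x` such that `(z, x)` is sparse. -/
noncomputable def revSparse (p : ℕ) (Z : ℕ → ℕ → Prop) : Finset (ℕ × ℕ) :=
  (Finset.range p ×ˢ Finset.range p).filter fun q => q.2 < q.1 ∧ Z q.2 q.1

lemma card_filter_square (p : ℕ) (f : ℕ → ℕ → Prop) [DecidablePred fun q : ℕ × ℕ => f q.1 q.2] :
    (((Finset.range p ×ˢ Finset.range p).filter fun q => f q.1 q.2).card : ℝ)
      = ∑ u ∈ Finset.range p, ∑ v ∈ Finset.range p, ind (f u v) := by
  rw [← Finset.sum_product' (f := fun x z => ind (f x z)), Finset.card_filter]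
  push_cast
  exact Finset.sum_congr rfl fun q _ => by unfold ind; congr

lemma hasCyc_of_comp {V : Type*} {T : ℕ → ℕ → Prop} {φ : V → ℕ} (hφ : Function.Injective φ) {k : ℕ}
    (h : HasCyc (fun u v : V => T (φ u) (φ v)) k) : HasCyc T k := by
  obtain ⟨c, h1, h2, h3⟩ := h
  exact ⟨fun i => φ (c i), fun i hi j hj hij => h1 i hi j hj (hφ hij), h2, h3⟩

/-- Block containers with the additional density property. -/
lemma exists_block_container (k : ℕ) (hk : 3 ≤ k) {γ e : ℝ} (hγ : 0 < γ) (he : 0 < e) :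
    ∃ M m : ℕ, ∀ p ≥ m, ∀ T : ℕ → ℕ → Prop, ¬ HasCyc T k → ∃ (π : Fin p → Fin M)
      (F : Finset (Fin M × Fin M)), ∀ R : ℕ → ℕ → Prop,
        (∀ u v : Fin p, R u v ↔ (π u, π v) ∈ F) →
        ∑ u ∈ Finset.range p, ∑ v ∈ Finset.range p, ind (T u v ∧ ¬ R u v) ≤ e * (p : ℝ) ^ 2 ∧
        (adj (fun u v : Fin p => R u v) ^ k).trace ≤ e * (p : ℝ) ^ k ∧
        dbl (fun u v : Fin p => R u v) ≤ non (fun u v : Fin p => R u v) + γ * (p : ℝ) ^ 2 := by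
  obtain ⟨c1, hc1, hD⟩ := exists_dbl_le_non k hk hγ
  obtain ⟨M, c2, hc2, hC⟩ := exists_container k hk (lt_min he hc1)
  obtain ⟨m, hm⟩ := exists_nat_ge ((k : ℝ) ^ 2 / c2)
  refine ⟨M, m, fun p hp T hT => ?_⟩
  have h1 : ¬ HasCyc (fun u v : Fin p => T u v) k := fun h => hT (hasCyc_of_comp Fin.val_injective h)
  have h2 := trace_le_of_no_cyc _ k (by omega) h1
  rw [Fintype.card_fin] at h2
  have h3 : (k : ℝ) ^ 2 * (p : ℝ) ^ (k - 1) ≤ c2 * (p : ℝ) ^ k := by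
    have e1 : (p : ℝ) ^ k = p * (p : ℝ) ^ (k - 1) := by
      rw [← pow_succ']; congr 1; omega
    rw [e1, ← mul_assoc]
    refine mul_le_mul_of_nonneg_right ?_ (by positivity)
    rw [div_le_iff₀ hc2] at hm
    have : (m : ℝ) ≤ p := by exact_mod_cast hp
    nlinarith
  obtain ⟨π, hπ, P, hP1, hP2⟩ := hC (fun u v : Fin p => T u v) (by
    rw [Fintype.card_fin]; exact h2.trans h3)
  rw [Fintype.card_fin] at hP1 hP2
  refine ⟨fun v => ⟨π v, hπ v⟩, Finset.univ.filter fun q => P q.1 q.2, fun R hR => ?_⟩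
  have hR' : (fun u v : Fin p => R u v) = fun u v : Fin p => P (π u) (π v) := by
    funext u v
    rw [hR u v]; simp
  have hmin1 : min e c1 * (p : ℝ) ^ k ≤ e * (p : ℝ) ^ k := by gcongr; exact min_le_left _ _
  have hmin2 : min e c1 * (p : ℝ) ^ k ≤ c1 * (p : ℝ) ^ k := by gcongr; exact min_le_right _ _
  refine ⟨?_, ?_, ?_⟩
  · rw [← sum_fin_square p (fun u v => ind (T u v ∧ ¬ R u v))]
    have : ∀ u v : Fin p, R u v ↔ P (π u) (π v) := fun u v => by rw [hR u v]; simp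
    simp_rw [this]
    refine hP1.trans ?_
    gcongr; exact min_le_left _ _
  · rw [hR']; exact hP2.trans hmin1
  · have := hD (fun u v : Fin p => P (π u) (π v)) (by
      rw [Fintype.card_fin]; exact hP2.trans hmin2)
    rw [Fintype.card_fin] at this
    rw [hR']; exact this

set_option maxHeartbeats 2000000 in
/-- An ordered optimal cycle-free relation with many failing windows is captured by a code. -/
lemma exists_code (k : ℕ) (hk : 3 ≤ k) {ε : ℝ} (hε : 0 < ε) : ∃ χ > 0, ∀ σ : ℝ, 0 < σ → σ ≤ 1 →
    ∀ γ e : ℝ, 0 < γ → 0 < e → ∃ M m : ℕ, ∀ p ≥ m, ∀ T : ℕ → ℕ → Prop,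
      (∀ u v, T u v → ¬ T v u) → ¬ HasCyc T k → OptOn T p → ∀ W : Finset (ℕ × ℕ), WinFam p W →
      (∀ I ∈ W, ¬ NiceWin T ε I.1 I.2) → σ * (p : ℝ) ^ 2 ≤ ∑ I ∈ W, ((I.2 - I.1 : ℕ) : ℝ) ^ 2 →
      ∃ j : BlockCode p M, ∃ X ∈ (Finset.range p ×ˢ Finset.range p).powerset,
        ∃ Y ∈ (revSparse p j.sparse).powerset, (X.card : ℝ) ≤ e * (p : ℝ) ^ 2 ∧
          (Y.card : ℝ) ≤ 1 / 200 * sparsePairs p j.rel j.sparse ∧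
          χ * σ * (p : ℝ) ^ 2 ≤ sparsePairs p j.rel j.sparse ∧
          dbl (fun u v : Fin p => j.rel u v) ≤ non (fun u v : Fin p => j.rel u v) + γ * (p : ℝ) ^ 2 ∧
          ∀ z x, z < x → x < p → status T z x ∈ opts j.rel j.sparse (X ∪ Y) z x := by
  have hg : 0 < ε ^ 2 / 400 := by positivity
  set g := ε ^ 2 / 400 with hgdef
  obtain ⟨c, hc, hB⟩ := exists_window_backward_le k hk hg
  refine ⟨min c (ε ^ 2) / 16, by positivity, fun σ hσ hσ1 γ e hγ he => ?_⟩
  set e0 := min e (min (g * σ ^ 2 / 4) (c * (σ / 2) ^ k)) with he0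
  have he0' : 0 < e0 := by positivity
  have e1 : e0 ≤ e := min_le_left _ _
  have e2 : e0 ≤ g * σ ^ 2 / 4 := (min_le_right _ _).trans (min_le_left _ _)
  have e3 : e0 ≤ c * (σ / 2) ^ k := (min_le_right _ _).trans (min_le_right _ _)
  obtain ⟨M, m, hC⟩ := exists_block_container k hk hγ he0'
  obtain ⟨m', hm'⟩ := exists_nat_ge (8 / (c * σ))
  refine ⟨M, max m m', fun p hp T hor hT hopt W hW hWf hWs => ?_⟩
  obtain ⟨π, F, hR⟩ := hC p (le_of_max_le_left hp) T hT
  have hpm : 8 / (c * σ) ≤ p := hm'.trans (by exact_mod_cast le_of_max_le_right hp)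
  -- long windows, split by the density of the container
  set W1 := W.filter fun I => σ / 2 * p ≤ ((I.2 - I.1 : ℕ) : ℝ) with hW1
  have hlong := hW.long_windows hσ.le hWs
  have hW1' : WinFam p W1 := hW.subset (Finset.filter_subset _ _)
  set Rl : ℕ → ℕ → Prop := fun u v => ∃ (hu : u < p) (hv : v < p), (π ⟨u, hu⟩, π ⟨v, hv⟩) ∈ F with hRl
  have hRiff : ∀ u v : Fin p, Rl u v ↔ (π u, π v) ∈ F := by
    intro u v; simp only [hRl, u.2, v.2, exists_true_left]
  obtain ⟨r1, r2, r3⟩ := hR Rl hRiff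
  set nonI : ℕ × ℕ → ℝ := fun I => ∑ u ∈ Finset.Ico I.1 I.2, ∑ v ∈ Finset.Ico I.1 I.2,
    ind (¬ Rl u v ∧ ¬ Rl v u) with hnonI
  set Wb := W1.filter fun I => nonI I ≤ c * ((I.2 - I.1 : ℕ) : ℝ) ^ 2 with hWb
  set Wa := W1.filter fun I => ¬ nonI I ≤ c * ((I.2 - I.1 : ℕ) : ℝ) ^ 2 with hWa
  have hWb' : WinFam p Wb := hW1'.subset (Finset.filter_subset _ _)
  have hWa' : WinFam p Wa := hW1'.subset (Finset.filter_subset _ _)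
  have hsplit : ∑ I ∈ Wb, ((I.2 - I.1 : ℕ) : ℝ) ^ 2 + ∑ I ∈ Wa, ((I.2 - I.1 : ℕ) : ℝ) ^ 2
      = ∑ I ∈ W1, ((I.2 - I.1 : ℕ) : ℝ) ^ 2 := Finset.sum_filter_add_sum_filter_not _ _ _
  -- rectangles
  have hrect : ∀ I : ℕ × ℕ, ∃ X Y : Finset ℕ, I ∈ W → X ⊆ Finset.Ico I.1 I.2 ∧
      Y ⊆ Finset.Ico I.1 I.2 ∧ (∀ x ∈ X, ∀ y ∈ Y, x < y) ∧ ε * (I.2 - I.1 : ℕ) ≤ X.card ∧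
      ε * (I.2 - I.1 : ℕ) ≤ Y.card ∧ ∀ x ∈ X, ∀ y ∈ Y, ¬ T x y := by
    intro I
    by_cases hI : I ∈ W
    · have := hWf I hI
      unfold NiceWin at this
      push Not at this
      obtain ⟨X, Y, h1, h2, h3, h4, h5, h6⟩ := this
      exact ⟨X, Y, fun _ => ⟨h1, h2, h3, h4, h5, h6⟩⟩
    · exact ⟨∅, ∅, fun h => absurd h hI⟩
  choose X Y hXY using hrect
  have hbW : ∀ I ∈ Wb, I ∈ W := fun I hI => (Finset.mem_filter.1 (Finset.mem_filter.1 hI).1).1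
  obtain ⟨γ', hγ1, hγ2⟩ := exists_rectCode hWb' X Y (fun I hI => (hXY I (hbW I hI)).1)
    (fun I hI => (hXY I (hbW I hI)).2.1) (fun I hI => (hXY I (hbW I hI)).2.2.1)
  set j : BlockCode p M := ⟨π, F, fun u => ⟨γ' u, hγ1 u⟩⟩ with hj
  have hjR : j.rel = Rl := rfl
  have hjZ : ∀ z x, z < p → x < p → (j.sparse z x ↔ ∃ I ∈ Wb, z ∈ X I ∧ x ∈ Y I) := by
    intro z x hz hx
    rw [← hγ2]
    constructor
    · rintro ⟨_, _, h⟩; exact h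
    · intro h; exact ⟨hz, hx, h⟩
  have hmemlt : ∀ I ∈ Wb, ∀ u ∈ Finset.Ico I.1 I.2, u < p := by
    intro I hI u hu
    have := (hWb'.1 I hI).2
    have := (Finset.mem_Ico.1 hu).2
    omega
  set E1 := (Finset.range p ×ˢ Finset.range p).filter fun q => T q.1 q.2 ∧ ¬ Rl q.1 q.2 with hE1
  set E2 := (Finset.range p ×ˢ Finset.range p).filter fun q =>
    (q.2 < q.1 ∧ j.sparse q.2 q.1) ∧ T q.1 q.2 with hE2
  set S := sparsePairs p j.rel j.sparse with hS
  -- lower bounds for the number of sparse pairs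
  have hS1 : ε ^ 2 * ∑ I ∈ Wb, ((I.2 - I.1 : ℕ) : ℝ) ^ 2 ≤ S := by
    have a1 : ∀ I ∈ Wb, ε ^ 2 * ((I.2 - I.1 : ℕ) : ℝ) ^ 2
        ≤ ∑ u ∈ Finset.Ico I.1 I.2, ∑ v ∈ Finset.Ico I.1 I.2, ind (u < v ∧ j.sparse u v) := by
      intro I hI
      obtain ⟨x1, x2, x3, x4, x5, x6⟩ := hXY I (hbW I hI)
      calc ε ^ 2 * ((I.2 - I.1 : ℕ) : ℝ) ^ 2
          = (ε * (I.2 - I.1 : ℕ)) * (ε * (I.2 - I.1 : ℕ)) := by ring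
        _ ≤ (X I).card * (Y I).card := mul_le_mul x4 x5 (by positivity) (by positivity)
        _ = ∑ u ∈ X I, ∑ v ∈ Y I, (1 : ℝ) := by simp
        _ = ∑ u ∈ X I, ∑ v ∈ Y I, ind (u < v ∧ j.sparse u v) := by
            refine Finset.sum_congr rfl fun u hu => Finset.sum_congr rfl fun v hv => ?_
            rw [ind_true]
            exact ⟨x3 u hu v hv, (hjZ u v (hmemlt I hI u (x1 hu)) (hmemlt I hI v (x2 hv))).2
              ⟨I, hI, hu, hv⟩⟩
        _ ≤ ∑ u ∈ X I, ∑ v ∈ Finset.Ico I.1 I.2, ind (u < v ∧ j.sparse u v) :=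
            Finset.sum_le_sum fun u _ =>
              Finset.sum_le_sum_of_subset_of_nonneg x2 fun _ _ _ => ind_nonneg _
        _ ≤ _ := Finset.sum_le_sum_of_subset_of_nonneg x1 fun _ _ _ =>
              Finset.sum_nonneg fun _ _ => ind_nonneg _
    rw [Finset.mul_sum]
    refine (Finset.sum_le_sum a1).trans ((hWb'.sum_le fun _ _ => ind_nonneg _).trans ?_)
    rw [sum_square_eq]
    have a2 : ∑ u ∈ Finset.range p, ind (u < u ∧ j.sparse u u) = 0 :=
      Finset.sum_eq_zero fun u _ => ind_false fun h => lt_irrefl _ h.1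
    rw [a2, add_zero]
    refine pairSum_mono fun z x hzx _ => ?_
    rw [ind_false (p := x < z ∧ j.sparse x z) fun h => lt_asymm hzx h.1, add_zero]
    exact ind_mono fun h => Or.inl h.2
  have hS2 : ∑ I ∈ Wa, nonI I ≤ 2 * S + p := by
    refine (hWa'.sum_le fun _ _ => ind_nonneg _).trans ?_
    rw [sum_square_eq]
    have a2 : ∑ u ∈ Finset.range p, ind (¬ Rl u u ∧ ¬ Rl u u) ≤ p := by
      calc _ ≤ ∑ u ∈ Finset.range p, (1 : ℝ) := Finset.sum_le_sum fun _ _ => ind_le_one _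
        _ = p := by simp
    rw [pairSum_add]
    have a3 : (pairSum p fun z x => ind (¬ Rl z x ∧ ¬ Rl x z)) ≤ S :=
      pairSum_mono fun z x _ _ => ind_mono fun h => Or.inr h
    have a4 : (pairSum p fun z x => ind (¬ Rl x z ∧ ¬ Rl z x)) ≤ S :=
      pairSum_mono fun z x _ _ => ind_mono fun h => Or.inr h.symm
    linarith
  have hback : (E2.card : ℝ) ≤ ∑ I ∈ Wb, 2 * g * ((I.2 - I.1 : ℕ) : ℝ) ^ 2 := by
    have b1 : E2 ⊆ Wb.biUnion fun I => (Finset.Ico I.1 I.2 ×ˢ Finset.Ico I.1 I.2).filter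
        fun q => T q.1 q.2 ∧ q.2 < q.1 := by
      intro q hq
      simp only [hE2, Finset.mem_filter, Finset.mem_product, Finset.mem_range] at hq
      obtain ⟨I, hI, h1, h2⟩ := (hjZ q.2 q.1 hq.1.2 hq.1.1).1 hq.2.1.2
      obtain ⟨x1, x2, -⟩ := hXY I (hbW I hI)
      rw [Finset.mem_biUnion]
      exact ⟨I, hI, Finset.mem_filter.2 ⟨Finset.mem_product.2 ⟨x2 h2, x1 h1⟩, hq.2.2, hq.2.1.1⟩⟩
    have b2 : (E2.card : ℝ) ≤ ∑ I ∈ Wb, (((Finset.Ico I.1 I.2 ×ˢ Finset.Ico I.1 I.2).filter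
        fun q => T q.1 q.2 ∧ q.2 < q.1).card : ℝ) := by
      exact_mod_cast (Finset.card_le_card b1).trans Finset.card_biUnion_le
    refine b2.trans (Finset.sum_le_sum fun I hI => ?_)
    obtain ⟨hI1, hI2⟩ := Finset.mem_filter.1 hI
    have hlen := (Finset.mem_filter.1 hI1).2
    have hI3 := hWb'.1 I hI
    have b3 : (((Finset.Ico I.1 I.2 ×ˢ Finset.Ico I.1 I.2).filter
        fun q => T q.1 q.2 ∧ q.2 < q.1).card : ℝ)
        = ∑ u ∈ Finset.Ico I.1 I.2, ∑ v ∈ Finset.Ico I.1 I.2, ind (T u v ∧ v < u) := by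
      rw [← Finset.sum_product' (f := fun x z => ind (T x z ∧ z < x)), Finset.card_filter]
      push_cast
      exact Finset.sum_congr rfl fun q _ => by unfold ind; congr
    rw [b3]
    have b4 := hB p I.1 I.2 hI3.1.le hI3.2 T Rl (e0 * (p : ℝ) ^ 2) hopt (r2.trans (by
      calc e0 * (p : ℝ) ^ k ≤ c * (σ / 2) ^ k * (p : ℝ) ^ k := by gcongr
        _ = c * (σ / 2 * p) ^ k := by rw [mul_pow]; ring
        _ ≤ _ := by gcongr)) hI2 r1
    have b5 : e0 * (p : ℝ) ^ 2 ≤ g * ((I.2 - I.1 : ℕ) : ℝ) ^ 2 := by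
      calc e0 * (p : ℝ) ^ 2 ≤ g * σ ^ 2 / 4 * (p : ℝ) ^ 2 := by gcongr
        _ = g * (σ / 2 * p) ^ 2 := by ring
        _ ≤ _ := by gcongr
    linarith
  refine ⟨j, E1, Finset.mem_powerset.2 (Finset.filter_subset _ _), E2, ?_, ?_, ?_, ?_, r3, ?_⟩
  · rw [Finset.mem_powerset]
    intro q hq
    simp only [hE2, revSparse, Finset.mem_filter] at hq ⊢
    exact ⟨hq.1, hq.2.1⟩
  · rw [hE1, card_filter_square p (fun u v => T u v ∧ ¬ Rl u v)]
    exact r1.trans (by gcongr)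
  · rw [← Finset.mul_sum] at hback
    rw [hgdef] at hback
    linarith
  · have hp0 : (0 : ℝ) ≤ p := Nat.cast_nonneg p
    have hm1 : min c (ε ^ 2) ≤ c := min_le_left _ _
    have hm2 : min c (ε ^ 2) ≤ ε ^ 2 := min_le_right _ _
    have hσp : 0 ≤ σ * (p : ℝ) ^ 2 := by positivity
    have k1 := mul_le_mul_of_nonneg_right hm1 hσp
    have k2 := mul_le_mul_of_nonneg_right hm2 hσp
    rw [div_le_iff₀ (by positivity)] at hpm
    have hSn : 0 ≤ S := sparsePairs_nonneg _ _ _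
    by_cases hcase : σ / 4 * (p : ℝ) ^ 2 ≤ ∑ I ∈ Wa, ((I.2 - I.1 : ℕ) : ℝ) ^ 2
    · have h1 : c * ∑ I ∈ Wa, ((I.2 - I.1 : ℕ) : ℝ) ^ 2 ≤ ∑ I ∈ Wa, nonI I := by
        rw [Finset.mul_sum]
        exact Finset.sum_le_sum fun I hI => (not_le.1 (Finset.mem_filter.1 hI).2).le
      have h2 := mul_le_mul_of_nonneg_left hcase hc.le
      have h3 := mul_le_mul_of_nonneg_right hpm hp0
      nlinarith
    · have h1 : σ / 4 * (p : ℝ) ^ 2 ≤ ∑ I ∈ Wb, ((I.2 - I.1 : ℕ) : ℝ) ^ 2 := by linarith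
      have h2 := mul_le_mul_of_nonneg_left h1 (sq_nonneg ε)
      have h4 : 0 ≤ ε ^ 2 * (σ * (p : ℝ) ^ 2) := by positivity
      nlinarith
  · intro z x hzx hx
    have hz : z < p := hzx.trans hx
    have mem1 : ∀ u v, (u, v) ∈ E1 → T u v := fun u v h => (Finset.mem_filter.1 h).2.1
    have mem2 : ∀ u v, (u, v) ∈ E2 → T u v := fun u v h => (Finset.mem_filter.1 h).2.2
    have mem : ∀ u v, (u, v) ∈ E1 ∪ E2 → T u v := fun u v h =>
      (Finset.mem_union.1 h).elim (mem1 u v) (mem2 u v)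
    have nmem1 : ∀ u v, u < p → v < p → (u, v) ∉ E1 ∪ E2 → T u v → Rl u v := by
      intro u v hu hv h hT
      by_contra hR
      exact h (Finset.mem_union_left _ (Finset.mem_filter.2
        ⟨Finset.mem_product.2 ⟨Finset.mem_range.2 hu, Finset.mem_range.2 hv⟩, hT, hR⟩))
    unfold opts status
    by_cases hA : (z, x) ∈ E1 ∪ E2
    · rw [if_pos hA, if_pos (mem z x hA)]; simp
    rw [if_neg hA]
    by_cases hA' : (x, z) ∈ E1 ∪ E2
    · rw [if_pos hA', if_neg (hor x z (mem x z hA')), if_pos (mem x z hA')]; simp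
    rw [if_neg hA']
    by_cases hZ : j.sparse z x
    · obtain ⟨I, hI, h1, h2⟩ := (hjZ z x hz hx).1 hZ
      have n1 : ¬ T z x := (hXY I (hbW I hI)).2.2.2.2.2 z h1 x h2
      have n2 : ¬ T x z := fun h => hA' (Finset.mem_union_right _ (Finset.mem_filter.2
        ⟨Finset.mem_product.2 ⟨Finset.mem_range.2 hx, Finset.mem_range.2 hz⟩, ⟨hzx, hZ⟩, h⟩))
      rw [if_pos hZ, if_neg n1, if_neg n2]; simp
    · rw [if_neg hZ, Finset.mem_filter]
      refine ⟨Finset.mem_univ _, ?_, ?_⟩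
      · intro h
        split_ifs at h with t1 t2
        · exact nmem1 z x hz hx hA t1
        · exact absurd h (by decide)
        · exact absurd h (by decide)
      · intro h
        split_ifs at h with t1 t2
        · exact absurd h (by decide)
        · exact nmem1 x z hx hz hA' t2
        · exact absurd h (by decide)

lemma exists_card_blockCode_le (M : ℕ) {s : ℝ} (hs : 0 < s) :
    ∃ m : ℕ, ∀ p ≥ m, (Fintype.card (BlockCode p M) : ℝ) ≤ Real.exp (s * (p : ℝ) ^ 2) := by
  obtain ⟨m, hm⟩ := exists_nat_ge (4 * (M : ℝ) / s + 4 * (M : ℝ) ^ 2 / s + 96 / s ^ 2 + 1)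
  refine ⟨m, fun p hp => ?_⟩
  have hpm : 4 * (M : ℝ) / s + 4 * (M : ℝ) ^ 2 / s + 96 / s ^ 2 + 1 ≤ p :=
    hm.trans (by exact_mod_cast hp)
  have q1 : 0 ≤ 4 * (M : ℝ) / s := by positivity
  have q2 : 0 ≤ 4 * (M : ℝ) ^ 2 / s := by positivity
  have q3 : 0 ≤ 96 / s ^ 2 := by positivity
  have p1 : (1 : ℝ) ≤ p := by linarith
  have r1 : 4 * (M : ℝ) / s ≤ p := by linarith
  have r2 : 4 * (M : ℝ) ^ 2 / s ≤ p := by linarith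
  have r3 : 96 / s ^ 2 ≤ p := by linarith
  rw [div_le_iff₀ (by positivity)] at r1 r2 r3
  have hcard : (Fintype.card (BlockCode p M) : ℝ)
      = (M : ℝ) ^ p * (2 ^ (M * M) * (2 * p + 1) ^ p) := by
    simp only [BlockCode, Fintype.card_prod, Fintype.card_fun, Fintype.card_fin,
      Fintype.card_finset]
    push_cast
    ring
  have hM : (M : ℝ) ≤ Real.exp (s * p / 4) := by
    have := Real.add_one_le_exp (s * p / 4)
    linarith
  have h2 : (2 : ℝ) ^ (M * M) ≤ Real.exp (s * p ^ 2 / 4) := by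
    calc (2 : ℝ) ^ (M * M) ≤ Real.exp 1 ^ (M * M) := by
          gcongr
          have := Real.add_one_le_exp 1
          linarith
      _ = Real.exp ((M : ℝ) ^ 2) := by rw [← Real.exp_nat_mul]; push_cast; ring_nf
      _ ≤ _ := by
          rw [Real.exp_le_exp]
          nlinarith
  have h3 : 2 * (p : ℝ) + 1 ≤ Real.exp (s * p / 4) := by
    have := Real.quadratic_le_exp_of_nonneg (x := s * p / 4) (by positivity)
    nlinarith [mul_pos hs hs, mul_pos hs (by linarith : (0 : ℝ) < p)]
  rw [hcard]
  calc (M : ℝ) ^ p * (2 ^ (M * M) * (2 * p + 1) ^ p)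
      ≤ Real.exp (s * p / 4) ^ p * (Real.exp (s * p ^ 2 / 4) * Real.exp (s * p / 4) ^ p) := by gcongr
    _ = Real.exp (s * p ^ 2 * (3 / 4)) := by
        rw [← Real.exp_nat_mul, ← Real.exp_add, ← Real.exp_add]; ring_nf
    _ ≤ _ := by
        rw [Real.exp_le_exp]
        have : 0 ≤ s * (p : ℝ) ^ 2 := by positivity
        linarith

/-- Relations with many failing windows are covered by few option systems of small total weight. -/
theorem exists_opts_cover (k : ℕ) (hk : 3 ≤ k) {ε : ℝ} (hε : 0 < ε) :
    ∃ χ > 0, ∀ σ : ℝ, 0 < σ → σ ≤ 1 → ∃ m : ℕ, ∀ p ≥ m,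
      ∃ (ι : Type) (F : Finset ι) (Ω : ι → ℕ → ℕ → Finset (Fin 3)),
        ∑ i ∈ F, Real.exp (-bZero * nullPairs p (Ω i) + dZero * fullPairs p (Ω i))
          ≤ Real.exp (-χ * σ * (p : ℝ) ^ 2) ∧
        ∀ T : ℕ → ℕ → Prop, (∀ u v, T u v → ¬ T v u) → ¬ HasCyc T k → OptOn T p →
          ∀ W : Finset (ℕ × ℕ), WinFam p W → (∀ I ∈ W, ¬ NiceWin T ε I.1 I.2) →
          σ * (p : ℝ) ^ 2 ≤ ∑ I ∈ W, ((I.2 - I.1 : ℕ) : ℝ) ^ 2 →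
          ∃ i ∈ F, ∀ z x, z < x → x < p → status T z x ∈ Ω i z x := by
  obtain ⟨χ, hχ, h⟩ := exists_code k hk hε
  refine ⟨3 / 8000 * χ, by positivity, fun σ hσ hσ1 => ?_⟩
  set s := 3 / 8000 * χ * σ with hs
  have hs0 : 0 < s := by positivity
  set t := min s 1 with ht
  have ht0 : 0 < t := lt_min hs0 one_pos
  have ht1 : t ≤ 1 := min_le_right _ _
  have hts : t ≤ s := min_le_left _ _
  have hlog : Real.log t ≤ 0 := Real.log_nonpos ht0.le ht1
  have he0 : 0 < s / (1 - Real.log t) := div_pos hs0 (by linarith)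
  set e := s / (1 - Real.log t) with he
  have hee : e * (1 - Real.log t) = s := div_mul_cancel₀ _ (by linarith)
  obtain ⟨M, m, hm⟩ := h σ hσ hσ1 s e hs0 he0
  obtain ⟨m', hm'⟩ := exists_card_blockCode_le M hs0
  obtain ⟨m'', hm''⟩ := exists_nat_ge (1 / s)
  refine ⟨max m (max m' m''), fun p hp => ?_⟩
  have hp1 : m ≤ p := (le_max_left _ _).trans hp
  have hp2 : m' ≤ p := (le_max_left _ _).trans ((le_max_right _ _).trans hp)
  have hp3 : 1 / s ≤ p :=
    hm''.trans (by exact_mod_cast (le_max_right _ _).trans ((le_max_right _ _).trans hp))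
  set G : Finset (BlockCode p M) := Finset.univ.filter fun j =>
    χ * σ * (p : ℝ) ^ 2 ≤ sparsePairs p j.rel j.sparse ∧
    dbl (fun u v : Fin p => j.rel u v) ≤ non (fun u v : Fin p => j.rel u v) + s * (p : ℝ) ^ 2 with hG
  set F : Finset (Σ _ : BlockCode p M, Finset (ℕ × ℕ) × Finset (ℕ × ℕ)) :=
    G.sigma fun j => ((Finset.range p ×ˢ Finset.range p).powerset ×ˢ
      (revSparse p j.sparse).powerset).filter fun q => (q.1.card : ℝ) ≤ e * (p : ℝ) ^ 2 ∧
        (q.2.card : ℝ) ≤ 1 / 200 * sparsePairs p j.rel j.sparse with hF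
  refine ⟨_, F, fun i => opts i.1.rel i.1.sparse (i.2.1 ∪ i.2.2), ?_, ?_⟩
  · rw [hF, Finset.sum_sigma]
    have h1 : ∀ j ∈ G, ∑ q ∈ ((Finset.range p ×ˢ Finset.range p).powerset ×ˢ
        (revSparse p j.sparse).powerset).filter fun q => (q.1.card : ℝ) ≤ e * (p : ℝ) ^ 2 ∧
          (q.2.card : ℝ) ≤ 1 / 200 * sparsePairs p j.rel j.sparse,
        Real.exp (-bZero * nullPairs p (opts j.rel j.sparse (q.1 ∪ q.2))
          + dZero * fullPairs p (opts j.rel j.sparse (q.1 ∪ q.2))) ≤ Real.exp (-2 * s * (p : ℝ) ^ 2) := by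
      intro j hj
      obtain ⟨-, hj1, hj2⟩ := Finset.mem_filter.1 hj
      have h2 := sum_opts_le p j.rel j.sparse hs0.le he0.le ht0 ht1 hj2
      rw [Finset.sum_filter, Finset.sum_product]
      have h3 : -(3 / 1000) * sparsePairs p j.rel j.sparse + p + s * (p : ℝ) ^ 2
          + (p : ℝ) ^ 2 * (t + e * (1 - Real.log t)) ≤ -2 * s * (p : ℝ) ^ 2 := by
        rw [hee]
        rw [div_le_iff₀ hs0] at hp3
        have hpp : (p : ℝ) ≤ s * (p : ℝ) ^ 2 := by nlinarith [(Nat.cast_nonneg p : (0 : ℝ) ≤ p)]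
        have h4 : (p : ℝ) ^ 2 * t ≤ (p : ℝ) ^ 2 * s := by gcongr
        have h5 : 8 * (s * (p : ℝ) ^ 2) = 3 / 1000 * (χ * σ * (p : ℝ) ^ 2) := by rw [hs]; ring
        nlinarith
      refine le_trans (le_of_eq ?_) (h2.trans (Real.exp_le_exp.2 h3))
      refine Finset.sum_congr rfl fun X _ => Finset.sum_congr rfl fun Y _ => ?_
      rw [← ind_and]
      unfold ind
      split_ifs <;> simp
    refine (Finset.sum_le_sum h1).trans ?_
    rw [Finset.sum_const, nsmul_eq_mul]
    have h2 : (G.card : ℝ) ≤ Real.exp (s * (p : ℝ) ^ 2) :=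
      le_trans (by exact_mod_cast Finset.card_le_univ G) (hm' p hp2)
    calc (G.card : ℝ) * Real.exp (-2 * s * (p : ℝ) ^ 2)
        ≤ Real.exp (s * (p : ℝ) ^ 2) * Real.exp (-2 * s * (p : ℝ) ^ 2) := by gcongr
      _ = Real.exp (-(3 / 8000 * χ) * σ * (p : ℝ) ^ 2) := by
          rw [← Real.exp_add, hs]; ring_nf
  · intro T hor hT hopt W hW hWf hWs
    obtain ⟨j, X, hX, Y, hY, h1, h2, h3, h4, h5⟩ := hm p hp1 T hor hT hopt W hW hWf hWs
    refine ⟨⟨j, X, Y⟩, ?_, h5⟩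
    rw [hF, Finset.mem_sigma]
    exact ⟨Finset.mem_filter.2 ⟨Finset.mem_univ _, h3, h4⟩,
      Finset.mem_filter.2 ⟨Finset.mem_product.2 ⟨hX, hY⟩, h1, h2⟩⟩

/-- Weighted count of the patterns of a new vertex. -/
lemma sum_patterns_le {x : ℕ} (a : Fin x → Fin 3 → ℝ) (ha : ∀ y j, 0 ≤ a y j)
    (O : Finset (Fin x → Fin 3)) (opt : Fin x → Finset (Fin 3)) (far : Fin x → Prop)
    (Φ : Fin x → Finset (Fin x)) (G : Fin x → ℝ) (hG : ∀ y, 0 ≤ G y)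
    {s β h δ τ : ℝ} (hs : 0 < s) (hs1 : s ≤ 1) (hβ : 0 < β) (hβ1 : β ≤ 1)
    (hrate : h * (-Real.log s) + s + δ * Real.log β ≤ -τ)
    (hopt : ∀ o ∈ O, ∀ y, o y ∈ opt y)
    (hnear : ∀ y, ¬ far y → ∑ j ∈ opt y, a y j ≤ 2 * G y)
    (hfar : ∀ y, far y → ∑ j ∈ Finset.univ.filter (· ≠ (2 : Fin 3)), a y j ≤ 2 * G y)
    (hpen : ∀ y, ∑ j ∈ opt y, a y j * (if j = 2 then s else 1) ≤ 2 * G y * (1 + s))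
    (hpen' : ∀ y, ∑ j ∈ (opt y).filter (· ≠ (1 : Fin 3)), a y j * (if j = 2 then s else 1)
      ≤ 2 * G y * ((1 + s) * β))
    (hΦ : ∀ y, far y → (∀ z ∈ Φ y, y ≤ z) ∧ δ * ((x - y : ℕ) : ℝ) ≤ (Φ y).card)
    (hO : ∀ o ∈ O, ∀ y, far y → o y = 2 →
      (((Finset.univ.filter fun z => y ≤ z ∧ o z = 2).card : ℝ) ≤ h * ((x - y : ℕ) : ℝ)) ∧
      ∀ z ∈ Φ y, o z ≠ 1) :
    ∑ o ∈ O, ∏ y, a y (o y)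
      ≤ (∏ y, 2 * G y) * (1 + ∑ y : Fin x, ind (far y) * Real.exp (-τ * ((x - y : ℕ) : ℝ))) := by
  set opt0 : Fin x → Finset (Fin 3) := fun z =>
    if far z then Finset.univ.filter (· ≠ (2 : Fin 3)) else opt z with hopt0
  have hopt0' : ∀ z, ∑ j ∈ opt0 z, a z j ≤ 2 * G z := by
    intro z
    simp only [hopt0]
    split_ifs with hz
    · exact hfar z hz
    · exact hnear z hz
  set opt1 : Fin x → Fin x → Finset (Fin 3) := fun y z =>
    if z < y then opt0 z else if z ∈ Φ y then (opt z).filter (· ≠ (1 : Fin 3)) else opt z with hopt1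
  set a1 : Fin x → Fin x → Fin 3 → ℝ := fun y z j =>
    a z j * (if y ≤ z ∧ j = 2 then s else 1) with ha1
  have ha1' : ∀ y z j, 0 ≤ a1 y z j := by
    intro y z j
    simp only [ha1]
    have := ha z j
    split_ifs <;> positivity
  have hprod : ∀ o : Fin x → Fin 3, 0 ≤ ∏ y, a y (o y) := fun o => Finset.prod_nonneg fun y _ => ha y _
  -- each pattern is charged
  have charge : ∀ o ∈ O, ∏ y, a y (o y) ≤ ind (o ∈ Fintype.piFinset opt0) * ∏ y, a y (o y)
      + ∑ y : Fin x, ind (far y) * (Real.exp (h * (-Real.log s) * ((x - y : ℕ) : ℝ)) *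
        (ind (o ∈ Fintype.piFinset (opt1 y)) * ∏ z, a1 y z (o z))) := by
    intro o ho
    have hterm : ∀ y ∈ (Finset.univ : Finset (Fin x)), 0 ≤ ind (far y) *
        (Real.exp (h * (-Real.log s) * ((x - y : ℕ) : ℝ)) *
        (ind (o ∈ Fintype.piFinset (opt1 y)) * ∏ z, a1 y z (o z))) := fun y _ =>
      mul_nonneg (ind_nonneg _) (mul_nonneg (Real.exp_pos _).le (mul_nonneg (ind_nonneg _)
        (Finset.prod_nonneg fun z _ => ha1' _ _ _)))
    by_cases hex : ∃ y, far y ∧ o y = 2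
    · obtain ⟨y, ⟨hy1, hy2⟩, hmin⟩ : ∃ y, (far y ∧ o y = 2) ∧ ∀ z, z < y → ¬ (far z ∧ o z = 2) := by
        set B := Finset.univ.filter fun y : Fin x => far y ∧ o y = 2 with hB
        have hBne : B.Nonempty := ⟨hex.choose, Finset.mem_filter.2 ⟨Finset.mem_univ _, hex.choose_spec⟩⟩
        refine ⟨B.min' hBne, (Finset.mem_filter.1 (B.min'_mem hBne)).2, fun z hz hz' => ?_⟩
        exact absurd (B.min'_le z (Finset.mem_filter.2 ⟨Finset.mem_univ _, hz'⟩)) (not_le.2 hz)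
      obtain ⟨hq, hΦo⟩ := hO o ho y hy1 hy2
      have hmem : o ∈ Fintype.piFinset (opt1 y) := by
        rw [Fintype.mem_piFinset]
        intro z
        simp only [hopt1, hopt0]
        split_ifs with z1 z2 z3
        · exact Finset.mem_filter.2 ⟨Finset.mem_univ _, fun h2 => hmin z z1 ⟨z2, h2⟩⟩
        · exact hopt o ho z
        · exact Finset.mem_filter.2 ⟨hopt o ho z, hΦo z z3⟩
        · exact hopt o ho z
      have hle : ∏ y, a y (o y) ≤ ind (far y) * (Real.exp (h * (-Real.log s) * ((x - y : ℕ) : ℝ)) *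
          (ind (o ∈ Fintype.piFinset (opt1 y)) * ∏ z, a1 y z (o z))) := by
        rw [ind_true hy1, ind_true hmem, one_mul, one_mul]
        simp only [ha1]
        rw [Finset.prod_mul_distrib, Finset.prod_ite, Finset.prod_const, Finset.prod_const_one, mul_one]
        have h1 : 1 ≤ Real.exp (h * (-Real.log s) * ((x - y : ℕ) : ℝ)) *
            s ^ (Finset.univ.filter fun z => y ≤ z ∧ o z = 2).card := by
          have : s ^ (Finset.univ.filter fun z => y ≤ z ∧ o z = 2).card
              = Real.exp ((Finset.univ.filter fun z => y ≤ z ∧ o z = 2).card * Real.log s) := by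
            rw [Real.exp_nat_mul, Real.exp_log hs]
          rw [this, ← Real.exp_add]
          apply Real.one_le_exp
          have hl : 0 ≤ - Real.log s := by
            have := Real.log_nonpos hs.le hs1
            linarith
          have := mul_le_mul_of_nonneg_right hq hl
          linarith
        calc ∏ y, a y (o y) = 1 * ∏ y, a y (o y) := (one_mul _).symm
          _ ≤ (Real.exp (h * (-Real.log s) * ((x - y : ℕ) : ℝ)) *
            s ^ (Finset.univ.filter fun z => y ≤ z ∧ o z = 2).card) * ∏ y, a y (o y) :=
              mul_le_mul_of_nonneg_right h1 (hprod o)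
          _ = _ := by ring
      have h2 := Finset.single_le_sum hterm (Finset.mem_univ y)
      have h3 := mul_nonneg (ind_nonneg (o ∈ Fintype.piFinset opt0)) (hprod o)
      linarith
    · have hmem : o ∈ Fintype.piFinset opt0 := by
        rw [Fintype.mem_piFinset]
        intro z
        simp only [hopt0]
        split_ifs with z2
        · exact Finset.mem_filter.2 ⟨Finset.mem_univ _, fun h2 => hex ⟨z, z2, h2⟩⟩
        · exact hopt o ho z
      rw [ind_true hmem, one_mul]
      have := Finset.sum_nonneg hterm
      linarith
  have indsum : ∀ (P : Fin x → Finset (Fin 3)) (f : Fin x → Fin 3 → ℝ), (∀ y j, 0 ≤ f y j) →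
      ∑ o ∈ O, ind (o ∈ Fintype.piFinset P) * ∏ y, f y (o y) ≤ ∏ y, ∑ j ∈ P y, f y j := by
    intro P f hf
    rw [Finset.prod_univ_sum]
    have hn : ∀ o : Fin x → Fin 3, 0 ≤ ∏ y, f y (o y) := fun o => Finset.prod_nonneg fun y _ => hf y _
    calc _ ≤ ∑ o : Fin x → Fin 3, ind (o ∈ Fintype.piFinset P) * ∏ y, f y (o y) :=
          Finset.sum_le_sum_of_subset_of_nonneg (Finset.subset_univ _) fun o _ _ =>
            mul_nonneg (ind_nonneg _) (hn o)
      _ = _ := by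
          simp only [ind, ite_mul, one_mul, zero_mul]
          rw [Finset.sum_ite_mem, Finset.univ_inter]
  have main : ∀ y : Fin x, far y → Real.exp (h * (-Real.log s) * ((x - y : ℕ) : ℝ)) *
      ∏ z, ∑ j ∈ opt1 y z, a1 y z j ≤ (∏ y, 2 * G y) * Real.exp (-τ * ((x - y : ℕ) : ℝ)) := by
    intro y hy
    obtain ⟨hΦ1, hΦ2⟩ := hΦ y hy
    have h1 : ∀ z, ∑ j ∈ opt1 y z, a1 y z j
        ≤ 2 * G z * ((if y ≤ z then 1 + s else 1) * (if z ∈ Φ y then β else 1)) := by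
      intro z
      simp only [hopt1, ha1]
      by_cases hzy : z < y
      · have n1 : ¬ y ≤ z := not_le.2 hzy
        have n2 : z ∉ Φ y := fun hz => n1 (hΦ1 z hz)
        simp only [if_pos hzy, n1, false_and, if_false, mul_one, if_neg n2]
        exact hopt0' z
      · have n1 : y ≤ z := not_lt.1 hzy
        simp only [if_neg hzy, n1, true_and, if_true]
        by_cases hz : z ∈ Φ y
        · simp only [if_pos hz]; exact hpen' z
        · simp only [if_neg hz, mul_one]; exact hpen z
    have h2 : ∏ z, ∑ j ∈ opt1 y z, a1 y z j
        ≤ ∏ z, 2 * G z * ((if y ≤ z then 1 + s else 1) * (if z ∈ Φ y then β else 1)) :=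
      Finset.prod_le_prod (fun z _ => Finset.sum_nonneg fun j _ => ha1' _ _ _) fun z _ => h1 z
    have h3 : ∏ z, 2 * G z * ((if y ≤ z then 1 + s else 1) * (if z ∈ Φ y then β else 1))
        = (∏ z, 2 * G z) * ((1 + s) ^ (x - y : ℕ) * β ^ (Φ y).card) := by
      rw [Finset.prod_mul_distrib]
      congr 1
      rw [Finset.prod_mul_distrib]
      congr 1
      · rw [Finset.prod_ite, Finset.prod_const, Finset.prod_const_one, mul_one]
        congr 1
        rw [← Fin.card_Ici]
        congr 1
        ext z; simp
      · rw [Finset.prod_ite, Finset.prod_const, Finset.prod_const_one, mul_one]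
        congr 2
        ext z; simp
    have hP : 0 ≤ ∏ z, 2 * G z := Finset.prod_nonneg fun z _ => mul_nonneg (by norm_num) (hG z)
    have h4 : (1 + s) ^ (x - y : ℕ) ≤ Real.exp (s * ((x - y : ℕ) : ℝ)) := by
      calc (1 + s) ^ (x - y : ℕ) ≤ Real.exp s ^ (x - y : ℕ) := by
            gcongr; rw [add_comm]; exact Real.add_one_le_exp s
        _ = _ := by rw [← Real.exp_nat_mul, mul_comm]
    have h5 : β ^ (Φ y).card ≤ Real.exp (δ * Real.log β * ((x - y : ℕ) : ℝ)) := by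
      have : β ^ (Φ y).card = Real.exp ((Φ y).card * Real.log β) := by
        rw [Real.exp_nat_mul, Real.exp_log hβ]
      rw [this, Real.exp_le_exp]
      have := mul_le_mul_of_nonpos_right hΦ2 (Real.log_nonpos hβ.le hβ1)
      linarith
    calc _ ≤ Real.exp (h * (-Real.log s) * ((x - y : ℕ) : ℝ)) * ((∏ z, 2 * G z) *
          (Real.exp (s * ((x - y : ℕ) : ℝ)) * Real.exp (δ * Real.log β * ((x - y : ℕ) : ℝ)))) := by
          refine mul_le_mul_of_nonneg_left ?_ (Real.exp_pos _).le
          rw [h3] at h2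
          refine h2.trans (mul_le_mul_of_nonneg_left ?_ hP)
          exact mul_le_mul h4 h5 (by positivity) (Real.exp_pos _).le
      _ = (∏ z, 2 * G z) * Real.exp ((h * (-Real.log s) + s + δ * Real.log β) * ((x - y : ℕ) : ℝ)) := by
          rw [add_mul, add_mul, Real.exp_add, Real.exp_add]; ring
      _ ≤ _ := by gcongr
  calc ∑ o ∈ O, ∏ y, a y (o y)
      ≤ ∑ o ∈ O, (ind (o ∈ Fintype.piFinset opt0) * ∏ y, a y (o y)
      + ∑ y : Fin x, ind (far y) * (Real.exp (h * (-Real.log s) * ((x - y : ℕ) : ℝ)) *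
        (ind (o ∈ Fintype.piFinset (opt1 y)) * ∏ z, a1 y z (o z)))) := Finset.sum_le_sum charge
    _ = ∑ o ∈ O, ind (o ∈ Fintype.piFinset opt0) * ∏ y, a y (o y)
      + ∑ y : Fin x, ind (far y) * (Real.exp (h * (-Real.log s) * ((x - y : ℕ) : ℝ)) *
        ∑ o ∈ O, ind (o ∈ Fintype.piFinset (opt1 y)) * ∏ z, a1 y z (o z)) := by
        rw [Finset.sum_add_distrib, Finset.sum_comm]
        simp_rw [Finset.mul_sum]
    _ ≤ (∏ y, 2 * G y) + ∑ y : Fin x, ind (far y) * ((∏ y, 2 * G y)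
          * Real.exp (-τ * ((x - y : ℕ) : ℝ))) := by
        refine add_le_add ?_ (Finset.sum_le_sum fun y _ => ?_)
        · refine (indsum opt0 a ha).trans ?_
          exact Finset.prod_le_prod (fun z _ => Finset.sum_nonneg fun j _ => ha _ _) fun z _ => hopt0' z
        · by_cases hy : far y
          · rw [ind_true hy, one_mul, one_mul]
            refine le_trans ?_ (main y hy)
            exact mul_le_mul_of_nonneg_left (indsum (opt1 y) (a1 y) (ha1' y)) (Real.exp_pos _).le
          · rw [ind_false hy, zero_mul, zero_mul]
    _ = _ := by
        rw [mul_add, mul_one, Finset.mul_sum]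
        congr 1
        exact Finset.sum_congr rfl fun y _ => by ring

/-- Directed walks with increasing vertices. -/
def IncPath (T : ℕ → ℕ → Prop) : ℕ → ℕ → ℕ → Prop
  | 0, y, z => y = z
  | j + 1, y, z => ∃ w, IncPath T j y w ∧ w < z ∧ T w z

lemma IncPath.mono {T T' : ℕ → ℕ → Prop} (h : ∀ u v, T u v → T' u v) {j y z : ℕ}
    (hp : IncPath T j y z) : IncPath T' j y z := by
  induction j generalizing z with
  | zero => exact hp
  | succ j ih =>
    obtain ⟨w, h1, h2, h3⟩ := hp
    exact ⟨w, ih h1, h2, h _ _ h3⟩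

lemma IncPath.cons {T : ℕ → ℕ → Prop} {j x y z : ℕ} (hxy : x < y) (hT : T x y)
    (hp : IncPath T j y z) : IncPath T (j + 1) x z := by
  induction j generalizing z with
  | zero => obtain rfl := hp; exact ⟨x, rfl, hxy, hT⟩
  | succ j ih =>
    obtain ⟨w, h1, h2, h3⟩ := hp
    exact ⟨w, ih h1, h2, h3⟩

lemma IncPath.exists_seq {T : ℕ → ℕ → Prop} {j y z : ℕ} (hp : IncPath T j y z) :
    ∃ c : ℕ → ℕ, c 0 = y ∧ c j = z ∧ ∀ i < j, c i < c (i + 1) ∧ T (c i) (c (i + 1)) := by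
  induction j generalizing z with
  | zero => exact ⟨fun _ => y, rfl, hp, fun i hi => absurd hi (Nat.not_lt_zero i)⟩
  | succ j ih =>
    obtain ⟨w, h1, h2, h3⟩ := hp
    obtain ⟨c, c1, c2, c3⟩ := ih h1
    refine ⟨fun i => if i ≤ j then c i else z, by simp [c1], by simp, fun i hi => ?_⟩
    rcases Nat.lt_or_ge i j with h | h
    · simpa [h.le, Nat.succ_le_of_lt h] using c3 i h
    · obtain rfl : i = j := by omega
      simpa [c2] using And.intro h2 h3

lemma hasCyc_of_incPath {T : ℕ → ℕ → Prop} {k y x : ℕ} (hk : 1 ≤ k) (hp : IncPath T (k - 1) y x)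
    (hxy : T x y) : HasCyc T k := by
  obtain ⟨c, c1, c2, c3⟩ := hp.exists_seq
  have hmono : ∀ i j, i < j → j ≤ k - 1 → c i < c j := by
    intro i j hij hj
    induction j with
    | zero => omega
    | succ j ih =>
      rcases Nat.lt_or_ge i j with h | h
      · exact (ih h (by omega)).trans (c3 j (by omega)).1
      · obtain rfl : i = j := by omega
        exact (c3 i (by omega)).1
  refine ⟨c, fun i hi j hj hij => ?_, fun i hi => (c3 i (by omega)).2, by rw [c1, c2]; exact hxy⟩
  by_contra hne
  rcases Nat.lt_or_gt_of_ne hne with h | h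
  · exact absurd hij (hmono i j h (by omega)).ne
  · exact absurd hij (hmono j i h (by omega)).ne'

lemma exists_card_filter_lt (O : Finset ℕ) (t : ℕ) (ht : t ≤ O.card) :
    ∃ s, (O.filter (· < s)).card = t := by
  induction t with
  | zero => exact ⟨0, by simp⟩
  | succ t ih =>
    obtain ⟨s, hs⟩ := ih (by omega)
    have hne : (O.filter (s ≤ ·)).Nonempty := by
      rw [← Finset.card_pos]
      have := Finset.card_filter_add_card_filter_not (s := O) (· < s)
      simp only [not_lt] at this
      omega
    have hm := (O.filter (s ≤ ·)).min'_mem hne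
    set m := (O.filter (s ≤ ·)).min' hne with hmdef
    refine ⟨m + 1, ?_⟩
    obtain ⟨hm1, hm2⟩ := Finset.mem_filter.1 hm
    have : O.filter (· < m + 1) = insert m (O.filter (· < s)) := by
      ext u
      simp only [Finset.mem_filter, Finset.mem_insert]
      constructor
      · rintro ⟨h1, h2⟩
        by_cases hu : s ≤ u
        · left
          have := (O.filter (s ≤ ·)).min'_le u (Finset.mem_filter.2 ⟨h1, hu⟩)
          omega
        · right; exact ⟨h1, not_le.1 hu⟩
      · rintro (rfl | ⟨h1, h2⟩)
        · exact ⟨hm1, Nat.lt_succ_self _⟩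
        · exact ⟨h1, by omega⟩
    rw [this, Finset.card_insert_of_notMem, hs]
    intro h
    have := (Finset.mem_filter.1 h).2
    omega

/-- In a nice window, large sets reach large sets along increasing walks. -/
lemma NiceWin.expand {T : ℕ → ℕ → Prop} {ε : ℝ} {a b s0 L : ℕ} (hn : NiceWin T ε a b)
    {S : Finset ℕ} (hS : S ⊆ Finset.Ico a s0) (hcard : ε * (b - a : ℕ) ≤ S.card)
    (hL : 2 * (ε * (b - a : ℕ)) ≤ L) (hs : a ≤ s0) (j : ℕ) (hj : s0 + j * L ≤ b) :
    ∃ R ⊆ Finset.Ico a (s0 + j * L), (∀ z ∈ R, ∃ y ∈ S, IncPath T j y z) ∧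
      ε * (b - a : ℕ) ≤ R.card ∧ ∀ t : ℝ, t ≤ S.card → t ≤ L - ε * (b - a : ℕ) → t ≤ R.card := by
  induction j with
  | zero => exact ⟨S, by simpa using hS, fun z hz => ⟨z, hz, rfl⟩, hcard, fun t h1 _ => h1⟩
  | succ j ih =>
    rw [Nat.succ_mul] at hj
    obtain ⟨R, hR1, hR2, hR3, -⟩ := ih (by omega)
    set I := Finset.Ico (s0 + j * L) (s0 + (j + 1) * L) with hI
    set R' := I.filter fun z => ∃ y ∈ S, IncPath T (j + 1) y z with hR'
    have hsub : I ⊆ Finset.Ico a b := by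
      rw [hI, Nat.succ_mul]
      exact Finset.Ico_subset_Ico (by omega) (by omega)
    have hcompl : ((I.filter fun z => ¬ ∃ y ∈ S, IncPath T (j + 1) y z).card : ℝ) < ε * (b - a : ℕ) := by
      by_contra hge
      push Not at hge
      obtain ⟨u, hu, v, hv, huv⟩ := hn R _ (hR1.trans (Finset.Ico_subset_Ico le_rfl (by omega)))
        ((Finset.filter_subset _ _).trans hsub) (by
          intro u hu v hv
          have h1 := Finset.mem_Ico.1 (hR1 hu)
          have h2 := Finset.mem_Ico.1 (Finset.mem_filter.1 hv).1
          omega) hR3 hge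
      obtain ⟨y, hy, hp⟩ := hR2 u hu
      obtain ⟨hv1, hv2⟩ := Finset.mem_filter.1 hv
      have h1 := Finset.mem_Ico.1 (hR1 hu)
      have h2 := Finset.mem_Ico.1 hv1
      exact hv2 y hy ⟨u, hp, by omega, huv⟩
    have htot := Finset.card_filter_add_card_filter_not (s := I) (fun z => ∃ y ∈ S, IncPath T (j + 1) y z)
    have hIc : I.card = L := by rw [hI, Nat.card_Ico, Nat.succ_mul]; omega
    rw [hIc] at htot
    have htot' : (R'.card : ℝ) + ((I.filter fun z => ¬ ∃ y ∈ S, IncPath T (j + 1) y z).card : ℝ) = L := by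
      exact_mod_cast htot
    refine ⟨R', (Finset.filter_subset _ _).trans (Finset.Ico_subset_Ico (by omega) le_rfl),
      fun z hz => (Finset.mem_filter.1 hz).2, by linarith, fun t _ h2 => by linarith⟩

lemma OptOn.card_back_le {T : ℕ → ℕ → Prop} (hor : ∀ u v, T u v → ¬ T v u) {x : ℕ}
    (hopt : OptOn T (x + 1)) (s : ℕ) (hs : s ≤ x) :
    ((Finset.Ico s x).filter fun v => T x v).card ≤ ((Finset.Ico s x).filter fun u => T u x).card := by
  have hxx : ¬ T x x := fun h => hor x x h h
  have h := hopt s (x + 1) le_rfl (fun u => if u = x then (s : ℝ) - 1 / 2 else u)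
  rw [Finset.sum_Ico_succ_top hs, Finset.sum_Ico_succ_top hs] at h
  simp_rw [Finset.sum_Ico_succ_top hs] at h
  rw [Finset.sum_add_distrib, Finset.sum_add_distrib] at h
  have e1 : ∑ u ∈ Finset.Ico s x, ∑ v ∈ Finset.Ico s x, ind (T u v ∧
      (if v = x then (s : ℝ) - 1 / 2 else v) ≤ (if u = x then (s : ℝ) - 1 / 2 else u))
      = ∑ u ∈ Finset.Ico s x, ∑ v ∈ Finset.Ico s x, ind (T u v ∧ v < u) := by
    refine Finset.sum_congr rfl fun u hu => Finset.sum_congr rfl fun v hv => ?_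
    have h1 := Finset.mem_Ico.1 hu
    have h2 := Finset.mem_Ico.1 hv
    rw [if_neg (by omega), if_neg (by omega)]
    congr 1
    rw [Nat.cast_le, eq_iff_iff]
    constructor
    · rintro ⟨h3, h4⟩
      refine ⟨h3, lt_of_le_of_ne h4 ?_⟩
      rintro rfl; exact hor _ _ h3 h3
    · rintro ⟨h3, h4⟩; exact ⟨h3, h4.le⟩
  have e2 : ∑ u ∈ Finset.Ico s x, ind (T u x ∧
      ((s : ℝ) - 1 / 2) ≤ (if u = x then (s : ℝ) - 1 / 2 else u))
      = (((Finset.Ico s x).filter fun u => T u x).card : ℝ) := by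
    rw [Finset.card_filter]
    push_cast
    refine Finset.sum_congr rfl fun u hu => ?_
    have h1 := Finset.mem_Ico.1 hu
    have h2 : (s : ℝ) ≤ u := by exact_mod_cast h1.1
    rw [if_neg (by omega)]
    unfold ind
    have h3 : (s : ℝ) - 1 / 2 ≤ u := by linarith
    simp only [h3, and_true]
  have e3 : ∑ v ∈ Finset.Ico s x, ind (T x v ∧
      (if v = x then (s : ℝ) - 1 / 2 else v) ≤ ((s : ℝ) - 1 / 2)) = 0 := by
    refine Finset.sum_eq_zero fun v hv => ind_false ?_
    have h1 := Finset.mem_Ico.1 hv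
    have h2 : (s : ℝ) ≤ v := by exact_mod_cast h1.1
    rw [if_neg (by omega)]
    rintro ⟨-, h3⟩
    linarith
  have e4 : ∑ v ∈ Finset.Ico s x, ind (T x v ∧ v < x)
      = (((Finset.Ico s x).filter fun v => T x v).card : ℝ) := by
    rw [Finset.card_filter]
    push_cast
    refine Finset.sum_congr rfl fun u hu => ?_
    have h1 := Finset.mem_Ico.1 hu
    unfold ind
    simp only [h1.2, and_true]
  have e5 : 0 ≤ ∑ u ∈ Finset.Ico s x, ind (T u x ∧ x < u) := Finset.sum_nonneg fun _ _ => ind_nonneg _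
  simp only [if_true] at h
  rw [e1, e2, e3, e4] at h
  simp only [hxx, false_and] at h
  rw [ind_false (p := False) id] at h
  have : (((Finset.Ico s x).filter fun v => T x v).card : ℝ)
      ≤ (((Finset.Ico s x).filter fun u => T u x).card : ℝ) := by linarith
  exact_mod_cast this

lemma OptOn.card_in_le {T : ℕ → ℕ → Prop} (hor : ∀ u v, T u v → ¬ T v u) {x y : ℕ}
    (hopt : OptOn T x) (hy : y < x) :
    ((Finset.Ico (y + 1) x).filter fun v => T v y).card
      ≤ ((Finset.Ico (y + 1) x).filter fun u => T y u).card := by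
  have hxx : ¬ T y y := fun h => hor y y h h
  have h := hopt y x le_rfl (fun u => if u = y then (x : ℝ) else u)
  rw [Finset.sum_eq_sum_Ico_succ_bot hy, Finset.sum_eq_sum_Ico_succ_bot hy] at h
  simp_rw [Finset.sum_eq_sum_Ico_succ_bot hy] at h
  rw [Finset.sum_add_distrib, Finset.sum_add_distrib] at h
  have e1 : ∑ u ∈ Finset.Ico (y + 1) x, ∑ v ∈ Finset.Ico (y + 1) x, ind (T u v ∧
      (if v = y then (x : ℝ) else v) ≤ (if u = y then (x : ℝ) else u))
      = ∑ u ∈ Finset.Ico (y + 1) x, ∑ v ∈ Finset.Ico (y + 1) x, ind (T u v ∧ v < u) := by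
    refine Finset.sum_congr rfl fun u hu => Finset.sum_congr rfl fun v hv => ?_
    have h1 := Finset.mem_Ico.1 hu
    have h2 := Finset.mem_Ico.1 hv
    rw [if_neg (by omega), if_neg (by omega)]
    congr 1
    rw [Nat.cast_le, eq_iff_iff]
    constructor
    · rintro ⟨h3, h4⟩
      refine ⟨h3, lt_of_le_of_ne h4 ?_⟩
      rintro rfl; exact hor _ _ h3 h3
    · rintro ⟨h3, h4⟩; exact ⟨h3, h4.le⟩
  have e2 : ∑ u ∈ Finset.Ico (y + 1) x, ind (T u y ∧
      ((x : ℝ)) ≤ (if u = y then (x : ℝ) else u)) = 0 := by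
    refine Finset.sum_eq_zero fun v hv => ind_false ?_
    have h1 := Finset.mem_Ico.1 hv
    have h2 : (v : ℝ) < x := by exact_mod_cast h1.2
    rw [if_neg (by omega)]
    rintro ⟨-, h3⟩
    linarith
  have e3 : ∑ v ∈ Finset.Ico (y + 1) x, ind (T y v ∧
      (if v = y then (x : ℝ) else v) ≤ ((x : ℝ)))
      = (((Finset.Ico (y + 1) x).filter fun u => T y u).card : ℝ) := by
    rw [Finset.card_filter]
    push_cast
    refine Finset.sum_congr rfl fun u hu => ?_
    have h1 := Finset.mem_Ico.1 hu
    have h2 : (u : ℝ) ≤ x := by exact_mod_cast h1.2.le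
    rw [if_neg (by omega)]
    unfold ind
    simp only [h2, and_true]
  have e4 : ∑ u ∈ Finset.Ico (y + 1) x, ind (T u y ∧ y < u)
      = (((Finset.Ico (y + 1) x).filter fun v => T v y).card : ℝ) := by
    rw [Finset.card_filter]
    push_cast
    refine Finset.sum_congr rfl fun u hu => ?_
    have h1 := Finset.mem_Ico.1 hu
    unfold ind
    have h2 : y < u := by omega
    simp only [h2, and_true]
  have e5 : 0 ≤ ∑ u ∈ Finset.Ico (y + 1) x, ind (T y u ∧ u < y) :=
    Finset.sum_nonneg fun _ _ => ind_nonneg _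
  simp only [if_true] at h
  rw [e1, e2, e3, e4] at h
  simp only [hxx, false_and] at h
  rw [ind_false (p := False) id] at h
  have : (((Finset.Ico (y + 1) x).filter fun v => T v y).card : ℝ)
      ≤ (((Finset.Ico (y + 1) x).filter fun u => T y u).card : ℝ) := by linarith
  exact_mod_cast this

lemma NiceWin.card_reach_ge {T : ℕ → ℕ → Prop} {ε θ : ℝ} {k x y : ℕ} (hk : 3 ≤ k)
    (hn : NiceWin T ε y x) (hθ : 0 < θ) (hε : ε ≤ θ / (8 * k))
    (hD : 8 * k ≤ θ * (x - y : ℕ))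
    (hO : θ * (x - y : ℕ) ≤ ((Finset.Ico (y + 1) x).filter fun z => T y z).card) :
    θ / (8 * k) * (x - y : ℕ) ≤
      ((Finset.Ico y x).filter fun z => IncPath T (k - 2) y z).card := by
  set O := (Finset.Ico (y + 1) x).filter fun z => T y z with hOdef
  have hk0 : (0 : ℝ) < k := by positivity
  have hk3 : (3 : ℝ) ≤ k := by exact_mod_cast hk
  set D : ℝ := ((x - y : ℕ) : ℝ) with hDdef
  have hD0 : 0 ≤ D := Nat.cast_nonneg _
  set δ := θ / (8 * k) with hδ
  have hθδ : θ = 8 * k * δ := by rw [hδ]; field_simp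
  have hδD : 1 ≤ δ * D := by
    rw [hθδ] at hD
    by_contra h
    push Not at h
    nlinarith
  have hεD : ε * D ≤ δ * D := mul_le_mul_of_nonneg_right hε hD0
  have hOc : 8 * k * (δ * D) ≤ O.card := by rw [hθδ] at hO; linarith
  obtain ⟨s0, hs0⟩ := exists_card_filter_lt O (O.card / 2) (Nat.div_le_self _ _)
  have hcomp := Finset.card_filter_add_card_filter_not (s := O) (· < s0)
  have hO24 : 24 ≤ O.card := by
    have : (24 : ℝ) ≤ O.card := by nlinarith
    exact_mod_cast this
  have hs0x : (O.filter fun z => ¬ z < s0).card ≤ x - s0 := by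
    rw [← Nat.card_Ico]
    refine Finset.card_le_card fun z hz => ?_
    obtain ⟨h1, h2⟩ := Finset.mem_filter.1 hz
    have := Finset.mem_Ico.1 (Finset.mem_filter.1 h1).1
    exact Finset.mem_Ico.2 ⟨not_lt.1 h2, this.2⟩
  have hys0 : y ≤ s0 := by
    have : 0 < (O.filter (· < s0)).card := by omega
    obtain ⟨z, hz⟩ := Finset.card_pos.1 this
    obtain ⟨h1, h2⟩ := Finset.mem_filter.1 hz
    have := Finset.mem_Ico.1 (Finset.mem_filter.1 h1).1
    omega
  set L := O.card / (2 * k) with hL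
  have hLle : L * (2 * k) ≤ O.card := Nat.div_mul_le_self _ _
  have hLge : (O.card : ℝ) / (2 * k) - 1 ≤ L := by
    have := Nat.lt_div_mul_add (a := O.card) (b := 2 * k) (by omega)
    have h2 : (O.card : ℝ) < L * (2 * k) + 2 * k := by exact_mod_cast this
    rw [sub_le_iff_le_add, div_le_iff₀ (by positivity)]
    linarith
  have hLδ : 3 * (δ * D) ≤ L := by
    have : 4 * (δ * D) ≤ (O.card : ℝ) / (2 * k) := by
      rw [le_div_iff₀ (by positivity)]; linarith
    linarith
  have hjL : s0 + (k - 3) * L ≤ x := by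
    obtain ⟨k', rfl⟩ : ∃ k', k = k' + 3 := ⟨k - 3, by omega⟩
    have h1 : (k' + 3 - 3) * L ≤ O.card / 2 := by
      rw [Nat.le_div_iff_mul_le (by norm_num), Nat.add_sub_cancel]
      nlinarith
    omega
  have hScard : δ * D ≤ ((O.filter (· < s0)).card : ℝ) := by
    rw [hs0]
    have h1 : O.card ≤ 2 * (O.card / 2) + 1 := by omega
    have h2 : (O.card : ℝ) ≤ 2 * ((O.card / 2 : ℕ) : ℝ) + 1 := by exact_mod_cast h1
    have h3 : 24 * (δ * D) ≤ 8 * k * (δ * D) := by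
      have : 0 ≤ δ * D := by linarith
      nlinarith
    linarith
  obtain ⟨R, hR1, hR2, -, hR4⟩ := hn.expand (S := O.filter (· < s0)) (s0 := s0) (L := L)
    (by
      intro z hz
      obtain ⟨h1, h2⟩ := Finset.mem_filter.1 hz
      have := Finset.mem_Ico.1 (Finset.mem_filter.1 h1).1
      exact Finset.mem_Ico.2 ⟨by omega, h2⟩)
    (by linarith) (by linarith) hys0 (k - 3) hjL
  refine (hR4 (δ * D) hScard (by linarith)).trans ?_
  norm_cast
  refine Finset.card_le_card fun z hz => ?_
  obtain ⟨w, hw, hp⟩ := hR2 z hz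
  have h1 := Finset.mem_Ico.1 (hR1 hz)
  obtain ⟨h2, h3⟩ := Finset.mem_filter.1 (Finset.mem_filter.1 hw).1
  refine Finset.mem_filter.2 ⟨Finset.mem_Ico.2 ⟨h1.1, by omega⟩, ?_⟩
  have := IncPath.cons (by have := Finset.mem_Ico.1 h2; omega) h3 hp
  rwa [show k - 3 + 1 = k - 2 by omega] at this

lemma NiceWin.card_out_le {T : ℕ → ℕ → Prop} {ε h : ℝ} {k x y : ℕ} (hk : 3 ≤ k)
    (hor : ∀ u v, T u v → ¬ T v u) (hcyc : ¬ HasCyc T k) (hopt : OptOn T (x + 1))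
    (hn : NiceWin T ε y x) (hε : ε ≤ h / (16 * k))
    (hD : 16 * k ≤ h * (x - y : ℕ)) :
    (((Finset.Ico y x).filter fun z => T x z).card : ℝ) ≤ h * (x - y : ℕ) := by
  by_contra hlt
  push Not at hlt
  set Q := (Finset.Ico y x).filter fun z => T x z with hQ
  have hk0 : (0 : ℝ) < k := by positivity
  have hk3 : (3 : ℝ) ≤ k := by exact_mod_cast hk
  set D : ℝ := ((x - y : ℕ) : ℝ) with hDdef
  have hD0 : 0 ≤ D := Nat.cast_nonneg _
  have hεD : ε * D * (16 * k) ≤ h * D := by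
    have := mul_le_mul_of_nonneg_right hε hD0
    rw [div_mul_eq_mul_div, le_div_iff₀ (by positivity)] at this
    exact this
  set t := Q.card / 3 with ht
  obtain ⟨s1, hs1⟩ := exists_card_filter_lt Q t (Nat.div_le_self _ _)
  obtain ⟨s2, hs2⟩ := exists_card_filter_lt Q (2 * t) (by omega)
  have hQ48 : 48 < Q.card := by
    have : (48 : ℝ) < Q.card := by linarith
    exact_mod_cast this
  have hmid : Q.filter (· < s2) ⊆ Q.filter (· < s1) ∪ Finset.Ico s1 s2 := by
    intro z hz
    obtain ⟨h1, h2⟩ := Finset.mem_filter.1 hz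
    rw [Finset.mem_union, Finset.mem_filter, Finset.mem_Ico]
    by_cases h3 : z < s1
    · exact Or.inl ⟨h1, h3⟩
    · exact Or.inr ⟨not_lt.1 h3, h2⟩
  have hmid' := (Finset.card_le_card hmid).trans (Finset.card_union_le _ _)
  rw [hs1, hs2, Nat.card_Ico] at hmid'
  have hcomp := Finset.card_filter_add_card_filter_not (s := Q) (· < s2)
  have hys1 : y ≤ s1 := by
    have : 0 < (Q.filter (· < s1)).card := by omega
    obtain ⟨z, hz⟩ := Finset.card_pos.1 this
    obtain ⟨h1, h2⟩ := Finset.mem_filter.1 hz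
    have := Finset.mem_Ico.1 (Finset.mem_filter.1 h1).1
    omega
  have hs2x : s2 < x := by
    have : 0 < (Q.filter fun z => ¬ z < s2).card := by omega
    obtain ⟨z, hz⟩ := Finset.card_pos.1 this
    obtain ⟨h1, h2⟩ := Finset.mem_filter.1 hz
    have := Finset.mem_Ico.1 (Finset.mem_filter.1 h1).1
    omega
  set L := t / k with hL
  have hLle : L * k ≤ t := Nat.div_mul_le_self _ _
  have htge : (Q.card : ℝ) / 3 - 1 ≤ t := by
    have h1 : Q.card ≤ 3 * t + 2 := by omega
    have h2 : (Q.card : ℝ) ≤ 3 * t + 2 := by exact_mod_cast h1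
    linarith
  have hLge : (t : ℝ) ≤ (L + 1) * k := by
    have := Nat.lt_div_mul_add (a := t) (b := k) (by omega)
    have h2 : (t : ℝ) < L * k + k := by exact_mod_cast this
    linarith
  have hLε : 2 * (ε * D) ≤ L := by
    by_contra hc
    push Not at hc
    have : (L : ℝ) * k < 2 * (ε * D) * k := mul_lt_mul_of_pos_right hc hk0
    nlinarith
  have htε : ε * D ≤ t := by
    rcases le_or_gt (ε * D) 0 with h0 | h0
    · exact h0.trans (Nat.cast_nonneg _)
    · nlinarith
  have hkL : (k - 3) * L ≤ t := (Nat.mul_le_mul_right L (Nat.sub_le k 3)).trans (by linarith)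
  have hjL : s1 + (k - 3) * L ≤ s2 := by omega
  obtain ⟨R, hR1, hR2, hR3, -⟩ := hn.expand (S := Q.filter (· < s1)) (s0 := s1) (L := L)
    (by
      intro z hz
      obtain ⟨h1, h2⟩ := Finset.mem_filter.1 hz
      have := Finset.mem_Ico.1 (Finset.mem_filter.1 h1).1
      exact Finset.mem_Ico.2 ⟨this.1, h2⟩)
    (by rw [hs1]; exact htε) hLε hys1 (k - 3) (by omega)
  have hF := hopt.card_back_le hor s2 hs2x.le
  have hQF : (Q.filter fun z => ¬ z < s2) ⊆ (Finset.Ico s2 x).filter fun v => T x v := by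
    intro z hz
    obtain ⟨h1, h2⟩ := Finset.mem_filter.1 hz
    obtain ⟨h3, h4⟩ := Finset.mem_filter.1 h1
    exact Finset.mem_filter.2 ⟨Finset.mem_Ico.2 ⟨not_lt.1 h2, (Finset.mem_Ico.1 h3).2⟩, h4⟩
  have hFt : t ≤ ((Finset.Ico s2 x).filter fun u => T u x).card := by
    have := Finset.card_le_card hQF
    omega
  obtain ⟨u, hu, v, hv, huv⟩ := hn R ((Finset.Ico s2 x).filter fun u => T u x)
    (hR1.trans (Finset.Ico_subset_Ico le_rfl (by omega)))
    ((Finset.filter_subset _ _).trans (Finset.Ico_subset_Ico (by omega) le_rfl))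
    (by
      intro u hu v hv
      have h1 := Finset.mem_Ico.1 (hR1 hu)
      have h2 := Finset.mem_Ico.1 (Finset.mem_filter.1 hv).1
      omega) hR3 (htε.trans (by exact_mod_cast hFt))
  obtain ⟨w, hw, hp⟩ := hR2 u hu
  obtain ⟨h1, h2⟩ := Finset.mem_filter.1 hv
  have h3 := Finset.mem_Ico.1 (hR1 hu)
  have h4 := Finset.mem_Ico.1 h1
  have hp2 : IncPath T (k - 3 + 1 + 1) w x := ⟨v, ⟨u, hp, by omega, huv⟩, h4.2, h2⟩
  rw [show k - 3 + 1 + 1 = k - 1 by omega] at hp2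
  exact hcyc (hasCyc_of_incPath (by omega) hp2
    (Finset.mem_filter.1 (Finset.mem_filter.1 hw).1).2)

lemma exp_neg_bZero : Real.exp (-bZero) = (17 / 20) ^ 3 := by
  unfold bZero
  rw [show -(-3 * Real.log (17 / 20)) = (3 : ℕ) * Real.log (17 / 20) by push_cast; ring,
    Real.exp_nat_mul, Real.exp_log (by norm_num)]

lemma exp_dZero : Real.exp dZero = 31 / 20 := by
  unfold dZero
  rw [Real.exp_log (by norm_num)]

/-- The factor by which the weight of a vertex with potential `U` changes when a new vertex is
attached with the given status; `l` is the price of a backwards arc. -/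
noncomputable def stepFactor (l U : ℝ) (j : Fin 3) : ℝ :=
  if j = 0 then (1 + 101 / 100 * U) / (1 + U)
  else if j = 1 then (1 + 101 / 400 * U) / (1 + U)
  else l * ((1 + 101 / 400 * U) / (1 + U))

section
variable {l U s : ℝ}

lemma stepFactor_zero : stepFactor l U 0 = (1 + 101 / 100 * U) / (1 + U) := by simp [stepFactor]

lemma stepFactor_one : stepFactor l U 1 = (1 + 101 / 400 * U) / (1 + U) := by simp [stepFactor]

lemma stepFactor_two : stepFactor l U 2 = l * ((1 + 101 / 400 * U) / (1 + U)) := by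
  simp [stepFactor]

lemma stepFactor_nonneg (hl : 1 ≤ l) (hU : 0 ≤ U) (j : Fin 3) : 0 ≤ stepFactor l U j := by
  unfold stepFactor
  split_ifs <;> positivity

lemma stepFactor_zero_le (hU : 0 ≤ U) : stepFactor l U 0 ≤ 101 / 100 := by
  rw [stepFactor_zero, div_le_iff₀ (by positivity)]
  linarith

lemma stepFactor_zero_add_one_le (hU : 0 ≤ U) : stepFactor l U 0 + stepFactor l U 1 ≤ 2 := by
  rw [stepFactor_zero, stepFactor_one, ← add_div, div_le_iff₀ (by positivity)]
  linarith

lemma stepFactor_one_le (hU : 0 ≤ U) : stepFactor l U 1 ≤ 1 := by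
  rw [stepFactor_one, div_le_iff₀ (by positivity)]
  linarith

lemma stepFactor_two_le (hl : 1 ≤ l) (hU : 0 ≤ U) : stepFactor l U 2 ≤ l := by
  rw [stepFactor_two]
  have : (1 + 101 / 400 * U) / (1 + U) ≤ 1 := by
    rw [div_le_iff₀ (by positivity)]; linarith
  exact mul_le_of_le_one_right (by linarith) this

lemma stepFactor_zero_add_two_le (hl : 1 ≤ l) (hU : 0 ≤ U) :
    stepFactor l U 0 + stepFactor l U 2 ≤ 1 + l := by
  rw [stepFactor_zero, stepFactor_two, ← mul_div_assoc, ← add_div, div_le_iff₀ (by positivity)]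
  nlinarith

lemma stepFactor_sum_le_two (hl' : l ≤ 11 / 10) (hU : 4 ≤ U) :
    stepFactor l U 0 + stepFactor l U 1 + stepFactor l U 2 ≤ 2 := by
  rw [stepFactor_zero, stepFactor_one, stepFactor_two, ← mul_div_assoc, ← add_div, ← add_div,
    div_le_iff₀ (by positivity)]
  nlinarith

lemma sum_fin_three_subset_le {f : Fin 3 → ℝ} (hf : ∀ j, 0 ≤ f j) (o : Finset (Fin 3)) :
    ∑ j ∈ o, f j ≤ f 0 + f 1 + f 2 := by
  rw [← Fin.sum_univ_three]
  exact Finset.sum_le_sum_of_subset_of_nonneg (Finset.subset_univ _) fun j _ _ => hf j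

lemma sum_le_of_subset_zero {f : Fin 3 → ℝ} (hf : ∀ j, 0 ≤ f j) {o : Finset (Fin 3)}
    (ho : o ⊆ {0}) : ∑ j ∈ o, f j ≤ f 0 := by
  rw [← Finset.sum_singleton f 0]
  exact Finset.sum_le_sum_of_subset_of_nonneg ho fun j _ _ => hf j

lemma sum_stepFactor_le_of_ne (hl : 1 ≤ l) (hU : 0 ≤ U) {o : Finset (Fin 3)}
    (ho : o ≠ Finset.univ) : ∑ j ∈ o, stepFactor l U j ≤ 1 + l := by
  obtain ⟨j, hj⟩ : ∃ j, j ∉ o := by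
    by_contra h
    push Not at h
    exact ho (Finset.eq_univ_iff_forall.2 h)
  have hsub : o ⊆ Finset.univ.erase j := fun i hi => Finset.mem_erase.2
    ⟨fun h => hj (h ▸ hi), Finset.mem_univ _⟩
  refine (Finset.sum_le_sum_of_subset_of_nonneg hsub
    fun j _ _ => stepFactor_nonneg hl hU j).trans ?_
  have htot := Finset.sum_erase_add Finset.univ (stepFactor l U) (Finset.mem_univ j)
  rw [Fin.sum_univ_three] at htot
  have h1 := stepFactor_zero_add_two_le hl hU
  have h2 := stepFactor_zero_add_one_le (l := l) hU
  have h3 := stepFactor_one_le (l := l) hU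
  have h4 := stepFactor_two_le hl hU
  fin_cases j
  · simp only [Fin.zero_eta] at htot ⊢; linarith
  · simp only [Fin.mk_one] at htot ⊢; linarith
  · simp only [Fin.reduceFinMk] at htot ⊢; linarith

lemma sum_filter_ne_two_le (hU : 0 ≤ U) :
    ∑ j ∈ Finset.univ.filter (· ≠ (2 : Fin 3)), stepFactor l U j ≤ 2 := by
  have : Finset.univ.filter (· ≠ (2 : Fin 3)) = {0, 1} := by decide
  rw [this, Finset.sum_pair (by decide)]
  exact stepFactor_zero_add_one_le hU

lemma sum_penalised_le (hl : 1 ≤ l) (hl' : l ≤ 11 / 10) (hU : 0 ≤ U) (hs : 0 ≤ s)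
    (o : Finset (Fin 3)) :
    ∑ j ∈ o, stepFactor l U j * (if j = 2 then s else 1) ≤ 2 * (1 + s) := by
  refine (sum_fin_three_subset_le (f := fun j => stepFactor l U j * (if j = 2 then s else 1))
    (fun j => mul_nonneg (stepFactor_nonneg hl hU j) (by split_ifs <;> linarith)) o).trans ?_
  have h2 := stepFactor_zero_add_one_le (l := l) hU
  have h4 := mul_le_mul_of_nonneg_right (stepFactor_two_le hl hU) hs
  simp only [show (0 : Fin 3) ≠ 2 by decide, show (1 : Fin 3) ≠ 2 by decide, if_false, if_true,
    mul_one]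
  linarith [mul_le_mul_of_nonneg_right hl' hs]

lemma sum_penalised_filter_le (hl : 1 ≤ l) (hl' : l ≤ 11 / 10) (hU : 0 ≤ U) (hs : 0 ≤ s)
    (o : Finset (Fin 3)) :
    ∑ j ∈ o.filter (· ≠ 1), stepFactor l U j * (if j = 2 then s else 1)
      ≤ 2 * ((1 + s) * (17 / 20)) := by
  have hsub : o.filter (· ≠ 1) ⊆ {0, 2} := by
    intro j hj
    have := (Finset.mem_filter.1 hj).2
    revert this
    fin_cases j <;> decide
  refine (Finset.sum_le_sum_of_subset_of_nonneg hsub fun j _ _ =>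
    mul_nonneg (stepFactor_nonneg hl hU j) (by split_ifs <;> linarith)).trans ?_
  rw [Finset.sum_pair (by decide)]
  have h2 := stepFactor_zero_le (l := l) hU
  have h4 := mul_le_mul_of_nonneg_right (stepFactor_two_le hl hU) hs
  rw [if_neg (by decide), if_pos rfl]
  nlinarith

lemma sum_penalised_le_of_subset_zero (hl : 1 ≤ l) (hU : 0 ≤ U) (hs : 0 ≤ s)
    {o : Finset (Fin 3)} (ho : o ⊆ {0}) :
    ∑ j ∈ o, stepFactor l U j * (if j = 2 then s else 1) ≤ 101 / 100 := by
  refine (sum_le_of_subset_zero (f := fun j => stepFactor l U j * (if j = 2 then s else 1))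
    (fun j => mul_nonneg (stepFactor_nonneg hl hU j) (by split_ifs <;> linarith)) ho).trans ?_
  rw [if_neg (by decide), mul_one]
  exact stepFactor_zero_le hU

end

/-- The potential of the vertex `y` in a graph on `{0, …, x - 1}`: it is small only if `y` has many
neighbours among the later vertices. -/
noncomputable def potential (T : ℕ → ℕ → Prop) (x y : ℕ) : ℝ :=
  4 * (101 / 100) ^ (x - 1 - y) *
    (1 / 4) ^ ((Finset.Ico (y + 1) x).filter fun z => T y z ∨ T z y).card

lemma potential_nonneg (T : ℕ → ℕ → Prop) (x y : ℕ) : 0 ≤ potential T x y := by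
  unfold potential
  positivity

lemma OptOn.mono {T : ℕ → ℕ → Prop} {p p' : ℕ} (h : OptOn T p) (hp : p' ≤ p) : OptOn T p' :=
  fun a b hb ρ => h a b (hb.trans hp) ρ

lemma OptOn.le_out_of_potential_lt {T : ℕ → ℕ → Prop} (hor : ∀ u v, T u v → ¬ T v u) {x y : ℕ}
    (hopt : OptOn T x) (hy : y < x) (hU : potential T x y < 4) :
    1 / 280 * ((x - y : ℕ) : ℝ) ≤ ((Finset.Ico (y + 1) x).filter fun z => T y z).card := by
  unfold potential at hU
  set d := ((Finset.Ico (y + 1) x).filter fun z => T y z ∨ T z y).card with hd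
  have h1 : ((101 / 100 : ℝ)) ^ (x - 1 - y) * (1 / 4) ^ d < 1 := by
    nlinarith
  have h2 : ((101 / 100 : ℝ)) ^ (x - 1 - y) < 4 ^ d := by
    rw [one_div, inv_pow, mul_inv_lt_iff₀ (by positivity), one_mul] at h1
    exact h1
  have h3 : ((4 : ℝ)) ^ d ≤ (101 / 100) ^ (140 * d) := by
    rw [pow_mul]
    exact pow_le_pow_left₀ (by norm_num) (by norm_num) d
  have h4 : x - 1 - y < 140 * d :=
    (pow_lt_pow_iff_right₀ (by norm_num : (1 : ℝ) < 101 / 100)).1 (h2.trans_le h3)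
  have h5 := hopt.card_in_le hor hy
  have h6 : d ≤ ((Finset.Ico (y + 1) x).filter fun z => T y z).card
      + ((Finset.Ico (y + 1) x).filter fun z => T z y).card := by
    rw [hd, Finset.filter_or]
    exact Finset.card_union_le _ _
  have h7 : x - y ≤ 280 * ((Finset.Ico (y + 1) x).filter fun z => T y z).card := by omega
  have h8 : ((x - y : ℕ) : ℝ) ≤ 280 * (((Finset.Ico (y + 1) x).filter fun z => T y z).card : ℝ) := by
    exact_mod_cast h7
  linarith

lemma card_filter_fin_Ico {x y : ℕ} (p : ℕ → Prop) :
    (Finset.univ.filter fun z : Fin x => y ≤ z ∧ p z).card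
      = ((Finset.Ico y x).filter p).card := by
  rw [← Finset.card_map Fin.valEmbedding]
  congr 1
  ext z
  simp only [Finset.mem_map, Finset.mem_filter, Finset.mem_univ, true_and, Fin.valEmbedding_apply,
    Finset.mem_Ico]
  constructor
  · rintro ⟨w, ⟨h1, h2⟩, rfl⟩; exact ⟨⟨h1, w.2⟩, h2⟩
  · rintro ⟨⟨h1, h2⟩, h3⟩; exact ⟨⟨z, h2⟩, ⟨h1, h3⟩, rfl⟩

lemma exists_sum_exp_le {τ : ℝ} (hτ : 0 < τ) : ∃ m : ℕ, ∀ x : ℕ,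
    ∑ y ∈ Finset.range x, ind (m < x - y) * Real.exp (-τ * ((x - y : ℕ) : ℝ)) ≤ 1 := by
  have hq : Real.exp (-τ) < 1 := by rw [Real.exp_lt_one_iff]; linarith
  have hs := summable_geometric_of_lt_one (Real.exp_pos (-τ)).le hq
  have ht := tendsto_sum_nat_add (fun i => Real.exp (-τ) ^ i)
  obtain ⟨m, hm⟩ := (ht.eventually (gt_mem_nhds zero_lt_one)).exists
  refine ⟨m, fun x => ?_⟩
  have h1 : ∑ y ∈ Finset.range x, ind (m < x - y) * Real.exp (-τ * ((x - y : ℕ) : ℝ))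
      = ∑ y ∈ Finset.range x, ind (m < y + 1) * Real.exp (-τ) ^ (y + 1) := by
    rw [← Finset.sum_range_reflect]
    refine Finset.sum_congr rfl fun y hy => ?_
    have := Finset.mem_range.1 hy
    rw [show x - (x - 1 - y) = y + 1 by omega, ← Real.exp_nat_mul]
    congr 2
    ring
  rw [h1]
  have h2 : ∑ y ∈ Finset.range x, ind (m < y + 1) * Real.exp (-τ) ^ (y + 1)
      ≤ ∑ y ∈ (Finset.range x).filter (m ≤ ·), Real.exp (-τ) ^ (y + 1) := by
    rw [Finset.sum_filter]
    refine Finset.sum_le_sum fun y _ => ?_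
    unfold ind
    split_ifs <;> first | (exfalso; omega) | simp
  refine h2.trans ?_
  have h3 : ∑ y ∈ (Finset.range x).filter (m ≤ ·), Real.exp (-τ) ^ (y + 1)
      ≤ ∑ i ∈ Finset.range x, Real.exp (-τ) ^ (i + m) := by
    calc _ ≤ ∑ y ∈ (Finset.range x).filter (m ≤ ·), Real.exp (-τ) ^ y := by
          refine Finset.sum_le_sum fun y _ => ?_
          exact pow_le_pow_of_le_one (Real.exp_pos _).le hq.le (Nat.le_succ y)
      _ = ∑ i ∈ ((Finset.range x).filter (m ≤ ·)).image (· - m), Real.exp (-τ) ^ (i + m) := by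
          rw [Finset.sum_image]
          · refine Finset.sum_congr rfl fun y hy => ?_
            rw [Nat.sub_add_cancel (Finset.mem_filter.1 hy).2]
          · intro u hu v hv huv
            have h1 := (Finset.mem_filter.1 hu).2
            have h2 := (Finset.mem_filter.1 hv).2
            simp only at huv
            omega
      _ ≤ _ := by
          refine Finset.sum_le_sum_of_subset_of_nonneg ?_ fun i _ _ => by positivity
          intro i hi
          obtain ⟨y, hy, rfl⟩ := Finset.mem_image.1 hi
          have := Finset.mem_range.1 (Finset.mem_filter.1 hy).1
          exact Finset.mem_range.2 (by omega)
  refine h3.trans ((Summable.sum_le_tsum _ (fun i _ => by positivity) ?_).trans hm.le)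
  exact (summable_nat_add_iff m).2 hs

lemma NiceWin.congr {T T' : ℕ → ℕ → Prop} {ε : ℝ} {a b : ℕ}
    (h : ∀ u v, u < b → v < b → T u v → T' u v) (hn : NiceWin T ε a b) : NiceWin T' ε a b := by
  intro X Y hX hY hXY h1 h2
  obtain ⟨u, hu, v, hv, huv⟩ := hn X Y hX hY hXY h1 h2
  exact ⟨u, hu, v, hv, h u v (Finset.mem_Ico.1 (hX hu)).2 (Finset.mem_Ico.1 (hY hv)).2 huv⟩

lemma OptOn.congr {T T' : ℕ → ℕ → Prop} {p : ℕ}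
    (h : ∀ u v, u < p → v < p → (T u v ↔ T' u v)) (ho : OptOn T p) : OptOn T' p := by
  intro a b hb ρ
  have key : ∀ f : ℕ → ℕ → Prop, ∑ u ∈ Finset.Ico a b, ∑ v ∈ Finset.Ico a b, ind (T u v ∧ f u v)
      = ∑ u ∈ Finset.Ico a b, ∑ v ∈ Finset.Ico a b, ind (T' u v ∧ f u v) := by
    intro f
    refine Finset.sum_congr rfl fun u hu => Finset.sum_congr rfl fun v hv => ?_
    have h1 := Finset.mem_Ico.1 hu
    have h2 := Finset.mem_Ico.1 hv
    rw [h u v (by omega) (by omega)]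
  rw [← key fun u v => v < u, ← key fun u v => ρ v ≤ ρ u]
  exact ho a b hb ρ

/-- The bound, up to a factor `2`, for the total contribution of the old vertex `y` when a new
vertex `x` is attached to a block starting at `c`. -/
noncomputable def stepBound (l : ℝ) (c d x : ℕ) (Ω : ℕ → Finset (Fin 3)) (y : ℕ) : ℝ :=
  if y < c then Real.exp (dZero * ind (x - y ≤ d))
  else (1 + l) / 2 * Real.exp (-bZero * ind (Ω y ⊆ {0}) + dZero * ind (Ω y = Finset.univ))

lemma stepBound_nonneg {l : ℝ} (hl : 1 ≤ l) (c d x : ℕ) (Ω : ℕ → Finset (Fin 3)) (y : ℕ) :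
    0 ≤ stepBound l c d x Ω y := by
  unfold stepBound
  split_ifs <;> positivity

lemma one_le_stepBound {l : ℝ} (hl : 1 ≤ l) {c d x : ℕ} {Ω : ℕ → Finset (Fin 3)} {y : ℕ}
    (h : y < c ∨ ¬ Ω y ⊆ {0}) : 1 ≤ stepBound l c d x Ω y := by
  unfold stepBound
  split_ifs with hy
  · exact Real.one_le_exp (mul_nonneg dZero_nonneg (ind_nonneg _))
  · rw [ind_false (h.resolve_left hy)]
    have : 1 ≤ Real.exp (-bZero * 0 + dZero * ind (Ω y = Finset.univ)) :=
      Real.one_le_exp (by have := mul_nonneg dZero_nonneg (ind_nonneg (Ω y = Finset.univ)); linarith)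
    nlinarith

lemma stepBound_of_subset {l : ℝ} (hl : 1 ≤ l) {c d x : ℕ} {Ω : ℕ → Finset (Fin 3)} {y : ℕ}
    (hy : ¬ y < c) (h : Ω y ⊆ {0}) : 4913 / 8000 ≤ stepBound l c d x Ω y := by
  unfold stepBound
  rw [if_neg hy, ind_true h, ind_false]
  · rw [mul_one, mul_zero, add_zero, exp_neg_bZero]
    nlinarith
  · intro h1
    rw [h1] at h
    exact absurd (h (Finset.mem_univ 1)) (by decide)

lemma status_eq_one {T : ℕ → ℕ → Prop} {z x : ℕ} : status T z x = 1 ↔ T z x := by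
  unfold status
  split_ifs <;> simp_all

lemma status_eq_two {T : ℕ → ℕ → Prop} (hor : ∀ u v, T u v → ¬ T v u) {z x : ℕ} :
    status T z x = 2 ↔ T x z := by
  unfold status
  have := hor z x
  split_ifs <;> simp_all

set_option maxHeartbeats 2000000 in
theorem exists_step_bound (k : ℕ) (hk : 3 ≤ k) : ∃ ε > 0, ∃ m₀ : ℕ, ∀ l : ℝ, 1 ≤ l → l ≤ 11 / 10 →
    ∀ (x c d : ℕ) (Ω : ℕ → Finset (Fin 3)) (T₀ : ℕ → ℕ → Prop) (O : Finset (Fin x → Fin 3)),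
    m₀ ≤ d → c ≤ x →
    (∀ o ∈ O, ∃ T : ℕ → ℕ → Prop, (∀ u v, T u v → ¬ T v u) ∧ ¬ HasCyc T k ∧ OptOn T (x + 1) ∧
      (∀ u v, T₀ u v ↔ T u v ∧ u < x ∧ v < x) ∧ (∀ y : Fin x, status T y x = o y) ∧
      ∀ y, y < c → d < x - y → NiceWin T ε y x) →
    (∀ o ∈ O, ∀ y : Fin x, c ≤ y → o y ∈ Ω y) →
    ∑ o ∈ O, ∏ y : Fin x, stepFactor l (potential T₀ x y) (o y)
      ≤ 2 * ∏ y : Fin x, 2 * stepBound l c d x Ω y := by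
  have hk0 : (0 : ℝ) < k := by positivity
  set δ : ℝ := 1 / 280 / (8 * k) with hδ
  have hδ0 : 0 < δ := by positivity
  set η : ℝ := δ * -Real.log (17 / 20) with hη
  have hlog : Real.log (17 / 20 : ℝ) < 0 := Real.log_neg (by norm_num) (by norm_num)
  have hη0 : 0 < η := mul_pos hδ0 (by linarith)
  set s : ℝ := min (1 / 2) (η / 4) with hs
  have hs0 : 0 < s := by positivity
  have hs1 : s ≤ 1 / 2 := min_le_left _ _
  have hsη : s ≤ η / 4 := min_le_right _ _
  have hlogs : Real.log s < 0 := Real.log_neg hs0 (by linarith)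
  set h : ℝ := η / (4 * -Real.log s) with hh
  have hh0 : 0 < h := div_pos hη0 (by linarith)
  have hhs : h * -Real.log s = η / 4 := by
    rw [hh, div_mul_eq_mul_div, mul_comm 4, ← div_div, mul_div_assoc, div_self (by linarith), mul_one]
  obtain ⟨m, hm⟩ := exists_sum_exp_le (half_pos hη0)
  set ε : ℝ := min δ (h / (16 * k)) with hε
  have hε0 : 0 < ε := by positivity
  refine ⟨ε, hε0, m + ⌈280 * (8 * k : ℝ)⌉₊ + ⌈16 * k / h⌉₊, fun l hl hl' x c d Ω T₀ O hd hcx hO hΩ => ?_⟩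
  rcases O.eq_empty_or_nonempty with rfl | hne
  · rw [Finset.sum_empty]
    exact mul_nonneg zero_le_two (Finset.prod_nonneg fun y _ =>
      mul_nonneg zero_le_two (stepBound_nonneg hl _ _ _ _ _))
  have hor₀ : ∀ u v, T₀ u v → ¬ T₀ v u := by
    obtain ⟨o, ho⟩ := hne
    obtain ⟨T, h1, -, -, h4, -⟩ := hO o ho
    intro u v huv hvu
    exact h1 u v ((h4 u v).1 huv).1 ((h4 v u).1 hvu).1
  have hopt₀ : OptOn T₀ x := by
    obtain ⟨o, ho⟩ := hne
    obtain ⟨T, -, -, h3, h4, -⟩ := hO o ho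
    exact (h3.mono (Nat.le_succ x)).congr fun u v hu hv => by rw [h4]; tauto
  have hnice₀ : ∀ y, y < c → d < x - y → NiceWin T₀ ε y x := by
    obtain ⟨o, ho⟩ := hne
    obtain ⟨T, -, -, -, h4, -, h6⟩ := hO o ho
    exact fun y hy hyx => (h6 y hy hyx).congr fun u v hu hv huv => (h4 u v).2 ⟨huv, hu, hv⟩
  set far : Fin x → Prop := fun y => potential T₀ x y < 4 ∧ (y : ℕ) < c ∧ d < x - y with hfar
  set opt : Fin x → Finset (Fin 3) := fun y => if (y : ℕ) < c then Finset.univ else Ω y with hopt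
  have hbig : ∀ y : Fin x, far y → 280 * (8 * k : ℝ) ≤ (x - y : ℕ) ∧ 16 * k / h ≤ (x - y : ℕ) ∧
      m < x - y := by
    rintro y ⟨-, -, h3⟩
    refine ⟨(Nat.le_ceil _).trans ?_, (Nat.le_ceil _).trans ?_, by omega⟩
    · exact_mod_cast (by omega : ⌈280 * (8 * k : ℝ)⌉₊ ≤ x - y)
    · exact_mod_cast (by omega : ⌈16 * k / h⌉₊ ≤ x - y)
  have hU := fun y => potential_nonneg T₀ x y
  have hmain := sum_patterns_le (fun y : Fin x => stepFactor l (potential T₀ x y))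
    (fun y j => stepFactor_nonneg hl (hU y) j) O opt far
    (fun y => Finset.univ.filter fun z : Fin x => (y : ℕ) ≤ z ∧ IncPath T₀ (k - 2) y z)
    (fun y => stepBound l c d x Ω y) (fun y => stepBound_nonneg hl _ _ _ _ _)
    (s := s) (β := 17 / 20) (h := h) (δ := δ) (τ := η / 2) hs0 (by linarith) (by norm_num)
    (by norm_num) (by rw [hhs]; have : δ * Real.log (17 / 20) = -η := by { rw [hη]; ring }
                      rw [this]; linarith)
    (by
      intro o ho y
      simp only [hopt]
      split_ifs with hy
      · exact Finset.mem_univ _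
      · exact hΩ o ho y (not_lt.1 hy))
    (by
      intro y hy
      simp only [hopt]
      split_ifs with hyc
      · refine (sum_fin_three_subset_le (stepFactor_nonneg hl (hU y)) _).trans ?_
        by_cases hyd : x - y ≤ d
        · unfold stepBound
          rw [if_pos hyc, ind_true hyd, mul_one, exp_dZero]
          linarith [stepFactor_zero_add_one_le (l := l) (hU y), stepFactor_two_le hl (hU y)]
        · have h4 : 4 ≤ potential T₀ x y := by
            by_contra hc
            exact hy ⟨not_le.1 hc, hyc, not_le.1 hyd⟩
          linarith [stepFactor_sum_le_two hl' h4,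
            one_le_stepBound hl (d := d) (x := x) (Ω := Ω) (Or.inl hyc)]
      · by_cases h0 : Ω y ⊆ {0}
        · linarith [sum_le_of_subset_zero (stepFactor_nonneg hl (hU y)) h0,
            stepFactor_zero_le (l := l) (hU y), stepBound_of_subset hl (d := d) (x := x) hyc h0]
        · by_cases h1 : Ω y = Finset.univ
          · unfold stepBound
            rw [if_neg hyc, ind_false h0, ind_true h1, mul_zero, zero_add, mul_one, exp_dZero]
            have := sum_fin_three_subset_le (stepFactor_nonneg hl (hU y)) (Ω y)
            linarith [stepFactor_zero_add_one_le (l := l) (hU y), stepFactor_two_le hl (hU y)]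
          · unfold stepBound
            rw [if_neg hyc, ind_false h0, ind_false h1, mul_zero, mul_zero, zero_add, Real.exp_zero]
            linarith [sum_stepFactor_le_of_ne hl (hU y) h1])
    (by
      intro y hy
      linarith [sum_filter_ne_two_le (l := l) (hU y),
        one_le_stepBound hl (d := d) (x := x) (Ω := Ω) (Or.inl hy.2.1)])
    (by
      intro y
      by_cases h0 : (y : ℕ) < c ∨ ¬ Ω y ⊆ {0}
      · have h1 := one_le_stepBound hl (d := d) (x := x) h0
        have h2 := sum_penalised_le hl hl' (hU y) hs0.le (opt y)
        nlinarith
      · push Not at h0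
        have h1 := stepBound_of_subset hl (d := d) (x := x) (not_lt.2 h0.1) h0.2
        have h2 := sum_penalised_le_of_subset_zero hl (hU y) hs0.le
          (show opt y ⊆ {0} by simp only [hopt]; rw [if_neg (not_lt.2 h0.1)]; exact h0.2)
        nlinarith)
    (by
      intro y
      by_cases h0 : (y : ℕ) < c ∨ ¬ Ω y ⊆ {0}
      · have h1 := one_le_stepBound hl (d := d) (x := x) h0
        have h2 := sum_penalised_filter_le hl hl' (hU y) hs0.le (opt y)
        have h3 : 0 ≤ (1 + s) * (17 / 20) := by positivity
        nlinarith
      · push Not at h0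
        have h1 := stepBound_of_subset hl (d := d) (x := x) (not_lt.2 h0.1) h0.2
        have h2 := sum_penalised_le_of_subset_zero hl (hU y) hs0.le
          (o := (opt y).filter (· ≠ 1)) ((Finset.filter_subset _ _).trans
          (by simp only [hopt]; rw [if_neg (not_lt.2 h0.1)]; exact h0.2))
        nlinarith)
    (by
      intro y hy
      refine ⟨fun z hz => (Finset.mem_filter.1 hz).2.1, ?_⟩
      rw [card_filter_fin_Ico fun z => IncPath T₀ (k - 2) y z]
      have h1 := (hbig y hy).1
      exact (hnice₀ y hy.2.1 hy.2.2).card_reach_ge hk (by norm_num) (min_le_left _ _)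
        (by linarith) (hopt₀.le_out_of_potential_lt hor₀ y.2 hy.1))
    (by
      intro o ho y hy hoy
      obtain ⟨T, t1, t2, t3, t4, t5, t6⟩ := hO o ho
      have hst : ∀ z : Fin x, o z = 2 ↔ T x z := by
        intro z
        rw [← t5 z]
        exact status_eq_two t1
      have hst1 : ∀ z : Fin x, o z = 1 ↔ T z x := by
        intro z
        rw [← t5 z]
        exact status_eq_one
      refine ⟨?_, fun z hz hoz => ?_⟩
      · have h2 := (hbig y hy).2.1
        rw [div_le_iff₀ hh0] at h2
        have h3 := (t6 y hy.2.1 hy.2.2).card_out_le hk t1 t2 t3 (min_le_right _ _ : ε ≤ h / (16 * k))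
          (by linarith)
        rw [← card_filter_fin_Ico fun z => T x z] at h3
        refine le_trans (le_of_eq ?_) h3
        congr 2
        ext z
        rw [Finset.mem_filter, Finset.mem_filter, hst]
        rfl
      · have hp : IncPath T (k - 2 + 1) y x :=
          ⟨z, (Finset.mem_filter.1 hz).2.2.mono fun u v huv => ((t4 u v).1 huv).1, z.2,
            (hst1 z).1 hoz⟩
        rw [show k - 2 + 1 = k - 1 by omega] at hp
        exact t2 (hasCyc_of_incPath (by omega) hp ((hst y).1 hoy)))
  refine hmain.trans ?_
  rw [mul_comm]
  refine mul_le_mul_of_nonneg_right ?_ (Finset.prod_nonneg fun y _ =>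
      mul_nonneg zero_le_two (stepBound_nonneg hl _ _ _ _ _))
  have hle : ∑ y : Fin x, ind (far y) * Real.exp (-(η / 2) * ((x - y : ℕ) : ℝ)) ≤ 1 := by
    refine le_trans ?_ (hm x)
    rw [← Fin.sum_univ_eq_sum_range
      (fun y => ind (m < x - y) * Real.exp (-(η / 2) * ((x - y : ℕ) : ℝ)))]
    refine Finset.sum_le_sum fun y _ => mul_le_mul_of_nonneg_right ?_ (Real.exp_pos _).le
    exact ind_mono fun hy => (hbig y hy).2.2
  linarith

/-- The arc relation of an arc set. -/
def arcRel (E : Finset (ℕ × ℕ)) (u v : ℕ) : Prop := (u, v) ∈ E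

/-- The arcs inside `{0, …, n - 1}`. -/
noncomputable def restrictTo (n : ℕ) (E : Finset (ℕ × ℕ)) : Finset (ℕ × ℕ) :=
  E.filter fun e => e.1 < n ∧ e.2 < n

/-- The optimally ordered oriented graphs on `{0, …, n - 1}` without directed `k`-cycles. -/
noncomputable def optGraphs (k n : ℕ) : Finset (Finset (ℕ × ℕ)) :=
  (Finset.range n ×ˢ Finset.range n).powerset.filter fun E =>
    (∀ u v, arcRel E u v → ¬ arcRel E v u) ∧ ¬ HasCyc (arcRel E) k ∧ OptOn (arcRel E) n

/-- The number of backward arcs in the natural ordering. -/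
noncomputable def numBack (E : Finset (ℕ × ℕ)) : ℕ := (E.filter fun e => e.2 < e.1).card

/-- The weight of a graph on `{0, …, n - 1}`. -/
noncomputable def weight (l : ℝ) (n : ℕ) (E : Finset (ℕ × ℕ)) : ℝ :=
  l ^ numBack E * ∏ y ∈ Finset.range n, (1 + potential (arcRel E) n y)

lemma weight_nonneg {l : ℝ} (hl : 1 ≤ l) (n : ℕ) (E : Finset (ℕ × ℕ)) : 0 ≤ weight l n E := by
  unfold weight
  refine mul_nonneg (by positivity) (Finset.prod_nonneg fun y _ => ?_)
  have := potential_nonneg (arcRel E) n y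
  linarith

lemma pow_numBack_le_weight {l : ℝ} (hl : 1 ≤ l) (n : ℕ) (E : Finset (ℕ × ℕ)) :
    l ^ numBack E ≤ weight l n E := by
  unfold weight
  refine le_mul_of_one_le_right (by positivity) ?_
  have h1 : ∏ _y ∈ Finset.range n, (1 : ℝ) ≤ ∏ y ∈ Finset.range n, (1 + potential (arcRel E) n y) :=
    Finset.prod_le_prod (fun _ _ => zero_le_one) fun y _ => by
      linarith [potential_nonneg (arcRel E) n y]
  rwa [Finset.prod_const_one] at h1

lemma arcRel_restrictTo {n : ℕ} {E : Finset (ℕ × ℕ)} {u v : ℕ} :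
    arcRel (restrictTo n E) u v ↔ arcRel E u v ∧ u < n ∧ v < n := by
  unfold arcRel restrictTo
  rw [Finset.mem_filter]

lemma potential_succ {T T' : ℕ → ℕ → Prop} {n y : ℕ} (hy : y < n)
    (hT : ∀ u v, u < n → v < n → (T u v ↔ T' u v)) :
    potential T (n + 1) y = potential T' n y *
      (101 / 100 * if T y n ∨ T n y then 1 / 4 else 1) := by
  unfold potential
  rw [show n + 1 - 1 - y = n - 1 - y + 1 by omega, pow_succ]
  have h1 : ((Finset.Ico (y + 1) (n + 1)).filter fun z => T y z ∨ T z y).card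
      = ((Finset.Ico (y + 1) n).filter fun z => T' y z ∨ T' z y).card
        + if T y n ∨ T n y then 1 else 0 := by
    rw [Finset.card_filter, Finset.card_filter, Finset.sum_Ico_succ_top (by omega)]
    congr 1
    refine Finset.sum_congr rfl fun z hz => ?_
    have := Finset.mem_Ico.1 hz
    simp only [hT y z hy this.2, hT z y this.2 hy]
  rw [h1, pow_add]
  split_ifs <;> ring

lemma potential_self (T : ℕ → ℕ → Prop) (n : ℕ) : potential T (n + 1) n = 4 := by
  unfold potential
  simp

lemma numBack_succ {n : ℕ} {E : Finset (ℕ × ℕ)} (hE : ∀ e ∈ E, e.1 < n + 1 ∧ e.2 < n + 1) :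
    numBack E = numBack (restrictTo n E)
      + (Finset.univ.filter fun y : Fin n => arcRel E n y).card := by
  unfold numBack
  have h1 : E.filter (fun e => e.2 < e.1) = (restrictTo n E).filter (fun e => e.2 < e.1) ∪
      (Finset.univ.filter fun y : Fin n => arcRel E n y).map
        (⟨fun y => (n, (y : ℕ)), fun a b h => Fin.ext (Prod.ext_iff.1 h).2⟩ : Fin n ↪ ℕ × ℕ) := by
    ext ⟨u, v⟩
    rw [Finset.mem_union, Finset.mem_filter, Finset.mem_filter, restrictTo, Finset.mem_filter,
      Finset.mem_map]
    constructor
    · rintro ⟨h1, h2⟩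
      have h3 := hE _ h1
      simp only at h2 h3
      by_cases hu : u < n
      · exact Or.inl ⟨⟨h1, hu, by simp only; omega⟩, h2⟩
      · obtain rfl : u = n := by omega
        exact Or.inr ⟨⟨v, h2⟩, Finset.mem_filter.2 ⟨Finset.mem_univ _, h1⟩, rfl⟩
    · rintro (⟨⟨h1, -⟩, h2⟩ | ⟨y, h1, h2⟩)
      · exact ⟨h1, h2⟩
      · obtain ⟨rfl, rfl⟩ : n = u ∧ (y : ℕ) = v := Prod.ext_iff.1 h2
        exact ⟨(Finset.mem_filter.1 h1).2, y.2⟩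
  rw [h1, Finset.card_union_of_disjoint, Finset.card_map]
  rw [Finset.disjoint_left]
  intro e he he'
  obtain ⟨y, -, rfl⟩ := Finset.mem_map.1 he'
  exact lt_irrefl n (Finset.mem_filter.1 (Finset.mem_filter.1 he).1).2.1

lemma weight_succ {l : ℝ} {n : ℕ} {E : Finset (ℕ × ℕ)}
    (hE : ∀ e ∈ E, e.1 < n + 1 ∧ e.2 < n + 1) (hor : ∀ u v, arcRel E u v → ¬ arcRel E v u) :
    weight l (n + 1) E = weight l n (restrictTo n E) * (5 * ∏ y : Fin n,
      stepFactor l (potential (arcRel (restrictTo n E)) n y) (status (arcRel E) y n)) := by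
  unfold weight
  rw [numBack_succ hE, pow_add, Finset.prod_range_succ, potential_self]
  have h1 : l ^ (Finset.univ.filter fun y : Fin n => arcRel E n y).card
      = ∏ y : Fin n, if arcRel E n y then l else 1 := by
    rw [← Finset.prod_const, Finset.prod_filter]
  rw [h1, ← Fin.prod_univ_eq_prod_range (fun y => 1 + potential (arcRel E) (n + 1) y),
    ← Fin.prod_univ_eq_prod_range (fun y => 1 + potential (arcRel (restrictTo n E)) n y)]
  have h2 : (∏ y : Fin n, if arcRel E n y then l else 1) *
      ∏ y : Fin n, (1 + potential (arcRel E) (n + 1) y)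
      = (∏ y : Fin n, (1 + potential (arcRel (restrictTo n E)) n y)) *
        ∏ y : Fin n, stepFactor l (potential (arcRel (restrictTo n E)) n y)
          (status (arcRel E) y n) := by
    rw [← Finset.prod_mul_distrib, ← Finset.prod_mul_distrib]
    refine Finset.prod_congr rfl fun y _ => ?_
    rw [potential_succ (T' := arcRel (restrictTo n E)) y.2
      fun u v hu hv => by rw [arcRel_restrictTo]; tauto]
    have hU := potential_nonneg (arcRel (restrictTo n E)) n y
    set U := potential (arcRel (restrictTo n E)) n y
    have h0 : (1 + U) ≠ 0 := by positivity
    by_cases hf : arcRel E y n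
    · rw [if_neg (hor _ _ hf), if_pos (Or.inl hf), status_eq_one.2 hf, stepFactor_one,
        mul_div_cancel₀ _ h0]
      ring
    · by_cases hb : arcRel E n y
      · rw [if_pos hb, if_pos (Or.inr hb), (status_eq_two hor).2 hb, stepFactor_two,
          mul_left_comm (1 + U) l, mul_div_cancel₀ _ h0]
        ring
      · rw [if_neg hb, if_neg (by tauto), status, if_neg hf, if_neg hb, stepFactor_zero,
          mul_div_cancel₀ _ h0]
        ring
  linear_combination (l ^ numBack (restrictTo n E) * 5) * h2

lemma mem_optGraphs {k n : ℕ} {E : Finset (ℕ × ℕ)} : E ∈ optGraphs k n ↔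
    (∀ e ∈ E, e.1 < n ∧ e.2 < n) ∧ (∀ u v, arcRel E u v → ¬ arcRel E v u) ∧
      ¬ HasCyc (arcRel E) k ∧ OptOn (arcRel E) n := by
  unfold optGraphs
  rw [Finset.mem_filter, Finset.mem_powerset]
  refine and_congr_left fun _ => ?_
  constructor
  · intro h e he
    have := Finset.mem_product.1 (h he)
    exact ⟨Finset.mem_range.1 this.1, Finset.mem_range.1 this.2⟩
  · intro h e he
    exact Finset.mem_product.2 ⟨Finset.mem_range.2 (h e he).1, Finset.mem_range.2 (h e he).2⟩

lemma HasCyc.mono {T T' : ℕ → ℕ → Prop} {k : ℕ} (h : ∀ u v, T u v → T' u v)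
    (hc : HasCyc T k) : HasCyc T' k := by
  obtain ⟨c, h1, h2, h3⟩ := hc
  exact ⟨c, h1, fun i hi => h _ _ (h2 i hi), h _ _ h3⟩

lemma restrictTo_mem_optGraphs {k n n' : ℕ} (hn : n ≤ n') {E : Finset (ℕ × ℕ)}
    (hE : E ∈ optGraphs k n') : restrictTo n E ∈ optGraphs k n := by
  obtain ⟨h1, h2, h3, h4⟩ := mem_optGraphs.1 hE
  refine mem_optGraphs.2 ⟨fun e he => (Finset.mem_filter.1 he).2, fun u v huv hvu => ?_,
    fun hc => h3 (hc.mono fun u v huv => (arcRel_restrictTo.1 huv).1), ?_⟩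
  · exact h2 u v (arcRel_restrictTo.1 huv).1 (arcRel_restrictTo.1 hvu).1
  · exact (h4.mono hn).congr fun u v hu hv => by rw [arcRel_restrictTo]; tauto

/-- The graphs which obey the options `Ω` inside the block of vertices from `c` on, and for which
all windows of length more than `d` that cross the start of the block are nice. -/
noncomputable def blockGraphs (k : ℕ) (ε : ℝ) (c d : ℕ) (Ω : ℕ → ℕ → Finset (Fin 3)) (n : ℕ) :
    Finset (Finset (ℕ × ℕ)) :=
  (optGraphs k n).filter fun E =>
    (∀ z x, z < x → c + x < n → status (arcRel E) (c + z) (c + x) ∈ Ω z x) ∧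
      ∀ y x, y < c → c ≤ x → x < n → d < x - y → NiceWin (arcRel E) ε y x

lemma status_restrictTo {n z x : ℕ} (E : Finset (ℕ × ℕ)) (hz : z < n) (hx : x < n) :
    status (arcRel (restrictTo n E)) z x = status (arcRel E) z x := by
  unfold status
  simp only [arcRel_restrictTo, hz, hx, and_true]

lemma eq_of_restrictTo_eq {n : ℕ} {E E' : Finset (ℕ × ℕ)}
    (hE : ∀ e ∈ E, e.1 < n + 1 ∧ e.2 < n + 1) (hE' : ∀ e ∈ E', e.1 < n + 1 ∧ e.2 < n + 1)
    (hor : ∀ u v, arcRel E u v → ¬ arcRel E v u) (hor' : ∀ u v, arcRel E' u v → ¬ arcRel E' v u)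
    (h : restrictTo n E = restrictTo n E')
    (hs : ∀ y < n, status (arcRel E) y n = status (arcRel E') y n) : E = E' := by
  have key : ∀ {F F' : Finset (ℕ × ℕ)}, (∀ e ∈ F, e.1 < n + 1 ∧ e.2 < n + 1) →
      (∀ u v, arcRel F u v → ¬ arcRel F v u) → (∀ u v, arcRel F' u v → ¬ arcRel F' v u) →
      restrictTo n F = restrictTo n F' →
      (∀ y < n, status (arcRel F) y n = status (arcRel F') y n) → F ⊆ F' := by
    rintro F F' h1 h2 h2' h3 h4 ⟨u, v⟩ he
    have h5 := h1 _ he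
    simp only at h5
    by_cases hu : u < n
    · by_cases hv : v < n
      · have : (u, v) ∈ restrictTo n F := Finset.mem_filter.2 ⟨he, hu, hv⟩
        rw [h3] at this
        exact (Finset.mem_filter.1 this).1
      · obtain rfl : v = n := by omega
        have h6 := status_eq_one.2 (show arcRel F u v from he)
        rw [h4 u hu] at h6
        exact status_eq_one.1 h6
    · obtain rfl : u = n := by omega
      rcases Nat.lt_or_ge v u with hv | hv
      · have h6 := (status_eq_two h2).2 (show arcRel F u v from he)
        rw [h4 v hv] at h6
        exact (status_eq_two h2').1 h6
      · obtain rfl : v = u := by omega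
        exact absurd he (h2 _ _ he)
  exact (key hE hor hor' h hs).antisymm (key hE' hor' hor h.symm fun y hy => (hs y hy).symm)

lemma restrictTo_mem_blockGraphs {k c d n : ℕ} {ε : ℝ} {Ω : ℕ → ℕ → Finset (Fin 3)}
    {E : Finset (ℕ × ℕ)} (hE : E ∈ blockGraphs k ε c d Ω (n + 1)) :
    restrictTo n E ∈ blockGraphs k ε c d Ω n := by
  obtain ⟨h1, h2, h3⟩ := Finset.mem_filter.1 hE
  refine Finset.mem_filter.2 ⟨restrictTo_mem_optGraphs (Nat.le_succ n) h1, fun z x hz hx => ?_,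
    fun y x hy hx hxn hd => ?_⟩
  · rw [status_restrictTo E (by omega) hx]
    exact h2 z x hz (by omega)
  · refine (h3 y x hy hx (by omega) hd).congr fun u v hu hv huv => ?_
    exact arcRel_restrictTo.2 ⟨huv, by omega, by omega⟩

theorem exists_blockGraphs_succ_le (k : ℕ) (hk : 3 ≤ k) : ∃ ε > 0, ∃ m₀ : ℕ, ∀ l : ℝ, 1 ≤ l →
    l ≤ 11 / 10 → ∀ (c d n : ℕ) (Ω : ℕ → ℕ → Finset (Fin 3)), m₀ ≤ d → c ≤ n →
    ∑ E ∈ blockGraphs k ε c d Ω (n + 1), weight l (n + 1) E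
      ≤ (∑ E ∈ blockGraphs k ε c d Ω n, weight l n E) *
        (10 * ∏ y : Fin n, 2 * stepBound l c d n (fun y => Ω (y - c) (n - c)) y) := by
  obtain ⟨ε, hε, m₀, hstep⟩ := exists_step_bound k hk
  refine ⟨ε, hε, m₀, fun l hl hl' c d n Ω hd hcn => ?_⟩
  rw [← Finset.sum_fiberwise_of_maps_to (g := restrictTo n)
    (fun E hE => restrictTo_mem_blockGraphs hE), Finset.sum_mul]
  refine Finset.sum_le_sum fun E₀ hE₀ => ?_
  set S := (blockGraphs k ε c d Ω (n + 1)).filter fun E => restrictTo n E = E₀ with hS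
  have hmem : ∀ E ∈ S, E ∈ optGraphs k (n + 1) ∧ restrictTo n E = E₀ := fun E hE =>
    ⟨(Finset.mem_filter.1 (Finset.mem_filter.1 hE).1).1, (Finset.mem_filter.1 hE).2⟩
  set pat : Finset (ℕ × ℕ) → Fin n → Fin 3 := fun E y => status (arcRel E) y n with hpat
  have hinj : Set.InjOn pat S := by
    intro E hE E' hE' h
    obtain ⟨h1, h2⟩ := hmem E hE
    obtain ⟨h1', h2'⟩ := hmem E' hE'
    obtain ⟨a1, a2, -⟩ := mem_optGraphs.1 h1
    obtain ⟨b1, b2, -⟩ := mem_optGraphs.1 h1'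
    exact eq_of_restrictTo_eq a1 b1 a2 b2 (h2.trans h2'.symm) fun y hy => congrFun h ⟨y, hy⟩
  have hw : ∀ E ∈ S, weight l (n + 1) E = weight l n E₀ * 5 *
      ∏ y : Fin n, stepFactor l (potential (arcRel E₀) n y) (pat E y) := by
    intro E hE
    obtain ⟨h1, h2⟩ := hmem E hE
    obtain ⟨a1, a2, -⟩ := mem_optGraphs.1 h1
    rw [weight_succ a1 a2, h2, mul_assoc]
  rw [Finset.sum_congr rfl hw, ← Finset.mul_sum,
    ← Finset.sum_image (f := fun o => ∏ y : Fin n, stepFactor l (potential (arcRel E₀) n y) (o y))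
      hinj]
  have h0 := weight_nonneg hl n E₀
  have hmain := hstep l hl hl' n c d (fun y => Ω (y - c) (n - c)) (arcRel E₀) (S.image pat) hd hcn
    (by
      intro o ho
      obtain ⟨E, hE, rfl⟩ := Finset.mem_image.1 ho
      obtain ⟨h1, h2⟩ := hmem E hE
      obtain ⟨a1, a2, a3, a4⟩ := mem_optGraphs.1 h1
      refine ⟨arcRel E, a2, a3, a4, fun u v => by rw [← h2, arcRel_restrictTo], fun y => rfl, ?_⟩
      intro y hy hyd
      exact (Finset.mem_filter.1 (Finset.mem_filter.1 hE).1).2.2 y n hy hcn (Nat.lt_succ_self n) hyd)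
    (by
      intro o ho y hy
      obtain ⟨E, hE, rfl⟩ := Finset.mem_image.1 ho
      have h3 := (Finset.mem_filter.1 (Finset.mem_filter.1 hE).1).2.1 (y - c) (n - c)
        (by have := y.2; omega) (by omega)
      rwa [Nat.add_sub_cancel' hy, Nat.add_sub_cancel' hcn] at h3)
  calc _ ≤ weight l n E₀ * 5 *
        (2 * ∏ y : Fin n, 2 * stepBound l c d n (fun y => Ω (y - c) (n - c)) y) :=
        mul_le_mul_of_nonneg_left hmain (by positivity)
    _ = _ := by ring

/-- The total weight of the optimally ordered graphs, normalised by the number of graphs with only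
forward arcs. -/
noncomputable def totalWeight (l : ℝ) (k n : ℕ) : ℝ :=
  (∑ E ∈ optGraphs k n, weight l n E) / 2 ^ (∑ x ∈ Finset.range n, x)

lemma totalWeight_nonneg {l : ℝ} (hl : 1 ≤ l) (k n : ℕ) : 0 ≤ totalWeight l k n :=
  div_nonneg (Finset.sum_nonneg fun E _ => weight_nonneg hl n E) (by positivity)

lemma sum_ind_near_le (c d i : ℕ) :
    ∑ y ∈ Finset.range c, ind (c + i - y ≤ d) ≤ if i < d then (d : ℝ) else 0 := by
  have h1 : ∑ y ∈ Finset.range c, ind (c + i - y ≤ d)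
      = ((Finset.range c).filter fun y => c + i - y ≤ d).card := by
    rw [Finset.card_filter]
    push_cast
    exact Finset.sum_congr rfl fun y _ => by unfold ind; congr
  rw [h1]
  split_ifs with h
  · norm_cast
    refine (Finset.card_le_card (t := Finset.Ico (c - d) c) fun y hy => ?_).trans ?_
    · obtain ⟨h1, h2⟩ := Finset.mem_filter.1 hy
      have := Finset.mem_range.1 h1
      exact Finset.mem_Ico.2 ⟨by omega, this⟩
    · rw [Nat.card_Ico]; omega
  · rw [Finset.filter_eq_empty_iff.2]
    · simp
    · intro y hy
      have := Finset.mem_range.1 hy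
      omega

lemma prod_stepBound_le {l : ℝ} (hl : 1 ≤ l) (c d i : ℕ) (Ω : ℕ → ℕ → Finset (Fin 3)) :
    ∏ y : Fin (c + i), 2 * stepBound l c d (c + i) (fun y => Ω (y - c) (c + i - c)) y
      ≤ 2 ^ (c + i) * ((1 + l) / 2) ^ i * Real.exp (dZero * (if i < d then (d : ℝ) else 0) +
        ∑ z ∈ Finset.range i,
          (-bZero * ind (Ω z i ⊆ {0}) + dZero * ind (Ω z i = Finset.univ))) := by
  rw [Fin.prod_univ_eq_prod_range
    (fun y => 2 * stepBound l c d (c + i) (fun y => Ω (y - c) (c + i - c)) y) (c + i),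
    Finset.prod_mul_distrib, Finset.prod_const, Finset.card_range, Finset.prod_range_add]
  have h1 : ∏ y ∈ Finset.range c, stepBound l c d (c + i) (fun y => Ω (y - c) (c + i - c)) y
      = Real.exp (dZero * ∑ y ∈ Finset.range c, ind (c + i - y ≤ d)) := by
    rw [Finset.mul_sum, Real.exp_sum]
    refine Finset.prod_congr rfl fun y hy => ?_
    unfold stepBound
    rw [if_pos (Finset.mem_range.1 hy)]
  have h2 : ∏ z ∈ Finset.range i, stepBound l c d (c + i) (fun y => Ω (y - c) (c + i - c)) (c + z)
      = ((1 + l) / 2) ^ i * Real.exp (∑ z ∈ Finset.range i,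
          (-bZero * ind (Ω z i ⊆ {0}) + dZero * ind (Ω z i = Finset.univ))) := by
    have h3 : ((1 + l) / 2) ^ i = ∏ _z ∈ Finset.range i, (1 + l) / 2 := by
      rw [Finset.prod_const, Finset.card_range]
    rw [Real.exp_sum, h3, ← Finset.prod_mul_distrib]
    refine Finset.prod_congr rfl fun z _ => ?_
    unfold stepBound
    simp only [if_neg (show ¬ c + z < c by omega), Nat.add_sub_cancel_left]
  rw [h1, h2, mul_assoc (2 ^ (c + i)), mul_left_comm (Real.exp _), Real.exp_add]
  refine mul_le_mul_of_nonneg_left (mul_le_mul_of_nonneg_left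
    (mul_le_mul_of_nonneg_right ?_ (Real.exp_pos _).le) (by positivity)) (by positivity)
  exact Real.exp_le_exp.2 (mul_le_mul_of_nonneg_left (sum_ind_near_le c d i) dZero_nonneg)

lemma sum_range_near_le (p d : ℕ) :
    ∑ i ∈ Finset.range p, (if i < d then (d : ℝ) else 0) ≤ (d : ℝ) ^ 2 := by
  rw [← Finset.sum_filter, Finset.sum_const, nsmul_eq_mul, sq]
  refine mul_le_mul_of_nonneg_right ?_ (Nat.cast_nonneg _)
  have : ((Finset.range p).filter (· < d)).card ≤ (Finset.range d).card :=
    Finset.card_le_card fun i hi => Finset.mem_range.2 (Finset.mem_filter.1 hi).2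
  rw [Finset.card_range] at this
  exact_mod_cast this

lemma prod_prod_stepBound_le {l : ℝ} (hl : 1 ≤ l) (c d p : ℕ) (Ω : ℕ → ℕ → Finset (Fin 3)) :
    ∏ i ∈ Finset.range p, (10 * ∏ y : Fin (c + i),
        2 * stepBound l c d (c + i) (fun y => Ω (y - c) (c + i - c)) y)
      ≤ 2 ^ (∑ i ∈ Finset.range p, (c + i)) * (10 ^ p * ((1 + l) / 2) ^ (p ^ 2) *
        Real.exp (dZero * (d : ℝ) ^ 2 + (-bZero * nullPairs p Ω + dZero * fullPairs p Ω))) := by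
  calc _ ≤ ∏ i ∈ Finset.range p, (10 * (2 ^ (c + i) * ((1 + l) / 2) ^ i *
          Real.exp (dZero * (if i < d then (d : ℝ) else 0) + ∑ z ∈ Finset.range i,
          (-bZero * ind (Ω z i ⊆ {0}) + dZero * ind (Ω z i = Finset.univ))))) := by
        refine Finset.prod_le_prod (fun i _ => ?_) fun i _ => ?_
        · exact mul_nonneg (by norm_num) (Finset.prod_nonneg fun y _ =>
            mul_nonneg zero_le_two (stepBound_nonneg hl _ _ _ _ _))
        · exact mul_le_mul_of_nonneg_left (prod_stepBound_le hl c d i Ω) (by norm_num)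
    _ = 2 ^ (∑ i ∈ Finset.range p, (c + i)) * (10 ^ p * ((1 + l) / 2) ^ (∑ i ∈ Finset.range p, i) *
        Real.exp (dZero * ∑ i ∈ Finset.range p, (if i < d then (d : ℝ) else 0) +
          (-bZero * nullPairs p Ω + dZero * fullPairs p Ω))) := by
        rw [Finset.prod_mul_distrib, Finset.prod_mul_distrib, Finset.prod_mul_distrib,
          Finset.prod_const, Finset.card_range, Finset.prod_pow_eq_pow_sum,
          Finset.prod_pow_eq_pow_sum, ← Real.exp_sum]
        have : ∑ i ∈ Finset.range p, ∑ z ∈ Finset.range i,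
            (-bZero * ind (Ω z i ⊆ {0}) + dZero * ind (Ω z i = Finset.univ))
            = -bZero * nullPairs p Ω + dZero * fullPairs p Ω := by
          unfold nullPairs fullPairs pairSum
          simp only [Finset.sum_add_distrib, ← Finset.mul_sum]
        rw [← this, Finset.mul_sum, ← Finset.sum_add_distrib]
        ring
    _ ≤ _ := by
        refine mul_le_mul_of_nonneg_left (mul_le_mul (mul_le_mul_of_nonneg_left ?_ (by positivity))
          (Real.exp_le_exp.2 ?_) (Real.exp_pos _).le (by positivity)) (by positivity)
        · refine pow_le_pow_right₀ (by linarith) ?_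
          calc ∑ i ∈ Finset.range p, i ≤ ∑ i ∈ Finset.range p, p :=
                Finset.sum_le_sum fun i hi => (Finset.mem_range.1 hi).le
            _ = p ^ 2 := by rw [Finset.sum_const, Finset.card_range, smul_eq_mul, sq]
        · have := mul_le_mul_of_nonneg_left (sum_range_near_le p d) dZero_nonneg
          linarith

theorem exists_sum_blockGraphs_le (k : ℕ) (hk : 3 ≤ k) : ∃ ε > 0, ∃ m₀ : ℕ, ∀ l : ℝ, 1 ≤ l →
    l ≤ 11 / 10 → ∀ (c d p : ℕ) (Ω : ℕ → ℕ → Finset (Fin 3)), m₀ ≤ d →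
    (∑ E ∈ blockGraphs k ε c d Ω (c + p), weight l (c + p) E) /
        2 ^ (∑ x ∈ Finset.range (c + p), x)
      ≤ totalWeight l k c * (10 ^ p * ((1 + l) / 2) ^ (p ^ 2) *
        Real.exp (dZero * (d : ℝ) ^ 2 + (-bZero * nullPairs p Ω + dZero * fullPairs p Ω))) := by
  obtain ⟨ε, hε, m₀, hstep⟩ := exists_blockGraphs_succ_le k hk
  refine ⟨ε, hε, m₀, fun l hl hl' c d p Ω hd => ?_⟩
  have key : ∑ E ∈ blockGraphs k ε c d Ω (c + p), weight l (c + p) E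
      ≤ (∑ E ∈ optGraphs k c, weight l c E) * ∏ i ∈ Finset.range p, (10 * ∏ y : Fin (c + i),
        2 * stepBound l c d (c + i) (fun y => Ω (y - c) (c + i - c)) y) := by
    induction p with
    | zero =>
      rw [Finset.prod_range_zero, mul_one, add_zero]
      exact Finset.sum_le_sum_of_subset_of_nonneg (Finset.filter_subset _ _)
        fun E _ _ => weight_nonneg hl c E
    | succ p ih =>
      rw [Finset.prod_range_succ, ← mul_assoc, ← add_assoc]
      refine (hstep l hl hl' c d (c + p) Ω hd (Nat.le_add_right c p)).trans ?_
      refine mul_le_mul_of_nonneg_right ih ?_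
      exact mul_nonneg (by norm_num) (Finset.prod_nonneg fun y _ =>
        mul_nonneg zero_le_two (stepBound_nonneg hl _ _ _ _ _))
  rw [div_le_iff₀ (by positivity)]
  refine key.trans ?_
  have h0 : 0 ≤ ∑ E ∈ optGraphs k c, weight l c E :=
    Finset.sum_nonneg fun E _ => weight_nonneg hl c E
  refine (mul_le_mul_of_nonneg_left (prod_prod_stepBound_le hl c d p Ω) h0).trans (le_of_eq ?_)
  unfold totalWeight
  rw [Finset.sum_range_add, pow_add, div_mul_eq_mul_div, div_mul_eq_mul_div, eq_div_iff (by positivity)]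
  ring

lemma exists_disjoint_subfamily (S : Finset (ℕ × ℕ)) : ∃ W ⊆ S,
    (∀ I ∈ W, ∀ J ∈ W, I ≠ J → I.2 ≤ J.1 ∨ J.2 ≤ I.1) ∧
      ∀ I ∈ S, I.1 < I.2 → ∃ J ∈ W, I.2 - I.1 ≤ J.2 - J.1 ∧ I.1 < J.2 ∧ J.1 < I.2 := by
  induction S using Finset.strongInduction with
  | H S ih =>
    rcases S.eq_empty_or_nonempty with rfl | hne
    · exact ⟨∅, le_rfl, by simp, by simp⟩
    obtain ⟨J, hJ, hmax⟩ := S.exists_max_image (fun I => I.2 - I.1) hne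
    by_cases hJJ : J.1 < J.2
    · obtain ⟨W, hW1, hW2, hW3⟩ := ih (S.filter fun I => I.2 ≤ J.1 ∨ J.2 ≤ I.1)
        (Finset.filter_ssubset.2 ⟨J, hJ, by omega⟩)
      refine ⟨insert J W, ?_, ?_, ?_⟩
      · exact Finset.insert_subset hJ (hW1.trans (Finset.filter_subset _ _))
      · intro I hI K hK hIK
        rcases Finset.mem_insert.1 hI with h1 | h1 <;> rcases Finset.mem_insert.1 hK with h2 | h2
        · exact absurd (h1.trans h2.symm) hIK
        · rw [h1]
          exact (Finset.mem_filter.1 (hW1 h2)).2.symm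
        · rw [h2]
          exact (Finset.mem_filter.1 (hW1 h1)).2
        · exact hW2 I h1 K h2 hIK
      · intro I hI hII
        by_cases h : I.2 ≤ J.1 ∨ J.2 ≤ I.1
        · obtain ⟨K, hK, h'⟩ := hW3 I (Finset.mem_filter.2 ⟨hI, h⟩) hII
          exact ⟨K, Finset.mem_insert_of_mem hK, h'⟩
        · exact ⟨J, Finset.mem_insert_self _ _, hmax I hI, by omega, by omega⟩
    · refine ⟨∅, Finset.empty_subset _, by simp, fun I hI hII => ?_⟩
      have := hmax I hI
      omega

/-- A disjoint subfamily of windows hitting every point of `[a, b]` has large total length. -/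
lemma exists_disjoint_windows {q : ℕ → ℕ → Prop} {a b : ℕ}
    (h : ∀ c, a ≤ c → c ≤ b → ∃ y x, y < c ∧ c ≤ x ∧ q y x) : ∃ W : Finset (ℕ × ℕ),
    (∀ I ∈ W, ∀ J ∈ W, I ≠ J → I.2 ≤ J.1 ∨ J.2 ≤ I.1) ∧
      (∀ I ∈ W, I.1 < I.2 ∧ q I.1 I.2 ∧ ∃ c, a ≤ c ∧ c ≤ b ∧ I.1 < c ∧ c ≤ I.2) ∧
      b - a ≤ 3 * ∑ I ∈ W, (I.2 - I.1) := by
  choose! y x h1 h2 h3 using h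
  obtain ⟨W, hW1, hW2, hW3⟩ := exists_disjoint_subfamily ((Finset.Icc a b).image fun c => (y c, x c))
  refine ⟨W, hW2, fun I hI => ?_, ?_⟩
  · obtain ⟨c, hc, rfl⟩ := Finset.mem_image.1 (hW1 hI)
    obtain ⟨ha, hb⟩ := Finset.mem_Icc.1 hc
    have e1 := h1 c ha hb
    have e2 := h2 c ha hb
    exact ⟨by simp only; omega, h3 c ha hb, c, ha, hb, e1, e2⟩
  · have hcov : Finset.Icc a b ⊆ W.biUnion fun J =>
        Finset.Ico (J.1 - (J.2 - J.1)) (J.2 + (J.2 - J.1)) := by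
      intro c hc
      obtain ⟨ha, hb⟩ := Finset.mem_Icc.1 hc
      have e1 := h1 c ha hb
      have e2 := h2 c ha hb
      obtain ⟨J, hJ, j1, j2, j3⟩ := hW3 (y c, x c) (Finset.mem_image.2 ⟨c, hc, rfl⟩)
        (by simp only; omega)
      simp only at j1 j2 j3
      exact Finset.mem_biUnion.2 ⟨J, hJ, Finset.mem_Ico.2 ⟨by omega, by omega⟩⟩
    have hcard := (Finset.card_le_card hcov).trans Finset.card_biUnion_le
    rw [Nat.card_Icc] at hcard
    have : ∑ J ∈ W, (Finset.Ico (J.1 - (J.2 - J.1)) (J.2 + (J.2 - J.1))).card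
        ≤ 3 * ∑ I ∈ W, (I.2 - I.1) := by
      rw [Finset.mul_sum]
      refine Finset.sum_le_sum fun J _ => ?_
      rw [Nat.card_Ico]
      omega
    omega

/-- A family of disjoint failing windows, each of length at least `m`, among the last `p` of the
`n` vertices, with large sum of squared lengths. -/
def HasFam (fail : ℕ → ℕ → Prop) (σ : ℝ) (m n p : ℕ) : Prop :=
  ∃ W : Finset (ℕ × ℕ), (∀ I ∈ W, ∀ J ∈ W, I ≠ J → I.2 ≤ J.1 ∨ J.2 ≤ I.1) ∧
    (∀ I ∈ W, n - p ≤ I.1 ∧ I.1 < I.2 ∧ I.2 ≤ n ∧ m ≤ I.2 - I.1 ∧ fail I.1 I.2) ∧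
    σ * (p : ℝ) ^ 2 ≤ ∑ I ∈ W, ((I.2 - I.1 : ℕ) : ℝ) ^ 2

lemma HasFam.of_window {fail : ℕ → ℕ → Prop} {σ : ℝ} {m n y x : ℕ} (hyx : y < x) (hx : x ≤ n)
    (hm : m ≤ x - y) (hf : fail y x) (hσ : σ * ((n - y : ℕ) : ℝ) ^ 2 ≤ ((x - y : ℕ) : ℝ) ^ 2) :
    HasFam fail σ m n (n - y) := by
  refine ⟨{(y, x)}, ?_, ?_, by simpa using hσ⟩
  · intro I hI J hJ hIJ
    rw [Finset.mem_singleton] at hI hJ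
    exact absurd (hI.trans hJ.symm) hIJ
  · intro I hI
    rw [Finset.mem_singleton] at hI
    subst hI
    exact ⟨by simp only; omega, hyx, hx, hm, hf⟩

theorem exists_block (fail : ℕ → ℕ → Prop) {σ : ℝ} (hσ : 0 < σ) (hσ' : σ ≤ 1 / 9) {m n : ℕ}
    (hm : 1 ≤ m) (hn : 1 ≤ n) : ∃ p, 1 ≤ p ∧ p ≤ n ∧
      (∀ y x, y < n - p → n - p ≤ x → x < n → ⌈27 * σ * p⌉₊ + m < x - y → ¬ fail y x) ∧
      (p = 1 ∨ m ≤ p ∧ HasFam fail (σ / 4) m n p) := by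
  set P : ℕ → Prop := fun p => HasFam fail σ m n p with hP
  have hP0 : P 0 := ⟨∅, by simp, by simp, by simp⟩
  set q := Nat.findGreatest P n with hq
  have hqn : q ≤ n := Nat.findGreatest_le n
  have hPq : P q := Nat.findGreatest_spec (Nat.zero_le n) hP0
  have hmax : ∀ p, q < p → p ≤ n → ¬ P p := fun p h1 h2 => Nat.findGreatest_is_greatest h1 h2
  rcases Nat.eq_zero_or_pos q with hq0 | hq0
  · refine ⟨1, le_rfl, hn, fun y x hy hx hxn hd hf => ?_, Or.inl rfl⟩
    obtain rfl : x = n - 1 := by omega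
    refine hmax (n - y) (by omega) (by omega) (HasFam.of_window (by omega) (by omega) (by omega) hf ?_)
    have h1 : n - y = (n - 1 - y) + 1 := by omega
    have h2 : (1 : ℝ) ≤ ((n - 1 - y : ℕ) : ℝ) := by exact_mod_cast (by omega : 1 ≤ n - 1 - y)
    rw [h1]
    push_cast
    nlinarith
  obtain ⟨W, hW1, hW2, hW3⟩ := hPq
  have hqR : (1 : ℝ) ≤ q := by exact_mod_cast hq0
  have hmq : m ≤ q := by
    have hne : W.Nonempty := by
      by_contra hne
      rw [Finset.not_nonempty_iff_eq_empty] at hne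
      rw [hne, Finset.sum_empty] at hW3
      have : 0 < σ * (q : ℝ) ^ 2 := by positivity
      linarith
    obtain ⟨I, hI⟩ := hne
    have := hW2 I hI
    omega
  have hfam : ∀ p, q ≤ p → p ≤ 2 * q → HasFam fail (σ / 4) m n p := by
    intro p h1 h2
    refine ⟨W, hW1, fun I hI => ?_, le_trans ?_ hW3⟩
    · have := hW2 I hI
      exact ⟨by omega, this.2⟩
    · have : (p : ℝ) ≤ 2 * q := by exact_mod_cast h2
      have h3 : (p : ℝ) ^ 2 ≤ (2 * q) ^ 2 := pow_le_pow_left₀ (Nat.cast_nonneg _) this 2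
      nlinarith
  by_cases h2q : n < 2 * q
  · exact ⟨n, hn, le_rfl, fun y x hy => by omega, Or.inr ⟨by omega, hfam n hqn h2q.le⟩⟩
  push Not at h2q
  by_contra hcon
  push Not at hcon
  have hex : ∀ c, n - 2 * q ≤ c → c ≤ n - q →
      ∃ y x, y < c ∧ c ≤ x ∧ (x < n ∧ ⌈27 * σ * q⌉₊ + m < x - y ∧ fail y x) := by
    intro c h1 h2
    by_contra hno
    push Not at hno
    refine (hcon (n - c) (by omega) (by omega) ?_).2 (by omega)
      (hfam (n - c) (by omega) (by omega))
    intro y x hy hx hxn hd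
    rw [show n - (n - c) = c by omega] at hy hx
    refine hno y x hy hx hxn (lt_of_le_of_lt (Nat.add_le_add_right (Nat.ceil_mono ?_) m) hd)
    refine mul_le_mul_of_nonneg_left ?_ (by positivity)
    exact_mod_cast (by omega : q ≤ n - c)
  obtain ⟨V, hV1, hV2, hV3⟩ := exists_disjoint_windows hex
  have hlen : ∀ I ∈ V, n - min (3 * q) n ≤ I.1 := by
    intro I hI
    obtain ⟨h1, ⟨h2, h3, h4⟩, c, h5, h6, h7, h8⟩ := hV2 I hI
    by_contra hlt
    refine hmax (n - I.1) (by omega) (by omega) (HasFam.of_window h1 h2.le (by omega) h4 ?_)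
    have h9 : n - I.1 ≤ 3 * (I.2 - I.1) := by omega
    have h10 : ((n - I.1 : ℕ) : ℝ) ≤ 3 * ((I.2 - I.1 : ℕ) : ℝ) := by exact_mod_cast h9
    have h11 := pow_le_pow_left₀ (Nat.cast_nonneg _) h10 2
    have h12 := sq_nonneg ((I.2 - I.1 : ℕ) : ℝ)
    have h13 := mul_le_mul hσ' h11 (by positivity) (by norm_num)
    linarith
  refine hmax (min (3 * q) n) (by omega) (min_le_right _ _) ⟨V, hV1, fun I hI => ?_, ?_⟩
  · obtain ⟨h1, ⟨h2, h3, h4⟩, -⟩ := hV2 I hI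
    exact ⟨hlen I hI, h1, h2.le, by omega, h4⟩
  · have h1 : ∀ I ∈ V, 27 * σ * q * ((I.2 - I.1 : ℕ) : ℝ) ≤ ((I.2 - I.1 : ℕ) : ℝ) ^ 2 := by
      intro I hI
      obtain ⟨h1, ⟨h2, h3, h4⟩, -⟩ := hV2 I hI
      have h5 : 27 * σ * q ≤ ((I.2 - I.1 : ℕ) : ℝ) :=
        (Nat.le_ceil _).trans (by exact_mod_cast (by omega : ⌈27 * σ * q⌉₊ ≤ I.2 - I.1))
      rw [sq]
      exact mul_le_mul_of_nonneg_right h5 (Nat.cast_nonneg _)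
    refine le_trans ?_ (Finset.sum_le_sum h1)
    rw [← Finset.mul_sum, ← Nat.cast_sum]
    have h2 : q ≤ 3 * ∑ I ∈ V, (I.2 - I.1) := by omega
    have h3 : (q : ℝ) ≤ 3 * ((∑ I ∈ V, (I.2 - I.1) : ℕ) : ℝ) := by exact_mod_cast h2
    have h4 : ((min (3 * q) n : ℕ) : ℝ) ≤ 3 * q := by exact_mod_cast min_le_left (3 * q) n
    have h5 := pow_le_pow_left₀ (Nat.cast_nonneg _) h4 2
    have h6 : 0 < σ * q := by positivity
    nlinarith

lemma sum_le_sum_of_cover {α ι : Type*} {S : Finset α} {F : Finset ι} {t : ι → Finset α}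
    {w : α → ℝ} (hw : ∀ E, 0 ≤ w E) (h : ∀ E ∈ S, ∃ i ∈ F, E ∈ t i) :
    ∑ E ∈ S, w E ≤ ∑ i ∈ F, ∑ E ∈ t i, w E := by
  have h1 : ∀ i ∈ F, ∑ E ∈ S, (if E ∈ t i then w E else 0) ≤ ∑ E ∈ t i, w E := by
    intro i _
    rw [← Finset.sum_filter]
    exact Finset.sum_le_sum_of_subset_of_nonneg (fun E hE => (Finset.mem_filter.1 hE).2)
      fun E _ _ => hw E
  refine le_trans ?_ (Finset.sum_le_sum h1)
  rw [Finset.sum_comm]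
  refine Finset.sum_le_sum fun E hE => ?_
  obtain ⟨i, hi, hEi⟩ := h E hE
  refine le_trans (le_of_eq (if_pos hEi).symm)
    (Finset.single_le_sum (f := fun i => if E ∈ t i then w E else 0) (fun j _ => ?_) hi)
  split_ifs
  · exact hw E
  · exact le_rfl

lemma OptOn.shift {T : ℕ → ℕ → Prop} {c p : ℕ} (h : OptOn T (c + p)) :
    OptOn (fun u v => T (c + u) (c + v)) p := by
  intro a b hb ρ
  have := h (a + c) (b + c) (by omega) fun u => ρ (u - c)
  simp only [← Finset.sum_Ico_add, Nat.add_sub_cancel_left, add_lt_add_iff_left] at this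
  exact this

lemma NiceWin.of_shift {T : ℕ → ℕ → Prop} {ε : ℝ} {c a b : ℕ}
    (h : NiceWin (fun u v => T (c + u) (c + v)) ε a b) : NiceWin T ε (c + a) (c + b) := by
  intro X Y hX hY hXY hXc hYc
  have hcard : ∀ Z ⊆ Finset.Ico (c + a) (c + b),
      (Z.image (· - c)).card = Z.card ∧ Z.image (· - c) ⊆ Finset.Ico a b := by
    intro Z hZ
    refine ⟨Finset.card_image_of_injOn fun x hx y hy hxy => ?_, fun x hx => ?_⟩
    · have h1 := Finset.mem_Ico.1 (hZ hx)
      have h2 := Finset.mem_Ico.1 (hZ hy)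
      omega
    · obtain ⟨y, hy, rfl⟩ := Finset.mem_image.1 hx
      have := Finset.mem_Ico.1 (hZ hy)
      exact Finset.mem_Ico.2 ⟨by omega, by omega⟩
  rw [Nat.add_sub_add_left] at hXc hYc
  obtain ⟨x, hx, y, hy, hT⟩ := h (X.image (· - c)) (Y.image (· - c)) (hcard X hX).2 (hcard Y hY).2
    (fun x hx y hy => by
      obtain ⟨x, hx', rfl⟩ := Finset.mem_image.1 hx
      obtain ⟨y, hy', rfl⟩ := Finset.mem_image.1 hy
      have h1 := Finset.mem_Ico.1 (hX hx')
      have h2 := Finset.mem_Ico.1 (hY hy')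
      have h3 := hXY x hx' y hy'
      omega) (by rwa [(hcard X hX).1]) (by rwa [(hcard Y hY).1])
  obtain ⟨x, hx', rfl⟩ := Finset.mem_image.1 hx
  obtain ⟨y, hy', rfl⟩ := Finset.mem_image.1 hy
  have h1 := Finset.mem_Ico.1 (hX hx')
  have h2 := Finset.mem_Ico.1 (hY hy')
  rw [show c + (x - c) = x by omega, show c + (y - c) = y by omega] at hT
  exact ⟨x, hx', y, hy', hT⟩

lemma HasFam.exists_winFam {T : ℕ → ℕ → Prop} {ε σ : ℝ} {m c p : ℕ}
    (h : HasFam (fun a b => ¬ NiceWin T ε a b) σ m (c + p) p) : ∃ W, WinFam p W ∧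
      (∀ I ∈ W, ¬ NiceWin (fun u v => T (c + u) (c + v)) ε I.1 I.2) ∧
      σ * (p : ℝ) ^ 2 ≤ ∑ I ∈ W, ((I.2 - I.1 : ℕ) : ℝ) ^ 2 := by
  obtain ⟨W, h1, h2, h3⟩ := h
  refine ⟨W.image fun I => (I.1 - c, I.2 - c), ⟨fun I hI => ?_, fun I hI J hJ hIJ => ?_⟩,
    fun I hI hn => ?_, ?_⟩
  · obtain ⟨I, hI', rfl⟩ := Finset.mem_image.1 hI
    have := h2 I hI'
    exact ⟨by simp only; omega, by simp only; omega⟩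
  · obtain ⟨I, hI', rfl⟩ := Finset.mem_image.1 hI
    obtain ⟨J, hJ', rfl⟩ := Finset.mem_image.1 hJ
    have h4 := h2 I hI'
    have h5 := h2 J hJ'
    have h6 := h1 I hI' J hJ' fun h => hIJ (by rw [h])
    simp only
    omega
  · obtain ⟨I, hI', rfl⟩ := Finset.mem_image.1 hI
    have h4 := h2 I hI'
    have h5 := hn.of_shift
    simp only at h5
    rw [show c + (I.1 - c) = I.1 by omega, show c + (I.2 - c) = I.2 by omega] at h5
    exact h4.2.2.2.2 h5
  · rw [Finset.sum_image]
    · refine h3.trans (le_of_eq (Finset.sum_congr rfl fun I hI => ?_))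
      have h4 := h2 I hI
      rw [show I.2 - c - (I.1 - c) = I.2 - I.1 by omega]
    · intro I hI J hJ hIJ
      have h4 := h2 I hI
      have h5 := h2 J hJ
      have h6 := Prod.ext_iff.1 hIJ
      simp only at h6
      exact Prod.ext (by omega) (by omega)

lemma exists_le_pow_of_rec {z : ℕ → ℝ} {K : ℝ} (hK : 0 ≤ K) (h0 : z 0 ≤ 1)
    (h : ∀ n, 1 ≤ n → z n ≤ ∑ p ∈ Finset.Icc 1 n, z (n - p) * (K * 10 ^ p)) (n : ℕ) :
    z n ≤ (10 * (K + 1)) ^ n := by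
  have key : ∀ n : ℕ, ∑ p ∈ Finset.Icc 1 n, (10 * (K + 1)) ^ (n - p) * (K * 10 ^ p) + 10 ^ n
      ≤ (10 * (K + 1)) ^ n := by
    intro n
    induction n with
    | zero => simp
    | succ n ih =>
      rw [Finset.sum_Icc_succ_top (by omega)]
      have h1 : ∑ p ∈ Finset.Icc 1 n, (10 * (K + 1)) ^ (n + 1 - p) * (K * 10 ^ p)
          = (10 * (K + 1)) * ∑ p ∈ Finset.Icc 1 n, (10 * (K + 1)) ^ (n - p) * (K * 10 ^ p) := by
        rw [Finset.mul_sum]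
        refine Finset.sum_congr rfl fun p hp => ?_
        have := Finset.mem_Icc.1 hp
        rw [show n + 1 - p = n - p + 1 by omega, pow_succ]
        ring
      rw [h1, Nat.sub_self, pow_zero, pow_succ, pow_succ]
      have := mul_le_mul_of_nonneg_left ih (by positivity : 0 ≤ 10 * (K + 1))
      linarith
  induction n using Nat.strong_induction_on with
  | _ n ih =>
    rcases Nat.eq_zero_or_pos n with rfl | hn
    · simpa using h0
    · refine (h n hn).trans (le_trans (Finset.sum_le_sum fun p hp => ?_)
        ((le_add_of_nonneg_right (by positivity)).trans (key n)))
      have := Finset.mem_Icc.1 hp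
      exact mul_le_mul_of_nonneg_right (ih _ (by omega)) (by positivity)

/-- The graphs whose last `p` vertices form a block in the sense of `exists_block`. -/
noncomputable def lastBlock (k : ℕ) (ε σ : ℝ) (m d c p : ℕ) : Finset (Finset (ℕ × ℕ)) :=
  (optGraphs k (c + p)).filter fun E =>
    (∀ y x, y < c → c ≤ x → x < c + p → d < x - y → NiceWin (arcRel E) ε y x) ∧
      (p = 1 ∨ m ≤ p ∧ HasFam (fun a b => ¬ NiceWin (arcRel E) ε a b) σ m (c + p) p)

lemma nullPairs_one (Ω : ℕ → ℕ → Finset (Fin 3)) : nullPairs 1 Ω = 0 := by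
  simp [nullPairs, pairSum]

lemma fullPairs_one (Ω : ℕ → ℕ → Finset (Fin 3)) : fullPairs 1 Ω = 0 := by
  simp [fullPairs, pairSum]

lemma totalWeight_zero_le (l : ℝ) (k : ℕ) : totalWeight l k 0 ≤ 1 := by
  have h : optGraphs k 0 ⊆ {∅} := by
    intro E hE
    rw [Finset.mem_singleton, Finset.eq_empty_iff_forall_notMem]
    intro e he
    have := (mem_optGraphs.1 hE).1 e he
    omega
  unfold totalWeight
  rw [Finset.sum_range_zero, pow_zero, div_one]
  refine (Finset.sum_le_sum_of_subset_of_nonneg h fun E hE _ => ?_).trans ?_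
  · rw [Finset.mem_singleton.1 hE]
    simp [weight, numBack]
  · simp [weight, numBack]

lemma lastBlock_one_subset (k : ℕ) (ε σ : ℝ) (m d c : ℕ) :
    lastBlock k ε σ m d c 1 ⊆ blockGraphs k ε c d (fun _ _ => Finset.univ) (c + 1) := by
  intro E hE
  obtain ⟨h1, h2, -⟩ := Finset.mem_filter.1 hE
  exact Finset.mem_filter.2 ⟨h1, fun _ _ _ _ => Finset.mem_univ _, h2⟩

lemma exists_mem_blockGraphs {k : ℕ} {ε σ : ℝ} {m d c p : ℕ} {ι : Type} {F : Finset ι}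
    {Ω : ι → ℕ → ℕ → Finset (Fin 3)}
    (hF : ∀ T : ℕ → ℕ → Prop, (∀ u v, T u v → ¬ T v u) → ¬ HasCyc T k → OptOn T p →
      ∀ W : Finset (ℕ × ℕ), WinFam p W → (∀ I ∈ W, ¬ NiceWin T ε I.1 I.2) →
      σ * (p : ℝ) ^ 2 ≤ ∑ I ∈ W, ((I.2 - I.1 : ℕ) : ℝ) ^ 2 →
      ∃ i ∈ F, ∀ z x, z < x → x < p → status T z x ∈ Ω i z x) (hp : p ≠ 1)
    {E : Finset (ℕ × ℕ)} (hE : E ∈ lastBlock k ε σ m d c p) :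
    ∃ i ∈ F, E ∈ blockGraphs k ε c d (Ω i) (c + p) := by
  obtain ⟨h1, h2, h3⟩ := Finset.mem_filter.1 hE
  obtain ⟨-, hor, hcyc, hopt⟩ := mem_optGraphs.1 h1
  obtain ⟨-, h4⟩ := h3.resolve_left hp
  obtain ⟨W, hW1, hW2, hW3⟩ := h4.exists_winFam
  obtain ⟨i, hi, h5⟩ := hF (fun u v => arcRel E (c + u) (c + v)) (fun u v => hor _ _)
    (fun h => hcyc (hasCyc_of_comp (φ := fun u => c + u) (fun _ _ => Nat.add_left_cancel) h))
    hopt.shift W hW1 hW2 hW3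
  exact ⟨i, hi, Finset.mem_filter.2 ⟨h1, fun z x hz hx => h5 z x hz (by omega), h2⟩⟩

set_option maxHeartbeats 2000000 in
theorem exists_totalWeight_le (k : ℕ) (hk : 3 ≤ k) :
    ∃ l > 1, ∃ A ≥ 1, ∀ n : ℕ, totalWeight l k n ≤ A ^ n := by
  obtain ⟨ε, hε, m₀, hB⟩ := exists_sum_blockGraphs_le k hk
  obtain ⟨χ, hχ, hO⟩ := exists_opts_cover k hk hε
  set σ := min (1 / 9) (χ / 23328) with hσ
  have hσ0 : 0 < σ := lt_min (by norm_num) (by positivity)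
  have hσ1 : σ ≤ 1 / 9 := min_le_left _ _
  have hσ2 : σ ≤ χ / 23328 := min_le_right _ _
  obtain ⟨m₁, hm₁⟩ := hO (σ / 4) (by positivity) (by linarith)
  set m := max m₀ (max m₁ 1) with hm
  have hmm0 : m₀ ≤ m := le_max_left _ _
  have hmm1 : m₁ ≤ m := (le_max_left _ _).trans (le_max_right _ _)
  have hm1 : 1 ≤ m := (le_max_right _ _).trans (le_max_right _ _)
  set s := χ * σ / 16 with hs
  have hs0 : 0 < s := by positivity
  set l := min (11 / 10) (1 + 2 * s) with hl
  have hl1 : 1 < l := lt_min (by norm_num) (by linarith)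
  have hl2 : l ≤ 11 / 10 := min_le_left _ _
  have hl3 : (1 + l) / 2 ≤ Real.exp s := by
    have h1 : l ≤ 1 + 2 * s := min_le_right _ _
    have h2 := Real.add_one_le_exp s
    linarith
  set D : ℕ → ℕ := fun p => ⌈27 * σ * p⌉₊ + m with hD
  have hDb : ∀ p : ℕ, dZero * (D p : ℝ) ^ 2 ≤ s * (p : ℝ) ^ 2 + 2 * ((m : ℝ) + 1) ^ 2 := by
    intro p
    have h1 : (D p : ℝ) ≤ 27 * σ * p + (m + 1) := by
      have := (Nat.ceil_lt_add_one (by positivity : 0 ≤ 27 * σ * (p : ℝ))).le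
      rw [hD]
      push_cast
      linarith
    have h2 := pow_le_pow_left₀ (Nat.cast_nonneg _) h1 2
    have h3 : dZero * (D p : ℝ) ^ 2 ≤ 1 * (D p : ℝ) ^ 2 :=
      mul_le_mul_of_nonneg_right dZero_le_one (by positivity)
    have h4 := sq_nonneg (27 * σ * (p : ℝ) - (m + 1))
    have h5 : 1458 * σ ^ 2 ≤ s := by rw [hs]; nlinarith
    have h6 := mul_le_mul_of_nonneg_right h5 (sq_nonneg (p : ℝ))
    nlinarith
  set K := Real.exp (2 * ((m : ℝ) + 1) ^ 2 + 2 * s) with hK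
  have hblock : ∀ (c p : ℕ) (Ω : ℕ → ℕ → Finset (Fin 3)),
      (∑ E ∈ blockGraphs k ε c (D p) Ω (c + p), weight l (c + p) E) /
          2 ^ (∑ x ∈ Finset.range (c + p), x)
        ≤ totalWeight l k c * (10 ^ p * Real.exp (2 * s * (p : ℝ) ^ 2 + 2 * ((m : ℝ) + 1) ^ 2) *
          Real.exp (-bZero * nullPairs p Ω + dZero * fullPairs p Ω)) := by
    intro c p Ω
    refine (hB l hl1.le hl2 c (D p) p Ω (by simp only [hD]; omega)).trans ?_
    refine mul_le_mul_of_nonneg_left ?_ (totalWeight_nonneg hl1.le k c)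
    rw [mul_assoc, mul_assoc]
    refine mul_le_mul_of_nonneg_left ?_ (by positivity)
    have h1 : ((1 + l) / 2) ^ (p ^ 2) ≤ Real.exp (s * (p : ℝ) ^ 2) := by
      refine (pow_le_pow_left₀ (by linarith) hl3 _).trans (le_of_eq ?_)
      rw [← Real.exp_nat_mul]
      push_cast
      ring_nf
    refine (mul_le_mul_of_nonneg_right h1 (Real.exp_pos _).le).trans ?_
    rw [← Real.exp_add, ← Real.exp_add]
    refine Real.exp_le_exp.2 ?_
    have := hDb p
    linarith
  have hlast : ∀ c p : ℕ, 1 ≤ p →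
      (∑ E ∈ lastBlock k ε (σ / 4) m (D p) c p, weight l (c + p) E) /
        2 ^ (∑ x ∈ Finset.range (c + p), x) ≤ totalWeight l k c * (K * 10 ^ p) := by
    intro c p hp
    have hden : (0 : ℝ) < 2 ^ (∑ x ∈ Finset.range (c + p), x) := by positivity
    have htw := totalWeight_nonneg hl1.le k c
    by_cases hp1 : p = 1
    · subst hp1
      refine le_trans (div_le_div_of_nonneg_right (Finset.sum_le_sum_of_subset_of_nonneg
        (lastBlock_one_subset k ε (σ / 4) m (D 1) c) fun E _ _ => weight_nonneg hl1.le _ E) hden.le)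
        ((hblock c 1 _).trans (le_of_eq ?_))
      rw [nullPairs_one, fullPairs_one, mul_zero, mul_zero, add_zero, Real.exp_zero, mul_one, hK]
      norm_num
      left
      rw [mul_comm, add_comm]
    by_cases hpm : m ≤ p
    · obtain ⟨ι, F, Ω, h1, h2⟩ := hm₁ p (hmm1.trans hpm)
      refine le_trans (div_le_div_of_nonneg_right (sum_le_sum_of_cover
        (t := fun i => blockGraphs k ε c (D p) (Ω i) (c + p)) (weight_nonneg hl1.le _)
        fun E hE => exists_mem_blockGraphs h2 hp1 hE) hden.le) ?_
      rw [Finset.sum_div]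
      refine (Finset.sum_le_sum fun i _ => hblock c p (Ω i)).trans ?_
      rw [← Finset.mul_sum, ← Finset.mul_sum]
      refine mul_le_mul_of_nonneg_left ?_ htw
      refine (mul_le_mul_of_nonneg_left h1 (by positivity)).trans ?_
      rw [mul_assoc, ← Real.exp_add, mul_comm]
      refine mul_le_mul_of_nonneg_right (Real.exp_le_exp.2 ?_) (by positivity)
      have h3 : χ * (σ / 4) = 4 * s := by rw [hs]; ring
      have h4 : 0 ≤ s * (p : ℝ) ^ 2 := by positivity
      have h5 : -χ * (σ / 4) * (p : ℝ) ^ 2 = -4 * (s * (p : ℝ) ^ 2) := by rw [hs]; ring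
      rw [h5]
      linarith
    · have h1 : lastBlock k ε (σ / 4) m (D p) c p = ∅ := by
        refine Finset.filter_false_of_mem fun E _ h => ?_
        rcases h.2 with h | h
        · exact hp1 h
        · exact hpm h.1
      rw [h1, Finset.sum_empty, zero_div]
      positivity
  have hK0 : 0 ≤ K := (Real.exp_pos _).le
  refine ⟨l, hl1, 10 * (K + 1), by linarith, fun n =>
    exists_le_pow_of_rec (z := totalWeight l k) hK0 (totalWeight_zero_le l k) (fun n hn => ?_) n⟩
  have hcov : ∀ E ∈ optGraphs k n, ∃ p ∈ Finset.Icc 1 n,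
      E ∈ lastBlock k ε (σ / 4) m (D p) (n - p) p := by
    intro E hE
    obtain ⟨p, hp1, hp2, h1, h2⟩ :=
      exists_block (fun a b => ¬ NiceWin (arcRel E) ε a b) hσ0 hσ1 hm1 hn
    refine ⟨p, Finset.mem_Icc.2 ⟨hp1, hp2⟩, Finset.mem_filter.2 ?_⟩
    rw [Nat.sub_add_cancel hp2]
    exact ⟨hE, fun y x hy hx hxn hd => not_not.1 (h1 y x hy hx hxn hd), h2⟩
  rw [totalWeight]
  refine (div_le_div_of_nonneg_right (sum_le_sum_of_cover (weight_nonneg hl1.le n) hcov)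
    (by positivity)).trans ?_
  rw [Finset.sum_div]
  refine Finset.sum_le_sum fun p hp => ?_
  obtain ⟨hp1, hp2⟩ := Finset.mem_Icc.1 hp
  have := hlast (n - p) p hp1
  rwa [Nat.sub_add_cancel hp2] at this

/-- Few optimally ordered graphs have many backward arcs. -/
theorem exists_card_numBack_le (k : ℕ) (hk : 3 ≤ k) : ∃ l > 1, ∃ A ≥ 1, ∀ n N : ℕ,
    (((optGraphs k n).filter fun E => N ≤ numBack E).card : ℝ) * l ^ N
      ≤ A ^ n * 2 ^ (∑ x ∈ Finset.range n, x) := by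
  obtain ⟨l, hl, A, hA, h⟩ := exists_totalWeight_le k hk
  refine ⟨l, hl, A, hA, fun n N => ?_⟩
  have h1 := h n
  rw [totalWeight, div_le_iff₀ (by positivity)] at h1
  refine le_trans ?_ h1
  rw [← nsmul_eq_mul, ← Finset.sum_const]
  refine le_trans (Finset.sum_le_sum fun E hE => ?_) (Finset.sum_le_sum_of_subset_of_nonneg
    (Finset.filter_subset _ _) fun E _ _ => weight_nonneg hl.le n E)
  exact (pow_le_pow_right₀ hl.le (Finset.mem_filter.1 hE).2).trans (pow_numBack_le_weight hl.le n E)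

/-- The arc set of `E` after moving every vertex to its position in the ordering `σ`. -/
noncomputable def reorder {n : ℕ} (σ : Equiv.Perm (Fin n)) (E : ArcSet n) : Finset (ℕ × ℕ) :=
  E.image fun e => ((σ e.1 : ℕ), (σ e.2 : ℕ))

lemma reorder_map_injective {n : ℕ} (σ : Equiv.Perm (Fin n)) :
    Function.Injective fun e : Fin n × Fin n => ((σ e.1 : ℕ), (σ e.2 : ℕ)) := by
  rintro ⟨a, b⟩ ⟨c, d⟩ h
  have h' := Prod.ext_iff.1 h
  exact Prod.ext (σ.injective (Fin.ext h'.1)) (σ.injective (Fin.ext h'.2))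

lemma reorder_injective {n : ℕ} (σ : Equiv.Perm (Fin n)) : Function.Injective (reorder σ) :=
  Finset.image_injective (reorder_map_injective σ)

lemma arcRel_reorder {n : ℕ} {σ : Equiv.Perm (Fin n)} {E : ArcSet n} {u v : ℕ} :
    arcRel (reorder σ E) u v ↔ ∃ a b : Fin n, (a, b) ∈ E ∧ (σ a : ℕ) = u ∧ (σ b : ℕ) = v := by
  unfold arcRel reorder
  rw [Finset.mem_image]
  constructor
  · rintro ⟨e, he, h⟩
    have h' := Prod.ext_iff.1 h
    exact ⟨e.1, e.2, he, h'.1, h'.2⟩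
  · rintro ⟨a, b, he, rfl, rfl⟩
    exact ⟨(a, b), he, rfl⟩

lemma arcRel_reorder_apply {n : ℕ} {σ : Equiv.Perm (Fin n)} {E : ArcSet n} {a b : Fin n} :
    arcRel (reorder σ E) (σ a) (σ b) ↔ (a, b) ∈ E := by
  rw [arcRel_reorder]
  constructor
  · rintro ⟨c, d, h, h1, h2⟩
    rwa [σ.injective (Fin.ext h1), σ.injective (Fin.ext h2)] at h
  · exact fun h => ⟨a, b, h, rfl, rfl⟩

lemma containsCycle_of_hasCyc {n k : ℕ} (hk : 0 < k) {σ : Equiv.Perm (Fin n)} {E : ArcSet n}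
    (h : HasCyc (arcRel (reorder σ E)) k) : ContainsCycle k E := by
  obtain ⟨c, h1, h2, h3⟩ := h
  have : NeZero k := ⟨hk.ne'⟩
  have hstep : ∀ z : ZMod k, arcRel (reorder σ E) (c z.val) (c (z + 1).val) := by
    intro z
    have hz := z.val_lt
    by_cases hlt : z.val + 1 < k
    · have : (z + 1).val = z.val + 1 := by
        have h4 : (1 : ZMod k).val = 1 := by
          rw [ZMod.val_one_eq_one_mod, Nat.mod_eq_of_lt (by omega)]
        rw [ZMod.val_add_of_lt (by omega), h4]
      rw [this]
      exact h2 _ hlt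
    · have h4 : z.val = k - 1 := by omega
      have h5 : z + 1 = 0 := by
        rw [← ZMod.natCast_zmod_val z, h4, ← Nat.cast_add_one, Nat.sub_add_cancel hk,
          ZMod.natCast_self]
      rw [h5, h4, ZMod.val_zero]
      exact h3
  have hex : ∀ z : ZMod k, ∃ a : Fin n, (σ a : ℕ) = c z.val := by
    intro z
    obtain ⟨a, b, -, h4, -⟩ := arcRel_reorder.1 (hstep z)
    exact ⟨a, h4⟩
  choose f hf using hex
  refine ⟨f, fun y z hyz => ?_, fun z => ?_⟩
  · refine ZMod.val_injective k (h1 _ y.val_lt _ z.val_lt ?_)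
    rw [← hf, ← hf, hyz]
  · have := hstep z
    rwa [← hf, ← hf, arcRel_reorder_apply] at this

lemma card_filter_reorder {n : ℕ} (σ : Equiv.Perm (Fin n)) (E : ArcSet n) (P : ℕ → ℕ → Prop)
    [DecidablePred fun e : ℕ × ℕ => P e.1 e.2]
    [DecidablePred fun e : Fin n × Fin n => P (σ e.1) (σ e.2)] :
    ((reorder σ E).filter fun e => P e.1 e.2).card
      = (E.filter fun e => P (σ e.1) (σ e.2)).card := by
  rw [← Finset.card_image_of_injective _ (reorder_map_injective σ)]
  congr 1
  ext q
  simp only [reorder, Finset.mem_filter, Finset.mem_image]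
  constructor
  · rintro ⟨⟨e, he, rfl⟩, h⟩
    exact ⟨e, ⟨he, h⟩, rfl⟩
  · rintro ⟨e, ⟨he, h⟩, rfl⟩
    exact ⟨⟨e, he, rfl⟩, h⟩

lemma numBack_reorder {n : ℕ} (σ : Equiv.Perm (Fin n)) (E : ArcSet n) :
    numBack (reorder σ E) = backCount E σ := by
  unfold numBack backCount
  exact card_filter_reorder σ E fun u v => v < u

lemma exists_perm_lt_iff {α : Type*} [LinearOrder α] {n : ℕ} (κ : Fin n → α)
    (hκ : Function.Injective κ) : ∃ τ : Equiv.Perm (Fin n), ∀ u v, τ u < τ v ↔ κ u < κ v := by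
  have hmono : StrictMono (κ ∘ Tuple.sort κ) :=
    (Tuple.monotone_sort κ).strictMono_of_injective (hκ.comp (Tuple.sort κ).injective)
  refine ⟨(Tuple.sort κ)⁻¹, fun u v => ?_⟩
  rw [← hmono.lt_iff_lt]
  simp

lemma card_filter_arcs {n : ℕ} {E : Finset (ℕ × ℕ)} (hE : ∀ e ∈ E, e.1 < n ∧ e.2 < n)
    (P : ℕ → ℕ → Prop) [DecidablePred fun e : ℕ × ℕ => P e.1 e.2] : ((E.filter fun e => P e.1 e.2).card : ℝ)
      = ∑ q ∈ Finset.range n ×ˢ Finset.range n, ind (arcRel E q.1 q.2 ∧ P q.1 q.2) := by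
  rw [Finset.sum_product' (f := fun u v => ind (arcRel E u v ∧ P u v)), ← card_filter_square]
  congr 2
  ext e
  rw [Finset.mem_filter, Finset.mem_filter, Finset.mem_product, Finset.mem_range, Finset.mem_range]
  unfold arcRel
  constructor
  · exact fun h => ⟨hE e h.1, h⟩
  · exact fun h => h.2

/-- An ordering with the fewest backward arcs is optimal on every window. -/
lemma optOn_reorder {n : ℕ} {σ : Equiv.Perm (Fin n)} {E : ArcSet n}
    (hσ : ∀ σ', backCount E σ ≤ backCount E σ') : OptOn (arcRel (reorder σ E)) n := by
  intro a b hb ρ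
  set E' := reorder σ E with hE'
  set g : ℕ → ℕ := fun u => if a ≤ u ∧ u < b then a else u with hg
  set κ : ℕ → ℕ ×ₗ ℝ ×ₗ ℕ := fun u => toLex (g u, toLex (ρ u, u)) with hκ
  have hκinj : Function.Injective κ := fun u v huv => by
    have h1 := congrArg (fun x : ℕ ×ₗ ℝ ×ₗ ℕ => (ofLex (ofLex x).2).2) huv
    simpa [hκ] using h1
  have hκlt : ∀ u v, κ v < κ u ↔ g v < g u ∨ g v = g u ∧ (ρ v < ρ u ∨ ρ v = ρ u ∧ v < u) := by
    intro u v
    simp only [hκ, Prod.Lex.toLex_lt_toLex]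
  obtain ⟨τ, hτ⟩ := exists_perm_lt_iff (fun u : Fin n => κ u) (hκinj.comp Fin.val_injective)
  have hmem : ∀ e ∈ E', e.1 < n ∧ e.2 < n := by
    intro e he
    obtain ⟨e', -, rfl⟩ := Finset.mem_image.1 he
    exact ⟨(σ e'.1).2, (σ e'.2).2⟩
  have h1 := hσ (σ.trans τ)
  have h2 : backCount E σ = (E'.filter fun e => e.2 < e.1).card := by
    rw [← numBack_reorder]
    rfl
  have h3 : backCount E (σ.trans τ) = (E'.filter fun e => κ e.2 < κ e.1).card := by
    refine Eq.trans ?_ (card_filter_reorder σ E fun u v => κ v < κ u).symm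
    unfold backCount
    refine congrArg Finset.card (Finset.filter_congr fun e _ => ?_)
    exact hτ _ _
  rw [h2, h3, ← Nat.cast_le (α := ℝ)] at h1
  have h4 := card_filter_arcs hmem fun u v => v < u
  have h5 := card_filter_arcs hmem fun u v => κ v < κ u
  have h6 : ∑ q ∈ Finset.range n ×ˢ Finset.range n, ind (arcRel E' q.1 q.2 ∧ q.2 < q.1)
      ≤ ∑ q ∈ Finset.range n ×ˢ Finset.range n, ind (arcRel E' q.1 q.2 ∧ κ q.2 < κ q.1) := by
    exact (h4.symm.le.trans h1).trans h5.le
  have hsub : Finset.Ico a b ×ˢ Finset.Ico a b ⊆ Finset.range n ×ˢ Finset.range n := by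
    have : Finset.Ico a b ⊆ Finset.range n := fun x hx =>
      Finset.mem_range.2 ((Finset.mem_Ico.1 hx).2.trans_le hb)
    exact Finset.product_subset_product this this
  rw [← Finset.sum_sdiff hsub, ← Finset.sum_sdiff hsub] at h6
  have h7 : ∑ q ∈ (Finset.range n ×ˢ Finset.range n) \ (Finset.Ico a b ×ˢ Finset.Ico a b),
        ind (arcRel E' q.1 q.2 ∧ q.2 < q.1)
      = ∑ q ∈ (Finset.range n ×ˢ Finset.range n) \ (Finset.Ico a b ×ˢ Finset.Ico a b),
        ind (arcRel E' q.1 q.2 ∧ κ q.2 < κ q.1) := by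
    refine Finset.sum_congr rfl fun q hq => ?_
    have h8 := (Finset.mem_sdiff.1 hq).2
    rw [Finset.mem_product, Finset.mem_Ico, Finset.mem_Ico] at h8
    have h9 : κ q.2 < κ q.1 ↔ q.2 < q.1 := by
      by_cases huv : q.2 = q.1
      · rw [huv]
        exact ⟨fun h => absurd h (lt_irrefl _), fun h => absurd h (lt_irrefl _)⟩
      rw [hκlt]
      have h10 : g q.2 ≠ g q.1 := by
        simp only [hg]
        split_ifs <;> omega
      have h11 : g q.2 < g q.1 ↔ q.2 < q.1 := by
        simp only [hg]
        split_ifs <;> omega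
      rw [h11]
      exact or_iff_left fun h => h10 h.1
    rw [h9]
  rw [h7] at h6
  have h8 := le_of_add_le_add_left h6
  rw [Finset.sum_product' (f := fun u v => ind (arcRel E' u v ∧ v < u)),
    Finset.sum_product' (f := fun u v => ind (arcRel E' u v ∧ κ v < κ u))] at h8
  refine h8.trans (Finset.sum_le_sum fun u hu => Finset.sum_le_sum fun v hv => ind_mono ?_)
  rintro ⟨h9, h10⟩
  refine ⟨h9, ?_⟩
  have hgu : g u = a := if_pos (Finset.mem_Ico.1 hu)
  have hgv : g v = a := if_pos (Finset.mem_Ico.1 hv)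
  rw [hκlt, hgu, hgv] at h10
  rcases h10 with h | ⟨-, h | h⟩
  · exact absurd h (lt_irrefl _)
  · exact h.le
  · exact h.1.le

lemma reorder_mem_optGraphs {n k : ℕ} (hk : 0 < k) {σ : Equiv.Perm (Fin n)} {E : ArcSet n}
    (hor : IsOriented E) (hE : CkFree k E) (hσ : ∀ σ', backCount E σ ≤ backCount E σ') :
    reorder σ E ∈ optGraphs k n := by
  refine mem_optGraphs.2 ⟨fun e he => ?_, fun u v huv hvu => ?_,
    fun h => hE (containsCycle_of_hasCyc hk h), optOn_reorder hσ⟩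
  · obtain ⟨e', -, rfl⟩ := Finset.mem_image.1 he
    exact ⟨(σ e'.1).2, (σ e'.2).2⟩
  · obtain ⟨a, b, h, rfl, rfl⟩ := arcRel_reorder.1 huv
    exact hor.2 a b h (arcRel_reorder_apply.1 hvu)

lemma exists_optimal {n : ℕ} (E : ArcSet n) : ∃ σ : Equiv.Perm (Fin n),
    backCount E σ = bMin E ∧ ∀ σ', backCount E σ ≤ backCount E σ' := by
  obtain ⟨σ, -, h⟩ := Finset.exists_mem_eq_inf' Finset.univ_nonempty (backCount E)
  refine ⟨σ, h.symm, fun σ' => ?_⟩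
  rw [← h]
  exact Finset.inf'_le _ (Finset.mem_univ _)

lemma card_bMin_ge_le {n k : ℕ} (hk : 0 < k) (N : ℕ) :
    (Finset.univ.filter fun E : ArcSet n => IsOriented E ∧ CkFree k E ∧ N ≤ bMin E).card
      ≤ n.factorial * ((optGraphs k n).filter fun E => N ≤ numBack E).card := by
  choose σ h1 h2 using fun E : ArcSet n => exists_optimal E
  have h3 : n.factorial = (Finset.univ : Finset (Equiv.Perm (Fin n))).card := by
    rw [Finset.card_univ, Fintype.card_perm, Fintype.card_fin]
  rw [h3, ← Finset.card_product]
  refine Finset.card_le_card_of_injOn (fun E => (σ E, reorder (σ E) E)) (fun E hE => ?_)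
    fun E _ E' _ h => ?_
  · obtain ⟨-, h4, h5, h6⟩ := Finset.mem_filter.1 hE
    refine Finset.mem_product.2 ⟨Finset.mem_univ _, Finset.mem_filter.2
      ⟨reorder_mem_optGraphs hk h4 h5 (h2 E), ?_⟩⟩
    rw [numBack_reorder, h1]
    exact h6
  · obtain ⟨h4, h5⟩ := Prod.ext_iff.1 h
    simp only at h4 h5
    rw [← h4] at h5
    exact reorder_injective _ h5

/-- The pairs of non-consecutive positions in increasing order. -/
def farPairs (n : ℕ) : Finset (ℕ × ℕ) :=
  (Finset.range n ×ˢ Finset.range n).filter fun q => q.1 + 1 < q.2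

lemma sum_range_le_card_farPairs (n : ℕ) : ∑ x ∈ Finset.range n, x ≤ (farPairs n).card + n := by
  have h1 : (farPairs n).card
      = ∑ j ∈ Finset.range n, ((Finset.range n).filter fun i => i + 1 < j).card := by
    unfold farPairs
    rw [Finset.card_filter, Finset.sum_product_right]
    exact Finset.sum_congr rfl fun j _ => (Finset.card_filter _ _).symm
  have h2 : n = ∑ _j ∈ Finset.range n, 1 := by simp
  rw [h1]
  refine le_trans ?_ (Nat.add_le_add_left h2.ge _)
  rw [← Finset.sum_add_distrib]
  refine Finset.sum_le_sum fun j hj => ?_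
  have hj' := Finset.mem_range.1 hj
  have h3 : Finset.range (j - 1) ⊆ (Finset.range n).filter fun i => i + 1 < j := fun i hi => by
    have := Finset.mem_range.1 hi
    exact Finset.mem_filter.2 ⟨Finset.mem_range.2 (by omega), by omega⟩
  have h4 := Finset.card_le_card h3
  rw [Finset.card_range] at h4
  omega

/-- The graph whose arcs, in the ordering `σ`, are all consecutive pairs and the pairs in `S`. -/
noncomputable def pathGraph {n : ℕ} (σ : Equiv.Perm (Fin n)) (S : Finset (ℕ × ℕ)) : ArcSet n :=
  Finset.univ.filter fun e => (σ e.1 : ℕ) + 1 = σ e.2 ∨ ((σ e.1 : ℕ), (σ e.2 : ℕ)) ∈ S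

lemma mem_pathGraph {n : ℕ} {σ : Equiv.Perm (Fin n)} {S : Finset (ℕ × ℕ)} {a b : Fin n} :
    (a, b) ∈ pathGraph σ S ↔ (σ a : ℕ) + 1 = σ b ∨ ((σ a : ℕ), (σ b : ℕ)) ∈ S := by
  unfold pathGraph
  rw [Finset.mem_filter, and_iff_right (Finset.mem_univ _)]

lemma lt_of_mem_pathGraph {n : ℕ} {σ : Equiv.Perm (Fin n)} {S : Finset (ℕ × ℕ)}
    (hS : S ⊆ farPairs n) {a b : Fin n} (h : (a, b) ∈ pathGraph σ S) : (σ a : ℕ) < σ b := by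
  rcases mem_pathGraph.1 h with h | h
  · omega
  · have := (Finset.mem_filter.1 (hS h)).2
    simp only at this
    omega

lemma isOriented_pathGraph {n : ℕ} {σ : Equiv.Perm (Fin n)} {S : Finset (ℕ × ℕ)}
    (hS : S ⊆ farPairs n) : IsOriented (pathGraph σ S) :=
  ⟨fun _ h => lt_irrefl _ (lt_of_mem_pathGraph hS h),
    fun _ _ h h' => lt_asymm (lt_of_mem_pathGraph hS h) (lt_of_mem_pathGraph hS h')⟩

lemma ckFree_pathGraph {n k : ℕ} (hk : 0 < k) {σ : Equiv.Perm (Fin n)} {S : Finset (ℕ × ℕ)}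
    (hS : S ⊆ farPairs n) : CkFree k (pathGraph σ S) := by
  rintro ⟨f, -, hf⟩
  have : NeZero k := ⟨hk.ne'⟩
  obtain ⟨i, hi⟩ := Finite.exists_max fun i : ZMod k => (σ (f i) : ℕ)
  exact absurd (lt_of_mem_pathGraph hS (hf i)) (hi (i + 1)).not_gt

lemma perm_eq_one_of_lt {n : ℕ} {τ : Equiv.Perm (Fin n)}
    (h : ∀ i j : Fin n, (i : ℕ) + 1 = j → τ i < τ j) : τ = 1 := by
  have h1 : ∀ d : ℕ, ∀ i j : Fin n, (i : ℕ) + d + 1 = j → τ i < τ j := by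
    intro d
    induction d with
    | zero => exact h
    | succ d ih =>
      intro i j hij
      have hlt : (i : ℕ) + d + 1 < n := by omega
      exact (ih i ⟨i + d + 1, hlt⟩ rfl).trans (h ⟨i + d + 1, hlt⟩ j hij)
  have hmono : StrictMono τ := fun i j hij =>
    h1 (j - i - 1) i j (by have := Fin.lt_def.1 hij; omega)
  have hmono' : StrictMono τ.symm := fun i j hij => by
    rw [← hmono.lt_iff_lt, Equiv.apply_symm_apply, Equiv.apply_symm_apply]
    exact hij
  ext1 i
  refine le_antisymm ?_ hmono.le_apply
  have := hmono'.le_apply (x := τ i)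
  rwa [Equiv.symm_apply_apply] at this

lemma pathGraph_injOn (n : ℕ) : Set.InjOn
    (fun q : Equiv.Perm (Fin n) × Finset (ℕ × ℕ) => pathGraph q.1 q.2)
    ↑((Finset.univ : Finset (Equiv.Perm (Fin n))) ×ˢ (farPairs n).powerset) := by
  rintro ⟨σ, S⟩ hS ⟨σ', S'⟩ hS' h
  have hS1 := Finset.mem_powerset.1 (Finset.mem_product.1 (Finset.mem_coe.1 hS)).2
  have hS2 := Finset.mem_powerset.1 (Finset.mem_product.1 (Finset.mem_coe.1 hS')).2
  simp only at h hS1 hS2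
  have hσ : σ.symm.trans σ' = 1 := by
    refine perm_eq_one_of_lt fun i j hij => ?_
    have h1 : (σ.symm i, σ.symm j) ∈ pathGraph σ S := mem_pathGraph.2 (Or.inl (by simpa using hij))
    rw [h] at h1
    have h2 := lt_of_mem_pathGraph hS2 h1
    exact h2
  have hσσ : σ = σ' := by
    ext1 a
    have := Equiv.congr_fun hσ (σ a)
    simpa using this.symm
  subst hσσ
  have hsub : ∀ S S' : Finset (ℕ × ℕ), S ⊆ farPairs n → pathGraph σ S = pathGraph σ S' → S ⊆ S' := by
    rintro S S' h1 h2 ⟨i, j⟩ hij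
    obtain ⟨h3, h4⟩ := Finset.mem_filter.1 (h1 hij)
    obtain ⟨h5, h6⟩ := Finset.mem_product.1 h3
    have h5' := Finset.mem_range.1 h5
    have h6' := Finset.mem_range.1 h6
    simp only at h4 h5' h6'
    have h7 : (σ.symm ⟨i, h5'⟩, σ.symm ⟨j, h6'⟩) ∈ pathGraph σ S :=
      mem_pathGraph.2 (Or.inr (by simpa using hij))
    rw [h2, mem_pathGraph] at h7
    simp only [Equiv.apply_symm_apply] at h7
    exact h7.resolve_left (by omega)
  rw [(hsub S S' hS1 h).antisymm (hsub S' S hS2 h.symm)]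

lemma factorial_mul_le_fnk (n : ℕ) {k : ℕ} (hk : 0 < k) :
    n.factorial * 2 ^ (∑ x ∈ Finset.range n, x) ≤ fnk n k * 2 ^ n := by
  have h1 : n.factorial * 2 ^ (farPairs n).card ≤ fnk n k := by
    have h3 : n.factorial = (Finset.univ : Finset (Equiv.Perm (Fin n))).card := by
      rw [Finset.card_univ, Fintype.card_perm, Fintype.card_fin]
    rw [h3, ← Finset.card_powerset, ← Finset.card_product]
    refine Finset.card_le_card_of_injOn (fun q => pathGraph q.1 q.2) (fun q hq => ?_)
      (pathGraph_injOn n)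
    have hS := Finset.mem_powerset.1 (Finset.mem_product.1 (Finset.mem_coe.1 hq)).2
    exact Finset.mem_coe.2 (Finset.mem_filter.2
      ⟨Finset.mem_univ _, isOriented_pathGraph hS, ckFree_pathGraph hk hS⟩)
  calc n.factorial * 2 ^ (∑ x ∈ Finset.range n, x)
      ≤ n.factorial * 2 ^ ((farPairs n).card + n) :=
        Nat.mul_le_mul_left _ (Nat.pow_le_pow_right two_pos (sum_range_le_card_farPairs n))
    _ = n.factorial * 2 ^ (farPairs n).card * 2 ^ n := by rw [pow_add, mul_assoc]
    _ ≤ fnk n k * 2 ^ n := Nat.mul_le_mul_right _ h1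

lemma fnk_pos (n : ℕ) {k : ℕ} (hk : 0 < k) : 0 < fnk n k := by
  have h := factorial_mul_le_fnk n hk
  have h1 : 0 < n.factorial * 2 ^ (∑ x ∈ Finset.range n, x) :=
    Nat.mul_pos n.factorial_pos (by positivity)
  exact pos_of_mul_pos_left (h1.trans_le h) (Nat.zero_le _)

theorem exists_card_bMin_ge_le (k : ℕ) (hk : 3 ≤ k) : ∃ c : ℕ, 0 < c ∧ ∀ n : ℕ,
    ((Finset.univ.filter fun E : ArcSet n => IsOriented E ∧ CkFree k E ∧ c * n ≤ bMin E).card : ℝ)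
      ≤ (1 / 2) ^ n * fnk n k := by
  obtain ⟨l, hl, A, hA, h⟩ := exists_card_numBack_le k hk
  obtain ⟨c, hc⟩ := pow_unbounded_of_one_lt (4 * A) hl
  refine ⟨c, ?_, fun n => ?_⟩
  · rcases Nat.eq_zero_or_pos c with rfl | h0
    · rw [pow_zero] at hc
      linarith
    · exact h0
  have h1 : ((Finset.univ.filter fun E : ArcSet n =>
      IsOriented E ∧ CkFree k E ∧ c * n ≤ bMin E).card : ℝ)
      ≤ n.factorial * ((optGraphs k n).filter fun E => c * n ≤ numBack E).card := by
    exact_mod_cast card_bMin_ge_le (by omega) (c * n)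
  have h2 := h n (c * n)
  have h3 : (n.factorial : ℝ) * 2 ^ (∑ x ∈ Finset.range n, x) ≤ fnk n k * 2 ^ n := by
    exact_mod_cast factorial_mul_le_fnk n (by omega : 0 < k)
  set b : ℝ := ((Finset.univ.filter fun E : ArcSet n =>
      IsOriented E ∧ CkFree k E ∧ c * n ≤ bMin E).card : ℝ)
  set o : ℝ := (((optGraphs k n).filter fun E => c * n ≤ numBack E).card : ℝ)
  have hAn : 0 < A ^ n := by positivity
  have h4 : (4 * A) ^ n ≤ l ^ (c * n) := by
    rw [pow_mul]
    exact pow_le_pow_left₀ (by linarith) hc.le n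
  have h5 : b * (4 * A) ^ n ≤ fnk n k * 2 ^ n * A ^ n := by
    calc b * (4 * A) ^ n ≤ n.factorial * o * l ^ (c * n) := by gcongr
      _ = n.factorial * (o * l ^ (c * n)) := by ring
      _ ≤ n.factorial * (A ^ n * 2 ^ (∑ x ∈ Finset.range n, x)) := by gcongr
      _ = n.factorial * 2 ^ (∑ x ∈ Finset.range n, x) * A ^ n := by ring
      _ ≤ fnk n k * 2 ^ n * A ^ n := by gcongr
  have h6 : (4 * A) ^ n = 2 ^ n * (2 ^ n * A ^ n) := by
    rw [← mul_pow, ← mul_pow]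
    ring_nf
  have h7 : (1 / 2 : ℝ) ^ n * 2 ^ n = 1 := by
    rw [← mul_pow]
    norm_num
  rw [h6] at h5
  have h8 : b * 2 ^ n ≤ fnk n k := by
    refine le_of_mul_le_mul_right (a := 2 ^ n * A ^ n) ?_ (by positivity)
    linarith
  calc b = (1 / 2) ^ n * (b * 2 ^ n) := by linear_combination -b * h7
    _ ≤ (1 / 2) ^ n * fnk n k := by gcongr

end BackArcs

/-- For `k ≥ 3` there is `C > 0` such that almost all
`C_k`-free oriented graphs on `[n]` satisfy `b(G) ≤ C n`. -/
theorem almost_all_linear_upper_bound (k : ℕ) (hk : 3 ≤ k) :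
    ∃ C : ℝ, 0 < C ∧
      Filter.Tendsto
        (fun n : ℕ =>
          (((Finset.univ.filter fun E : ArcSet n =>
              IsOriented E ∧ CkFree k E ∧ (bMin E : ℝ) ≤ C * n).card : ℝ) /
            (fnk n k : ℝ)))
        Filter.atTop (nhds 1) := by
  obtain ⟨c, hc, h⟩ := BackArcs.exists_card_bMin_ge_le k hk
  refine ⟨c, by exact_mod_cast hc, ?_⟩
  have hlim : Filter.Tendsto (fun n : ℕ => 1 - (1 / 2 : ℝ) ^ n) Filter.atTop (nhds 1) := by
    have := (tendsto_pow_atTop_nhds_zero_of_lt_one (by norm_num : (0 : ℝ) ≤ 1 / 2)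
      (by norm_num)).const_sub 1
    rwa [sub_zero] at this
  refine tendsto_of_tendsto_of_tendsto_of_le_of_le hlim tendsto_const_nhds (fun n => ?_) fun n => ?_
  · have hpos : (0 : ℝ) < fnk n k := by exact_mod_cast BackArcs.fnk_pos n (by omega : 0 < k)
    simp only
    rw [le_div_iff₀ hpos]
    have hsub : (Finset.univ.filter fun E : ArcSet n => IsOriented E ∧ CkFree k E) ⊆
        (Finset.univ.filter fun E : ArcSet n =>
          IsOriented E ∧ CkFree k E ∧ (bMin E : ℝ) ≤ c * n) ∪
        (Finset.univ.filter fun E : ArcSet n =>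
          IsOriented E ∧ CkFree k E ∧ c * n ≤ bMin E) := by
      intro E hE
      obtain ⟨h1, h2, h3⟩ := Finset.mem_filter.1 hE
      rw [Finset.mem_union, Finset.mem_filter, Finset.mem_filter]
      rcases le_total (bMin E) (c * n) with h4 | h4
      · exact Or.inl ⟨h1, h2, h3, by exact_mod_cast h4⟩
      · exact Or.inr ⟨h1, h2, h3, h4⟩
    have h1 := (Finset.card_le_card hsub).trans (Finset.card_union_le _ _)
    have h2 : (fnk n k : ℝ) ≤ _ := Nat.cast_le.2 h1
    rw [Nat.cast_add] at h2
    have h3 := h n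
    linarith
  · refine div_le_one_of_le₀ (Nat.cast_le.2 (Finset.card_le_card fun E hE => ?_)) (Nat.cast_nonneg _)
    obtain ⟨h1, h2, h3, -⟩ := Finset.mem_filter.1 hE
    exact Finset.mem_filter.2 ⟨h1, h2, h3⟩
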